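/- Let n, m, n', m' be positive integers with n + m = n' + m' and let μ, μ' > 0. If f is a proper holomorphic mapping of the Fock–Bargmann–Hartogs domain D_{n,m}(μ) into D_{n',m'}(μ'), then f extends holomorphically past the boundary: there exist an open set G ⊆ ℂ^{n+m} containing the closure of D_{n,m}(μ) and a holomorphic map F : G → ℂ^{n'+m'} such that F(x) = f(x) for all x ∈ D_{n,m}(μ). -/

import Mathlib

/-- The Fock–Bargmann–Hartogs domain
`D_{n,m}(μ) = {(z,w) ∈ ℂ^n × ℂ^m : ‖w‖² < exp (−μ‖z‖²)}`. -/
def FBH (n m : ℕ) (μ : ℝ) :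
    Set (EuclideanSpace ℂ (Fin n) × EuclideanSpace ℂ (Fin m)) :=
  {p | ‖p.2‖ ^ 2 < Real.exp (-μ * ‖p.1‖ ^ 2)}

section
open MeasureTheory Metric Set Filter Topology

namespace FBHProof

theorem line_diffAt {E F : Type*} [NormedAddCommGroup E] [NormedSpace ℂ E]
    [NormedAddCommGroup F] [NormedSpace ℂ F] {g : E → F} {x v : E} {t : ℂ}
    (hg : DifferentiableAt ℂ g (x + t • v)) :
    DifferentiableAt ℂ (fun t : ℂ => g (x + t • v)) t := by
  have h : DifferentiableAt ℂ (fun t : ℂ => x + t • v) t := by fun_prop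
  exact DifferentiableAt.comp t (f := fun t : ℂ => x + t • v) hg h

theorem line_deriv {E F : Type*} [NormedAddCommGroup E] [NormedSpace ℂ E]
    [NormedAddCommGroup F] [NormedSpace ℂ F] {g : E → F} {x v : E}
    (hg : DifferentiableAt ℂ g x) :
    deriv (fun t : ℂ => g (x + t • v)) 0 = fderiv ℂ g x v := by
  have h : HasDerivAt (fun t : ℂ => x + t • v) v 0 := by
    simpa using ((hasDerivAt_id (0:ℂ)).smul_const v).const_add x
  have hg' : HasFDerivAt g (fderiv ℂ g x) (x + (0:ℂ) • v) := by simpa using hg.hasFDerivAt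
  exact (hg'.comp_hasDerivAt (0:ℂ) h).deriv

theorem cauchy_bound {E F : Type*} [NormedAddCommGroup E] [NormedSpace ℂ E]
    [NormedAddCommGroup F] [NormedSpace ℂ F] {g : E → F} {x : E} {R C : ℝ} (hR : 0 < R)
    (hg : DifferentiableOn ℂ g (ball x R)) (hb : ∀ y ∈ ball x R, ‖g y‖ ≤ C) :
    ‖fderiv ℂ g x‖ ≤ 2 / R * C := by
  have hC : 0 ≤ C := (norm_nonneg _).trans (hb x (mem_ball_self hR))
  refine ContinuousLinearMap.opNorm_le_bound _ (by positivity) fun v => ?_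
  by_cases hv : v = 0
  · simp [hv]
  have hv' : 0 < ‖v‖ := norm_pos_iff.mpr hv
  have hmem : ∀ t ∈ closedBall (0:ℂ) (R / (2 * ‖v‖)), x + t • v ∈ ball x R := by
    intro t ht
    rw [mem_closedBall_zero_iff] at ht
    rw [mem_ball, dist_eq_norm, add_sub_cancel_left, norm_smul]
    calc ‖t‖ * ‖v‖ ≤ R / (2 * ‖v‖) * ‖v‖ := by gcongr
      _ = R / 2 := by field_simp
      _ < R := by linarith
  have hd : DifferentiableOn ℂ (fun t : ℂ => g (x + t • v)) (closedBall (0:ℂ) (R / (2 * ‖v‖))) :=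
    fun t ht => (line_diffAt (hg.differentiableAt (isOpen_ball.mem_nhds (hmem t ht)))).differentiableWithinAt
  have hρ : 0 < R / (2 * ‖v‖) := by positivity
  have := Complex.norm_deriv_le_of_forall_mem_sphere_norm_le hρ
    (hd.diffContOnCl_ball subset_rfl)
    (fun t ht => hb _ (hmem t (sphere_subset_closedBall ht)))
  rw [line_deriv (hg.differentiableAt (isOpen_ball.mem_nhds (mem_ball_self hR)))] at this
  calc _ ≤ _ := this
    _ = _ := by field_simp

theorem aesm_fderiv {ι α : Type*} [Fintype ι] [DecidableEq ι] [MeasurableSpace α] {μ : Measure α}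
    {U : Set (ι → ℂ)} (hU : IsOpen U) {g : (ι → ℂ) → α → ℂ}
    (hd : ∀ᵐ a ∂μ, DifferentiableOn ℂ (fun x => g x a) U)
    (hm : ∀ x ∈ U, AEStronglyMeasurable (g x) μ) {x : ι → ℂ} (hx : x ∈ U) :
    AEStronglyMeasurable (fun a => fderiv ℂ (fun x => g x a) x) μ := by
  have key : ∀ v : ι → ℂ, AEStronglyMeasurable (fun a => fderiv ℂ (fun x => g x a) x v) μ := by
    intro v
    have ht : Tendsto (fun k : ℕ => x + (((k:ℂ) + 1)⁻¹) • v) atTop (𝓝 x) := by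
      have h1 : Tendsto (fun k : ℕ => (((k:ℂ) + 1)⁻¹)) atTop (𝓝 0) := by
        have := tendsto_one_div_add_atTop_nhds_zero_nat (𝕜 := ℂ)
        simpa using this
      simpa using (h1.smul_const v).const_add x
    obtain ⟨K, hK⟩ := eventually_atTop.1 (ht.eventually (hU.mem_nhds hx))
    refine aestronglyMeasurable_of_tendsto_ae (atTop : Filter ℕ)
      (f := fun k a => (((k + K : ℕ) : ℂ) + 1) * (g (x + ((((k+K : ℕ):ℂ) + 1)⁻¹) • v) a - g x a)) ?_ ?_
    · intro k
      exact ((hm _ (hK (k+K) (by omega))).sub (hm x hx)).const_mul _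
    · filter_upwards [hd] with a ha
      have h0 : HasFDerivAt (fun x => g x a) (fderiv ℂ (fun x => g x a) x) x :=
        (ha.differentiableAt (hU.mem_nhds hx)).hasFDerivAt
      have h2 := h0.lim v (l := (atTop : Filter ℕ)) (c := fun k : ℕ => ((k:ℂ) + 1)) ?_ 
      · simp only [smul_eq_mul] at h2
        exact h2.comp (tendsto_add_atTop_nat K)
      · have : Tendsto (fun k : ℕ => (k:ℝ) + 1) atTop atTop :=
          tendsto_atTop_add_const_right _ _ tendsto_natCast_atTop_atTop
        refine this.congr fun k => ?_
        have : ((k:ℂ) + 1) = ((k + 1 : ℝ) : ℂ) := by push_cast; rfl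
        rw [this, Complex.norm_real, Real.norm_of_nonneg (by positivity)]
  have heq : (fun a => fderiv ℂ (fun x => g x a) x) = fun a => ∑ i : ι,
      (fderiv ℂ (fun x => g x a) x (Pi.single i 1)) •
        (ContinuousLinearMap.proj i : (ι → ℂ) →L[ℂ] ℂ) := by
    funext a
    ext v
    conv_lhs => rw [pi_eq_sum_univ' v]
    simp [map_sum, mul_comm]
  rw [heq]
  exact Finset.aestronglyMeasurable_fun_sum _ fun i _ => (key _).smul_const _

theorem holo_integral {ι α : Type*} [Fintype ι] [MeasurableSpace α] {μ : Measure α}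
    {U : Set (ι → ℂ)} (hU : IsOpen U) {g : (ι → ℂ) → α → ℂ}
    (hd : ∀ᵐ a ∂μ, DifferentiableOn ℂ (fun x => g x a) U)
    (hm : ∀ x ∈ U, AEStronglyMeasurable (g x) μ)
    (hb : ∀ x ∈ U, ∃ r > 0, ∃ b : α → ℝ, Integrable b μ ∧
      ∀ᵐ a ∂μ, ∀ y ∈ ball x r, ‖g y a‖ ≤ b a) :
    DifferentiableOn ℂ (fun x => ∫ a, g x a ∂μ) U := by
  classical
  intro x hx
  obtain ⟨r₁, hr₁, hr₁U⟩ := Metric.isOpen_iff.1 hU x hx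
  obtain ⟨r₂, hr₂, b, hbi, hbb⟩ := hb x hx
  set r := min r₁ r₂ with hr
  have hr0 : 0 < r := lt_min hr₁ hr₂
  have hsub : ball x r ⊆ U := (ball_subset_ball (min_le_left _ _)).trans hr₁U
  have hsub2 : ball x r ⊆ ball x r₂ := ball_subset_ball (min_le_right _ _)
  have hy : ∀ y ∈ ball x (r/2), ball y (r/2) ⊆ ball x r := by
    intro y hy z hz
    rw [mem_ball] at *
    linarith [dist_triangle z y x]
  refine (hasFDerivAt_integral_of_dominated_of_fderiv_le (𝕜 := ℂ) (s := ball x (r/2))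
    (F' := fun x a => fderiv ℂ (fun x => g x a) x) (bound := fun a => 2 / (r/2) * b a)
    (ball_mem_nhds x (by positivity)) ?_ ?_ (aesm_fderiv hU hd hm hx) ?_ (hbi.const_mul _) ?_).differentiableAt.differentiableWithinAt
  · filter_upwards [hU.mem_nhds hx] with y hy using hm y hy
  · refine hbi.mono' (hm x hx) ?_
    filter_upwards [hbb] with a ha using ha x (mem_ball_self hr₂)
  · filter_upwards [hd, hbb] with a had hab y hyb
    exact cauchy_bound (by positivity) (had.mono ((hy y hyb).trans hsub))
      fun z hz => hab z (hsub2 (hy y hyb hz))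
  · filter_upwards [hd] with a ha y hyb
    refine (ha.differentiableAt (hU.mem_nhds (hsub ?_))).hasFDerivAt
    exact hy y hyb (mem_ball_self (by positivity))

/-- parametrised integrals over the circle -/
theorem holo_circle {ι : Type*} [Fintype ι] {U : Set (ι → ℂ)} (hU : IsOpen U)
    {g : (ι → ℂ) → ℝ → ℂ} (hd : ∀ a, DifferentiableOn ℂ (fun x => g x a) U)
    (hc : ContinuousOn (Function.uncurry g) (U ×ˢ univ)) :
    DifferentiableOn ℂ (fun x => ∫ a in Ioc (0:ℝ) (2 * Real.pi), g x a) U := by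
  refine holo_integral hU (ae_of_all _ hd) ?_ ?_
  · intro x hx
    have : Continuous (g x) := by
      have h : ContinuousOn (fun a => Function.uncurry g (x, a)) univ :=
        hc.comp (by fun_prop) (fun a _ => ⟨hx, mem_univ _⟩)
      simpa using continuousOn_univ.1 h
    exact this.aestronglyMeasurable
  · intro x hx
    obtain ⟨r, hr, hrU⟩ := Metric.isOpen_iff.1 hU x hx
    have hK : IsCompact ((closedBall x (r/2)) ×ˢ (Icc (0:ℝ) (2 * Real.pi))) :=
      (isCompact_closedBall x _).prod isCompact_Icc
    obtain ⟨C, hC⟩ := hK.exists_bound_of_continuousOn (f := Function.uncurry g) (hc.mono (by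
      rintro ⟨y, a⟩ ⟨hy, _⟩
      exact ⟨hrU (closedBall_subset_ball (by linarith) hy), mem_univ _⟩))
    refine ⟨r/2, by positivity, fun _ => C, ?_, ?_⟩
    · exact integrable_const C
    · refine (ae_restrict_iff' measurableSet_Ioc).2 (ae_of_all _ fun a ha y hy => ?_)
      exact hC (y, a) ⟨ball_subset_closedBall hy, Ioc_subset_Icc_self ha⟩

/-- Directional derivatives of holomorphic functions are holomorphic. -/
theorem fderiv_holo {ι : Type*} [Fintype ι] {U : Set (ι → ℂ)} (hU : IsOpen U)
    {g : (ι → ℂ) → ℂ} (hg : DifferentiableOn ℂ g U) (v : ι → ℂ) :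
    DifferentiableOn ℂ (fun x => fderiv ℂ g x v) U := by
  intro x hx
  obtain ⟨r, hr, hrU⟩ := Metric.isOpen_iff.1 hU x hx
  set ρ : ℝ := r / (2 * (‖v‖ + 1)) with hρ
  have hρ0 : 0 < ρ := by positivity
  have hρv : ρ * ‖v‖ < r / 2 := by
    rw [hρ, div_mul_eq_mul_div, div_lt_div_iff₀ (by positivity) (by positivity)]
    nlinarith [norm_nonneg v]
  have hmem : ∀ y ∈ ball x (r/2), ∀ t : ℂ, ‖t‖ ≤ ρ → y + t • v ∈ U := by
    intro y hy t ht
    apply hrU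
    rw [mem_ball, dist_eq_norm] at *
    calc ‖y + t • v - x‖ = ‖(y - x) + t • v‖ := by congr 1; abel
      _ ≤ ‖y - x‖ + ‖t‖ * ‖v‖ := (norm_add_le _ _).trans (by rw [norm_smul])
      _ ≤ ‖y - x‖ + ρ * ‖v‖ := by gcongr
      _ < r := by linarith
  have hcm : ∀ a : ℝ, ‖circleMap 0 ρ a‖ ≤ ρ := by
    intro a; rw [norm_circleMap_zero, abs_of_pos hρ0]
  have key := holo_circle (U := ball x (r/2)) isOpen_ball
    (g := fun y a => (2 * Real.pi * Complex.I : ℂ)⁻¹ * (deriv (circleMap 0 ρ) a *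
      (((circleMap 0 ρ a) ^ 2)⁻¹ * g (y + circleMap 0 ρ a • v)))) ?_ ?_
  · refine ((key.congr (f₁ := fun x => fderiv ℂ g x v) ?_).differentiableAt
      (ball_mem_nhds x (half_pos hr))).differentiableWithinAt
    intro y hy
    have hyU : y ∈ U := by simpa using hmem y hy 0 (by simpa using hρ0.le)
    rw [← line_deriv (hg.differentiableAt (hU.mem_nhds hyU))]
    have hV : IsOpen {t : ℂ | y + t • v ∈ U} := hU.preimage (by fun_prop)
    rw [← Complex.two_pi_I_inv_smul_circleIntegral_sub_sq_inv_smul_of_differentiable hV (c := 0)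
      (R := ρ) ?_ ?_ (mem_ball_self hρ0)]
    · rw [circleIntegral, intervalIntegral.integral_of_le (by positivity)]
      simp only [smul_eq_mul, sub_zero]
      rw [integral_const_mul]
    · intro t ht
      exact hmem y hy t (by simpa using ht)
    · intro t ht
      exact (line_diffAt (hg.differentiableAt (hU.mem_nhds ht))).differentiableWithinAt
  · intro a y hy
    have : DifferentiableAt ℂ (fun y => g (y + circleMap 0 ρ a • v)) y := by
      have h1 : DifferentiableAt ℂ g (y + circleMap 0 ρ a • v) :=
        hg.differentiableAt (hU.mem_nhds (hmem y hy _ (hcm a)))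
      exact DifferentiableAt.comp y (f := fun y => y + circleMap 0 ρ a • v) h1 (by fun_prop)
    exact (((this.const_mul _).const_mul _).const_mul _).differentiableWithinAt
  · have h1 : ContinuousOn (fun p : (ι → ℂ) × ℝ => g (p.1 + circleMap 0 ρ p.2 • v))
        (ball x (r/2) ×ˢ univ) := by
      refine hg.continuousOn.comp ?_ ?_
      · have := continuous_circleMap 0 ρ
        fun_prop
      · rintro ⟨y, a⟩ ⟨hy, _⟩
        exact hmem y hy _ (hcm a)
    have h2 : Continuous (fun p : (ι → ℂ) × ℝ => (2 * Real.pi * Complex.I : ℂ)⁻¹ *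
        (deriv (circleMap 0 ρ) p.2 * (((circleMap 0 ρ p.2) ^ 2)⁻¹))) := by
      have h3 := continuous_circleMap 0 ρ
      have h4 : Continuous fun p : (ι → ℂ) × ℝ => ((circleMap 0 ρ p.2) ^ 2)⁻¹ :=
        Continuous.inv₀ (by fun_prop) fun p => pow_ne_zero _ (by
          exact circleMap_ne_center hρ0.ne')
      simp only [deriv_circleMap]
      fun_prop
    refine (h2.continuousOn.mul h1).congr ?_
    rintro ⟨y, a⟩ _
    simp only [Function.uncurry, Pi.mul_apply]
    ring

theorem fderiv_holo' {ι : Type*} [Fintype ι] {U : Set (ι → ℂ)} (hU : IsOpen U)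
    {g : (ι → ℂ) → ℂ} (hg : DifferentiableOn ℂ g U) :
    DifferentiableOn ℂ (fun x => fderiv ℂ g x) U := by
  classical
  have heq : (fun x => fderiv ℂ g x) = fun x => ∑ i : ι,
      (fderiv ℂ g x (Pi.single i 1)) •
        (ContinuousLinearMap.proj i : (ι → ℂ) →L[ℂ] ℂ) := by
    funext a
    ext v
    conv_lhs => rw [pi_eq_sum_univ' v]
    simp [map_sum, mul_comm]
  rw [heq]
  refine DifferentiableOn.fun_sum fun i _ => ?_
  exact (fderiv_holo hU hg _).smul_const _

theorem holo_symm {ι : Type*} [Fintype ι] {U : Set (ι → ℂ)} (hU : IsOpen U)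
    {g : (ι → ℂ) → ℂ} (hg : DifferentiableOn ℂ g U) {x : ι → ℂ} (hx : x ∈ U) (v w : ι → ℂ) :
    fderiv ℂ (fun y => fderiv ℂ g y v) x w = fderiv ℂ (fun y => fderiv ℂ g y w) x v := by
  have h1 : ∀ᶠ y in 𝓝 x, HasFDerivAt g (fderiv ℂ g y) y := by
    filter_upwards [hU.mem_nhds hx] with y hy
    exact (hg.differentiableAt (hU.mem_nhds hy)).hasFDerivAt
  have hd := (fderiv_holo' hU hg).differentiableAt (hU.mem_nhds hx)
  have h2 := second_derivative_symmetric_of_eventually h1 hd.hasFDerivAt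
  have h3 : ∀ v, HasFDerivAt (fun y => fderiv ℂ g y v)
      ((ContinuousLinearMap.apply ℂ ℂ v).comp (fderiv ℂ (fun y => fderiv ℂ g y) x)) x := by
    intro v
    exact (ContinuousLinearMap.apply ℂ ℂ v).hasFDerivAt.comp x hd.hasFDerivAt
  rw [(h3 v).fderiv, (h3 w).fderiv]
  simpa using h2 w v

end FBHProof
end

section
open MeasureTheory Metric Set Filter Topology

namespace FBHProof

variable {ι : Type*} [Fintype ι] [DecidableEq ι]

/-- Jacobian matrix. -/
noncomputable def jac (f : (ι → ℂ) → (ι → ℂ)) (x : ι → ℂ) : Matrix ι ι ℂ :=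
  Matrix.of fun k i => fderiv ℂ (fun y => f y k) x (Pi.single i 1)

/-- Jacobian determinant. -/
noncomputable def jdet (f : (ι → ℂ) → (ι → ℂ)) (x : ι → ℂ) : ℂ := (jac f x).det

/-- Wirtinger derivative. -/
noncomputable def wirt (g : (ι → ℂ) → ℂ) (i : ι) (x : ι → ℂ) : ℂ :=
  (fderiv ℝ g x (Pi.single i 1) - Complex.I * fderiv ℝ g x (Complex.I • Pi.single i 1)) / 2

theorem wirt_of_hasFDerivAt {g : (ι → ℂ) → ℂ} {i : ι} {x : ι → ℂ} {L : (ι → ℂ) →L[ℝ] ℂ}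
    (h : HasFDerivAt g L x) :
    wirt g i x = (L (Pi.single i 1) - Complex.I * L (Complex.I • Pi.single i 1)) / 2 := by
  rw [wirt, h.fderiv]

theorem wirt_mul {g₁ g₂ : (ι → ℂ) → ℂ} {i : ι} {x : ι → ℂ}
    (h₁ : DifferentiableAt ℝ g₁ x) (h₂ : DifferentiableAt ℝ g₂ x) :
    wirt (fun y => g₁ y * g₂ y) i x = wirt g₁ i x * g₂ x + g₁ x * wirt g₂ i x := by
  have h : HasFDerivAt (fun y => g₁ y * g₂ y) _ x := h₁.hasFDerivAt.mul h₂.hasFDerivAt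
  rw [wirt_of_hasFDerivAt h, wirt, wirt]
  simp only [ContinuousLinearMap.add_apply, ContinuousLinearMap.smul_apply, smul_eq_mul]
  ring

theorem wirt_holo {g : (ι → ℂ) → ℂ} {i : ι} {x : ι → ℂ} (h : DifferentiableAt ℂ g x) :
    wirt g i x = fderiv ℂ g x (Pi.single i 1) := by
  rw [wirt_of_hasFDerivAt (h.hasFDerivAt.restrictScalars ℝ)]
  simp only [ContinuousLinearMap.coe_restrictScalars', map_smul, smul_eq_mul]
  linear_combination (-(fderiv ℂ g x (Pi.single i 1)) / 2) * Complex.I_mul_I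

theorem wirt_conj {g : (ι → ℂ) → ℂ} {i : ι} {x : ι → ℂ} (h : DifferentiableAt ℂ g x) :
    wirt (fun y => (starRingEnd ℂ) (g y)) i x = 0 := by
  have := (Complex.conjCLE.toContinuousLinearMap.hasFDerivAt).comp x
    (h.hasFDerivAt.restrictScalars ℝ)
  have h2 : HasFDerivAt (fun y => (starRingEnd ℂ) (g y)) _ x := this
  rw [wirt_of_hasFDerivAt h2]
  simp
  ring_nf
  simp

theorem wirt_comp {θ : (ι → ℂ) → ℂ} {f : (ι → ℂ) → (ι → ℂ)} {i : ι} {x : ι → ℂ}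
    (hθ : DifferentiableAt ℝ θ (f x)) (hf : ∀ k, DifferentiableAt ℂ (fun y => f y k) x) :
    wirt (fun y => θ (f y)) i x = ∑ k, wirt θ k (f x) * jac f x k i := by
  have hf' : HasFDerivAt f (ContinuousLinearMap.pi fun k => fderiv ℂ (fun y => f y k) x) x :=
    hasFDerivAt_pi.2 fun k => (hf k).hasFDerivAt
  have h2 : HasFDerivAt (fun y => θ (f y)) _ x :=
    hθ.hasFDerivAt.comp x (hf'.restrictScalars ℝ)
  rw [wirt_of_hasFDerivAt h2]
  set L := fderiv ℝ θ (f x)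
  set v : ι → ℂ := fun k => fderiv ℂ (fun y => f y k) x (Pi.single i 1)
  have e1 : (L.comp ((ContinuousLinearMap.pi fun k => fderiv ℂ (fun y => f y k) x).restrictScalars ℝ))
      (Pi.single i 1) = L v := rfl
  have e2 : (L.comp ((ContinuousLinearMap.pi fun k => fderiv ℂ (fun y => f y k) x).restrictScalars ℝ))
      (Complex.I • Pi.single i 1) = L (Complex.I • v) := by
    simp only [ContinuousLinearMap.comp_apply, ContinuousLinearMap.coe_restrictScalars', map_smul]
    rfl
  rw [e1, e2]
  have key : ∀ c : ℂ, ∀ k, L (c • Pi.single k 1) - Complex.I * L (Complex.I • c • Pi.single k 1) =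
      c * (L (Pi.single k 1) - Complex.I * L (Complex.I • Pi.single k 1)) := by
    intro c k
    have h1 : c • (Pi.single k 1 : ι → ℂ) = c.re • (Pi.single k (1:ℂ) : ι → ℂ) + c.im • (Complex.I • (Pi.single k (1:ℂ) : ι → ℂ)) := by
      conv_lhs => rw [← Complex.re_add_im c]
      rw [add_smul, mul_smul]
      simp only [Complex.coe_smul]
    have h3 : Complex.I • c • (Pi.single k 1 : ι → ℂ) = c.re • (Complex.I • (Pi.single k (1:ℂ) : ι → ℂ)) - c.im • (Pi.single k (1:ℂ) : ι → ℂ) := by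
      rw [h1, smul_add, smul_comm Complex.I c.re, smul_comm Complex.I c.im, smul_smul Complex.I Complex.I, Complex.I_mul_I]
      simp [sub_eq_add_neg]
    rw [h3, h1]
    simp only [map_add, map_sub, map_smul, Complex.real_smul]
    conv_rhs => rw [← Complex.re_add_im c]
    ring_nf
    simp
  have hv : v = ∑ k, v k • (Pi.single k 1 : ι → ℂ) := pi_eq_sum_univ' v
  rw [hv, Finset.smul_sum, map_sum, map_sum, Finset.mul_sum, ← Finset.sum_sub_distrib, Finset.sum_div]
  refine Finset.sum_congr rfl fun k _ => ?_
  rw [key]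
  simp only [wirt, jac, Matrix.of_apply]
  ring

theorem contDiffOn_holo {U : Set (ι → ℂ)} (hU : IsOpen U) {g : (ι → ℂ) → ℂ}
    (hg : DifferentiableOn ℂ g U) : ContDiffOn ℝ 1 g U := by
  have : ContDiffOn ℂ (0 + 1) g U :=
    (contDiffOn_succ_iff_fderiv_of_isOpen hU).2 ⟨hg, by simp,
      contDiffOn_zero.2 (fderiv_holo' hU hg).continuousOn⟩
  rw [zero_add] at this
  exact this.restrict_scalars ℝ

theorem jac_holo {U : Set (ι → ℂ)} (hU : IsOpen U) {f : (ι → ℂ) → (ι → ℂ)}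
    (hf : ∀ k, DifferentiableOn ℂ (fun y => f y k) U) (k i : ι) :
    DifferentiableOn ℂ (fun x => jac f x k i) U := fderiv_holo hU (hf k) _

/-- the determinant as a continuous multilinear map in rows -/
noncomputable def detC : ContinuousMultilinearMap ℂ (fun _ : ι => (ι → ℂ)) ℂ where
  toMultilinearMap := (Matrix.detRowAlternating (n := ι) (R := ℂ)).toMultilinearMap
  cont := by
    change Continuous fun M : Matrix ι ι ℂ => M.det
    fun_prop

theorem detC_apply (M : Matrix ι ι ℂ) : detC (fun k => M k) = M.det := rfl

theorem hasFDerivAt_det {x : ι → ℂ} {N : (ι → ℂ) → Matrix ι ι ℂ}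
    {N' : ι → (ι → ℂ) →L[ℂ] (ι → ℂ)} (h : ∀ k, HasFDerivAt (fun y => N y k) (N' k) x) :
    HasFDerivAt (fun y => (N y).det)
      ((detC.linearDeriv (fun k => N x k)).comp (ContinuousLinearMap.pi N')) x := by
  have h1 : HasFDerivAt (fun y => (fun k => N y k : ι → ι → ℂ)) (ContinuousLinearMap.pi N') x :=
    hasFDerivAt_pi.2 h
  exact (detC.hasFDerivAt (fun k => N x k)).comp x h1

theorem jdet_holo {U : Set (ι → ℂ)} (hU : IsOpen U) {f : (ι → ℂ) → (ι → ℂ)}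
    (hf : ∀ k, DifferentiableOn ℂ (fun y => f y k) U) : DifferentiableOn ℂ (jdet f) U := by
  intro x hx
  have h : ∀ k, DifferentiableAt ℂ (fun y => jac f y k) x := fun k =>
    differentiableAt_pi.2 fun i => (jac_holo hU hf k i).differentiableAt (hU.mem_nhds hx)
  exact (hasFDerivAt_det (N := jac f) fun k => (h k).hasFDerivAt).differentiableAt.differentiableWithinAt

theorem row_deriv {U : Set (ι → ℂ)} (hU : IsOpen U) {f : (ι → ℂ) → (ι → ℂ)}
    (hf : ∀ k, DifferentiableOn ℂ (fun y => f y k) U) (j i : ι) {x : ι → ℂ} (hx : x ∈ U) (k : ι) :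
    HasFDerivAt (fun y => ((jac f y).updateRow j (Pi.single i 1)) k)
      (if k = j then 0 else ContinuousLinearMap.pi fun l => fderiv ℂ (fun y => jac f y k l) x) x := by
  by_cases hk : k = j
  · subst hk
    simp only [Matrix.updateRow_self, if_true]
    exact hasFDerivAt_const _ _
  · simp only [Matrix.updateRow_ne hk, if_neg hk]
    exact hasFDerivAt_pi.2 fun l =>
      ((jac_holo hU hf k l).differentiableAt (hU.mem_nhds hx)).hasFDerivAt

theorem cof_diff {U : Set (ι → ℂ)} (hU : IsOpen U) {f : (ι → ℂ) → (ι → ℂ)}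
    (hf : ∀ k, DifferentiableOn ℂ (fun y => f y k) U) (j i : ι) :
    DifferentiableOn ℂ (fun y => (jac f y).adjugate i j) U := by
  intro x hx
  simp only [Matrix.adjugate_apply]
  exact (hasFDerivAt_det (row_deriv hU hf j i hx)).differentiableAt.differentiableWithinAt

theorem piola {U : Set (ι → ℂ)} (hU : IsOpen U) {f : (ι → ℂ) → (ι → ℂ)}
    (hf : ∀ k, DifferentiableOn ℂ (fun y => f y k) U) (j : ι) {x : ι → ℂ} (hx : x ∈ U) :
    ∑ i, fderiv ℂ (fun y => (jac f y).adjugate i j) x (Pi.single i 1) = 0 := by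
  have h1 : ∀ i, fderiv ℂ (fun y => (jac f y).adjugate i j) x (Pi.single i 1) =
      ∑ k ∈ Finset.univ.erase j, ∑ l, fderiv ℂ (fun y => jac f y k l) x (Pi.single i 1) *
        (((jac f x).updateRow j (Pi.single i 1)).updateRow k (Pi.single l 1)).det := by
    intro i
    simp only [Matrix.adjugate_apply]
    rw [(hasFDerivAt_det (row_deriv hU hf j i hx)).fderiv, ContinuousLinearMap.comp_apply,
      ContinuousMultilinearMap.linearDeriv_apply, ← Finset.sum_erase_add _ _ (Finset.mem_univ j)]
    have hz : detC (Function.update (fun k => (jac f x).updateRow j (Pi.single i 1) k) j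
        ((ContinuousLinearMap.pi fun k => (if k = j then 0 else ContinuousLinearMap.pi fun l => fderiv ℂ (fun y => jac f y k l) x)) (Pi.single i 1) j)) = 0 := by
      simp only [ContinuousLinearMap.coe_pi', if_true]
      exact detC.map_update_zero _ _
    rw [hz, add_zero]
    refine Finset.sum_congr rfl fun k hk => ?_
    have hkj : k ≠ j := Finset.ne_of_mem_erase hk
    simp only [ContinuousLinearMap.coe_pi', if_neg hkj]
    rw [pi_eq_sum_univ' (fun l => fderiv ℂ (fun y => jac f y k l) x (Pi.single i 1)),
      show ∀ (m : ι → ι → ℂ) (g : ι → ι → ℂ), detC (Function.update m k (∑ l, g l)) = ∑ l, detC (Function.update m k (g l)) from fun m g => detC.toMultilinearMap.map_update_sum Finset.univ k g m]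
    refine Finset.sum_congr rfl fun l _ => ?_
    rw [ContinuousMultilinearMap.map_update_smul]
    rfl
  simp only [h1]
  rw [Finset.sum_comm]
  refine Finset.sum_eq_zero fun k hk => ?_
  have hkj : k ≠ j := Finset.ne_of_mem_erase hk
  have hanti : ∀ i l, (((jac f x).updateRow j (Pi.single i 1)).updateRow k (Pi.single l 1)).det =
      - (((jac f x).updateRow j (Pi.single l 1)).updateRow k (Pi.single i 1)).det := by
    intro i l
    have := (Matrix.detRowAlternating (n := ι) (R := ℂ)).map_swap
      (((jac f x).updateRow j (Pi.single l 1)).updateRow k (Pi.single i 1)) hkj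
    change Matrix.detRowAlternating _ = - Matrix.detRowAlternating _
    rw [← this]
    congr 1
    funext a
    change _ = (((jac f x).updateRow j (Pi.single l 1)).updateRow k (Pi.single i 1)) (Equiv.swap k j a)
    by_cases ha : a = k
    · subst ha
      rw [Equiv.swap_apply_left, Matrix.updateRow_self, Matrix.updateRow_ne hkj.symm, Matrix.updateRow_self]
    by_cases ha' : a = j
    · subst ha'
      rw [Equiv.swap_apply_right, Matrix.updateRow_self, Matrix.updateRow_ne hkj.symm, Matrix.updateRow_self]
    · rw [Equiv.swap_apply_of_ne_of_ne ha ha', Matrix.updateRow_ne ha,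
        Matrix.updateRow_ne ha, Matrix.updateRow_ne ha', Matrix.updateRow_ne ha']
  have hsymm : ∀ i l, fderiv ℂ (fun y => jac f y k l) x (Pi.single i 1) =
      fderiv ℂ (fun y => jac f y k i) x (Pi.single l 1) := fun i l => holo_symm hU (hf k) hx _ _
  set S := ∑ i, ∑ l, fderiv ℂ (fun y => jac f y k l) x (Pi.single i 1) *
        (((jac f x).updateRow j (Pi.single i 1)).updateRow k (Pi.single l 1)).det with hS
  have : S = -S := by
    conv_lhs => rw [hS, Finset.sum_comm]
    rw [hS, ← Finset.sum_neg_distrib]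
    refine Finset.sum_congr rfl fun i _ => ?_
    rw [← Finset.sum_neg_distrib]
    refine Finset.sum_congr rfl fun l _ => ?_
    rw [hanti, hsymm]
    ring
  linear_combination (1/2 : ℂ) * this

theorem integral_fderiv_zero {g : (ι → ℂ) → ℂ} (hg : ContDiff ℝ 1 g) (hc : HasCompactSupport g)
    (v : ι → ℂ) : Integrable (fun x => fderiv ℝ g x v) ∧ ∫ x, fderiv ℝ g x v = 0 := by
  have hcont : Continuous fun x => fderiv ℝ g x v :=
    (hg.continuous_fderiv one_ne_zero).clm_apply continuous_const
  have hi : Integrable (fun x => fderiv ℝ g x v) := by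
    refine hcont.integrable_of_hasCompactSupport ?_
    exact hc.fderiv_apply ℝ v
  refine ⟨hi, ?_⟩
  have := integral_mul_fderiv_eq_neg_fderiv_mul_of_integrable (μ := (volume : Measure (ι → ℂ)))
    (f := fun _ => (1:ℂ)) (g := g) (v := v) (by simp) (by simpa using hi)
    (by simpa using hg.continuous.integrable_of_hasCompactSupport hc)
    (by intro x _; fun_prop) (by intro x _; exact (hg.differentiable one_ne_zero) x)
  simpa using this

theorem div_zero_integral {D : Set (ι → ℂ)} (hD : IsOpen D) {f : (ι → ℂ) → (ι → ℂ)}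
    (hf : ∀ k, DifferentiableOn ℂ (fun y => f y k) D) {h : (ι → ℂ) → ℂ}
    (hh : DifferentiableOn ℂ h D) {θ : (ι → ℂ) → ℂ} (hθ : ContDiff ℝ 1 θ) {K : Set (ι → ℂ)}
    (hK : ∀ ζ ∉ K, θ ζ = 0) (hc : IsCompact (f ⁻¹' K ∩ D)) (j : ι) :
    IntegrableOn (fun x => jdet f x * wirt θ j (f x) * (starRingEnd ℂ) (h x)) D ∧
    ∫ x in D, jdet f x * wirt θ j (f x) * (starRingEnd ℂ) (h x) = 0 := by
  classical
  set V : ι → (ι → ℂ) → ℂ := fun i y =>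
    (jac f y).adjugate i j * θ (f y) * (starRingEnd ℂ) (h y) with hV
  set v : ι → (ι → ℂ) → ℂ := fun i => D.indicator (V i) with hv
  have hvD : ∀ i, ∀ x ∈ D, v i =ᶠ[𝓝 x] V i := by
    intro i x hx
    filter_upwards [hD.mem_nhds hx] with y hy
    simp [hv, hy]
  have hvC : ∀ i, ∀ x ∉ f ⁻¹' K ∩ D, v i x = 0 := by
    intro i x hx
    by_cases hxD : x ∈ D
    · have : f x ∉ K := fun h => hx ⟨h, hxD⟩
      simp [hv, hV, hK _ this]
    · simp [hv, hxD]
  have hvN : ∀ i, ∀ x ∉ D, v i =ᶠ[𝓝 x] fun _ => 0 := by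
    intro i x hx
    filter_upwards [hc.isClosed.isOpen_compl.mem_nhds (x := x) (fun h => hx h.2)] with y hy
    exact hvC i y hy
  have hfD : ContDiffOn ℝ 1 f D := contDiffOn_pi.2 fun k => contDiffOn_holo hD (hf k)
  have hvs : ∀ i, ContDiff ℝ 1 (v i) := by
    intro i
    rw [contDiff_iff_contDiffAt]
    intro x
    by_cases hx : x ∈ D
    · refine ContDiffAt.congr_of_eventuallyEq ?_ (hvD i x hx)
      have hxn := hD.mem_nhds hx
      refine ((((contDiffOn_holo hD (cof_diff hD hf j i)).contDiffAt hxn)).mul ?_).mul ?_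
      · exact hθ.contDiffAt.comp x (hfD.contDiffAt hxn)
      · exact (Complex.conjCLE.contDiff.contDiffAt).comp x ((contDiffOn_holo hD hh).contDiffAt hxn)
    · exact contDiffAt_const.congr_of_eventuallyEq (hvN i x hx)
  have hvc : ∀ i, HasCompactSupport (v i) := fun i =>
    HasCompactSupport.intro hc (fun x hx => hvC i x hx)
  have hpt : ∀ x, ∑ i, wirt (v i) i x =
      D.indicator (fun x => jdet f x * wirt θ j (f x) * (starRingEnd ℂ) (h x)) x := by
    intro x
    by_cases hx : x ∈ D
    · rw [indicator_of_mem hx]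
      have hxn := hD.mem_nhds hx
      have hdf : ∀ k, DifferentiableAt ℂ (fun y => f y k) x := fun k => (hf k).differentiableAt hxn
      have hdr : DifferentiableAt ℝ f x := differentiableAt_pi.2 fun k => (hdf k).restrictScalars ℝ
      have hdθ : DifferentiableAt ℝ θ (f x) := (hθ.differentiable one_ne_zero) _
      have hdc : ∀ i, DifferentiableAt ℂ (fun y => (jac f y).adjugate i j) x := fun i =>
        (cof_diff hD hf j i).differentiableAt hxn
      have hdh : DifferentiableAt ℂ h x := hh.differentiableAt hxn
      have hdhc : DifferentiableAt ℝ (fun y => (starRingEnd ℂ) (h y)) x :=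
        (Complex.conjCLE.differentiableAt).comp x (hdh.restrictScalars ℝ)
      have hdθf : DifferentiableAt ℝ (fun y => θ (f y)) x := hdθ.comp x hdr
      have e : ∀ i, wirt (v i) i x =
          fderiv ℂ (fun y => (jac f y).adjugate i j) x (Pi.single i 1) * (θ (f x) * (starRingEnd ℂ) (h x))
          + (∑ k, wirt θ k (f x) * (jac f x k i * (jac f x).adjugate i j)) * (starRingEnd ℂ) (h x) := by
        intro i
        have : wirt (v i) i x = wirt (V i) i x := by
          rw [wirt, wirt, (hvD i x hx).fderiv_eq]
        rw [this, hV]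
        rw [wirt_mul (g₁ := fun y => (jac f y).adjugate i j * θ (f y)) (((hdc i).restrictScalars ℝ).mul hdθf) hdhc,
          wirt_mul ((hdc i).restrictScalars ℝ) hdθf, wirt_conj hdh, wirt_holo (hdc i), wirt_comp hdθ hdf]
        simp only [← mul_assoc]
        rw [← Finset.sum_mul]
        ring
      simp only [e]
      rw [Finset.sum_add_distrib, ← Finset.sum_mul, piola hD hf j hx, zero_mul, zero_add,
        ← Finset.sum_mul, Finset.sum_comm]
      congr 1
      simp only [← Finset.mul_sum]
      have hm : ∀ k, ∑ i, jac f x k i * (jac f x).adjugate i j = if k = j then jdet f x else 0 := by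
        intro k
        have := congrFun (congrFun (Matrix.mul_adjugate (jac f x)) k) j
        rw [Matrix.mul_apply] at this
        rw [this]
        simp [Matrix.one_apply, jdet]
      simp only [hm]
      simp [mul_comm]
    · rw [indicator_of_notMem hx]
      refine Finset.sum_eq_zero fun i _ => ?_
      rw [wirt, (hvN i x hx).fderiv_eq]
      simp
  have hwi : ∀ i, Integrable (fun x => wirt (v i) i x) ∧ ∫ x, wirt (v i) i x = 0 := by
    intro i
    obtain ⟨a1, a2⟩ := integral_fderiv_zero (hvs i) (hvc i) (Pi.single i 1)
    obtain ⟨b1, b2⟩ := integral_fderiv_zero (hvs i) (hvc i) (Complex.I • Pi.single i 1)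
    refine ⟨(a1.sub (b1.const_mul Complex.I)).div_const 2, ?_⟩
    simp only [wirt]
    rw [integral_div, integral_sub a1 (b1.const_mul Complex.I), integral_const_mul, a2, b2]
    simp
  constructor
  · rw [← integrable_indicator_iff hD.measurableSet]
    have := integrable_finsetSum Finset.univ (fun i _ => (hwi i).1)
    exact this.congr (ae_of_all _ hpt)
  · rw [← integral_indicator hD.measurableSet, ← integral_congr_ae (ae_of_all _ hpt),
      integral_finsetSum _ (fun i _ => (hwi i).1)]
    exact Finset.sum_eq_zero fun i _ => (hwi i).2

end FBHProof
end

section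
open MeasureTheory Metric Set Filter Topology

namespace FBHProof

/-- one dimensional test functions -/
def Tst (U : Set ℝ) (A : ℝ → ℝ) : Prop :=
  ContDiff ℝ 1 A ∧ ∃ α β, α ≤ β ∧ Icc α β ⊆ U ∧ ∀ x ∉ Icc α β, A x = 0

theorem Tst.comb {U : Set ℝ} [OrdConnected U] {A B : ℝ → ℝ} (hA : Tst U A) (hB : Tst U B) (c d : ℝ) :
    Tst U (fun x => c * A x - d * B x) := by
  obtain ⟨hA, α, β, hab, hU, h0⟩ := hA
  obtain ⟨hB, α', β', hab', hU', h0'⟩ := hB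
  refine ⟨by fun_prop, min α α', max β β', ?_, ?_, ?_⟩
  · exact (min_le_left _ _).trans (hab.trans (le_max_left _ _))
  · refine OrdConnected.out inferInstance ?_ ?_
    · rcases min_choice α α' with h | h <;> rw [h]
      · exact hU ⟨le_rfl, hab⟩
      · exact hU' ⟨le_rfl, hab'⟩
    · rcases max_choice β β' with h | h <;> rw [h]
      · exact hU ⟨hab, le_rfl⟩
      · exact hU' ⟨hab', le_rfl⟩
  · intro x hx
    have h1 : x ∉ Icc α β := fun h => hx ⟨(min_le_left _ _).trans h.1, h.2.trans (le_max_left _ _)⟩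
    have h2 : x ∉ Icc α' β' := fun h => hx ⟨(min_le_right _ _).trans h.1, h.2.trans (le_max_right _ _)⟩
    simp [h0 x h1, h0' x h2]

theorem Tst.hasCompactSupport {U : Set ℝ} {A : ℝ → ℝ} (hA : Tst U A) : HasCompactSupport A := by
  obtain ⟨hA, α, β, hab, hU, h0⟩ := hA
  exact HasCompactSupport.intro isCompact_Icc h0

theorem Tst.integrable {U : Set ℝ} {A W : ℝ → ℝ} (hA : Tst U A) (hW : Continuous W) :
    Integrable (fun x => A x * W x) :=
  (hA.1.continuous.mul hW).integrable_of_hasCompactSupport (hA.hasCompactSupport.mul_right)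

theorem ode1 {U : Set ℝ} (hU : U ⊆ Ioi 0) {A : ℝ → ℝ} (hA : Tst U A) (p : ℕ) (c : ℝ)
    (h0 : ∫ x, A x * (x ^ p * Real.exp (-c * x)) = 0) :
    ∃ a, Tst U a ∧ ∀ x, ((p + 1 : ℝ) - c * x) * a x + x * deriv a x = A x := by
  have hintg := hA.integrable (W := fun x => x ^ p * Real.exp (-c * x)) (by fun_prop)
  obtain ⟨hAd, α, β, hab, hUa, hz⟩ := hA
  have hα : 0 < α := hU (hUa ⟨le_rfl, hab⟩)
  set w : ℝ → ℝ := fun x => A x * (x ^ p * Real.exp (-c * x)) with hw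
  have hwc : Continuous w := by have := hAd.continuous; fun_prop
  set I : ℝ → ℝ := fun x => ∫ t in (0:ℝ)..x, w t with hI
  have hwz : ∀ x ∉ Icc α β, w x = 0 := fun x hx => by simp [hw, hz x hx]
  have hId : ∀ x, HasDerivAt I (w x) x := fun x => by
    exact intervalIntegral.integral_hasDerivAt_right (hwc.intervalIntegrable _ _)
      hwc.stronglyMeasurable.stronglyMeasurableAtFilter hwc.continuousAt
  have hI1 : ∀ x, x < α → I x = 0 := by
    intro x hx
    rw [hI]
    refine (intervalIntegral.integral_congr (g := fun _ => 0) ?_).trans (by simp)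
    intro t ht
    refine hwz t fun h => ?_
    have : t ≤ max 0 x := ht.2
    have := h.1
    have : max 0 x < α := max_lt hα hx
    linarith
  have hI2 : ∀ x, β < x → I x = 0 := by
    intro x hx
    rw [hI]
    dsimp only
    rw [intervalIntegral.integral_of_le (by linarith), ← h0]
    refine setIntegral_eq_integral_of_forall_compl_eq_zero fun t ht => ?_
    refine hwz t fun h => ht ⟨by linarith [h.1], by linarith [h.2]⟩
  set a : ℝ → ℝ := fun x => (x ^ (p+1))⁻¹ * Real.exp (c * x) * I x with ha
  have haz : ∀ x ∉ Icc α β, a x = 0 := by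
    intro x hx
    have : I x = 0 := by
      by_cases h : x < α
      · exact hI1 x h
      · exact hI2 x (by by_contra h'; exact hx ⟨not_lt.1 h, not_lt.1 h'⟩)
    simp [ha, this]
  have hIc : ContDiff ℝ 1 I := by
    rw [contDiff_one_iff_deriv]
    refine ⟨fun x => (hId x).differentiableAt, ?_⟩
    have : deriv I = w := funext fun x => (hId x).deriv
    rwa [this]
  have hev : ∀ x, x < α → a =ᶠ[𝓝 x] fun _ => 0 := by
    intro x hx
    filter_upwards [Iio_mem_nhds hx] with y hy
    exact haz y fun h => not_lt.2 h.1 hy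
  refine ⟨a, ⟨?_, α, β, hab, hUa, haz⟩, ?_⟩
  · rw [contDiff_iff_contDiffAt]
    intro x
    by_cases hx : x < α
    · exact contDiffAt_const.congr_of_eventuallyEq (hev x hx)
    · have hx0 : x ≠ 0 := by linarith
      refine ContDiffAt.mul (ContDiffAt.mul (ContDiffAt.inv (by fun_prop) (pow_ne_zero _ hx0)) (by fun_prop)) hIc.contDiffAt
  · intro x
    by_cases hx : x < α
    · have hn : x ∉ Icc α β := fun h => not_lt.2 h.1 hx
      rw [haz x hn, hz x hn, (hev x hx).deriv_eq]
      simp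
    · have hx0 : x ≠ 0 := by linarith
      have h1 : HasDerivAt (fun x : ℝ => (x ^ (p+1))⁻¹) (-(((p+1 : ℕ):ℝ) * x ^ p) / (x ^ (p+1))^2) x := by
        have := (hasDerivAt_pow (p+1) x).fun_inv (pow_ne_zero _ hx0)
        simpa using this
      have h2 : HasDerivAt (fun x : ℝ => Real.exp (c * x)) (Real.exp (c * x) * c) x := by
        have := ((hasDerivAt_id x).const_mul c).exp
        simpa using this
      have h3 : HasDerivAt a _ x := (h1.mul h2).mul (hId x)
      rw [h3.deriv]
      simp only [ha, hw, Pi.mul_apply]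
      have : Real.exp (-c * x) = (Real.exp (c * x))⁻¹ := by rw [← Real.exp_neg]; ring_nf
      rw [this]
      have he := Real.exp_pos (c * x)
      field_simp
      push_cast
      ring

theorem int_of_compact {ι : Type*} [Fintype ι] {D C : Set (ι → ℂ)} (hD : IsOpen D) (hC : IsCompact C)
    (hCD : C ⊆ D) {g : (ι → ℂ) → ℂ} (hg : ContinuousOn g D) (h0 : ∀ x ∈ D, x ∉ C → g x = 0) :
    IntegrableOn g D := by
  have h1 : IntegrableOn g C := (hg.mono hCD).integrableOn_compact hC
  rw [← integrable_indicator_iff hD.measurableSet]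
  rw [← integrable_indicator_iff hC.measurableSet] at h1
  refine h1.congr (ae_of_all _ fun x => ?_)
  by_cases hx : x ∈ C
  · simp [hx, hCD hx]
  · by_cases hxD : x ∈ D
    · simp [hx, hxD, h0 x hxD hx]
    · simp [hx, hxD]

end FBHProof
end

section
open MeasureTheory Metric Set Filter Topology

namespace FBHProof

variable {ι : Type*} [Fintype ι] [DecidableEq ι]

/-- squared norm of the coordinates in `S` -/
noncomputable def XX (S : Finset ι) (ζ : ι → ℂ) : ℝ := ∑ i ∈ S, ‖ζ i‖ ^ 2

/-- defining function -/
noncomputable def sg (S : Finset ι) (μ : ℝ) (ζ : ι → ℂ) : ℝ := XX Sᶜ ζ * Real.exp (μ * XX S ζ)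

/-- model domain -/
def Dm (S : Finset ι) (μ : ℝ) : Set (ι → ℂ) := {ζ | sg S μ ζ < 1}

theorem XX_contDiff (S : Finset ι) : ContDiff ℝ 1 (XX S) := by
  unfold XX
  refine ContDiff.sum fun i _ => ?_
  exact (contDiff_apply ℝ ℂ i).norm_sq ℝ

theorem sg_contDiff (S : Finset ι) (μ : ℝ) : ContDiff ℝ 1 (sg S μ) := by
  unfold sg
  have := XX_contDiff (ι := ι) S
  have := XX_contDiff (ι := ι) Sᶜ
  fun_prop

theorem isOpen_Dm (S : Finset ι) (μ : ℝ) : IsOpen (Dm S μ) :=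
  isOpen_lt (sg_contDiff S μ).continuous continuous_const

theorem XX_nonneg (S : Finset ι) (ζ : ι → ℂ) : 0 ≤ XX S ζ := by unfold XX; positivity

theorem sg_nonneg (S : Finset ι) (μ : ℝ) (ζ : ι → ℂ) : 0 ≤ sg S μ ζ := by
  unfold sg; have := XX_nonneg Sᶜ ζ; positivity

theorem XX_le {S : Finset ι} {i : ι} (hi : i ∈ S) (ζ : ι → ℂ) : ‖ζ i‖ ^ 2 ≤ XX S ζ :=
  Finset.single_le_sum (f := fun i => ‖ζ i‖ ^ 2) (fun i _ => by positivity) hi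

theorem XXc_le_sg {S : Finset ι} {μ : ℝ} (hμ : 0 ≤ μ) (ζ : ι → ℂ) : XX Sᶜ ζ ≤ sg S μ ζ := by
  unfold sg
  have h1 := XX_nonneg Sᶜ ζ
  have h2 := XX_nonneg S ζ
  exact le_mul_of_one_le_right h1 (Real.one_le_exp (by positivity))

theorem isCompact_box (S : Finset ι) {μ : ℝ} (hμ : 0 ≤ μ) (α β γ δ : ℝ) :
    IsCompact {ζ : ι → ℂ | XX S ζ ∈ Icc α β ∧ sg S μ ζ ∈ Icc γ δ} := by
  refine Metric.isCompact_of_isClosed_isBounded ?_ ?_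
  · exact (isClosed_Icc.preimage (XX_contDiff S).continuous).inter
      (isClosed_Icc.preimage (sg_contDiff S μ).continuous)
  · rw [isBounded_iff_forall_norm_le]
    refine ⟨max 1 (max β δ), fun ζ hζ => ?_⟩
    rw [pi_norm_le_iff_of_nonneg (by positivity)]
    intro i
    have h : ‖ζ i‖ ^ 2 ≤ max β δ := by
      by_cases hi : i ∈ S
      · exact (XX_le hi ζ).trans (hζ.1.2.trans (le_max_left _ _))
      · exact (XX_le (Finset.mem_compl.2 hi) ζ).trans ((XXc_le_sg hμ ζ).trans (hζ.2.2.trans (le_max_right _ _)))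
    by_contra hc
    rw [not_le, max_lt_iff] at hc
    nlinarith [hc.1, hc.2]

theorem wirt_const_mul {g : (ι → ℂ) → ℂ} {i : ι} {x : ι → ℂ} (c : ℂ)
    (h : DifferentiableAt ℝ g x) : wirt (fun y => c * g y) i x = c * wirt g i x := by
  rw [wirt_mul (differentiableAt_const c) h, wirt_holo (differentiableAt_const c)]
  simp

theorem wirt_real {R : (ι → ℂ) → ℝ} {a : ℝ → ℝ} {i : ι} {x : ι → ℂ}
    (ha : DifferentiableAt ℝ a (R x)) (h : DifferentiableAt ℝ R x) :
    wirt (fun y => ((a (R y) : ℝ) : ℂ)) i x =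
      ((deriv a (R x) : ℝ) : ℂ) * wirt (fun y => (R y : ℂ)) i x := by
  have h1 : HasFDerivAt (fun y => ((R y : ℝ) : ℂ)) (Complex.ofRealCLM.comp (fderiv ℝ R x)) x :=
    Complex.ofRealCLM.hasFDerivAt.comp x h.hasFDerivAt
  have h2 : HasFDerivAt (fun y => a (R y)) _ x := ha.hasDerivAt.comp_hasFDerivAt x h.hasFDerivAt
  have h3 : HasFDerivAt (fun y => ((a (R y) : ℝ) : ℂ)) (Complex.ofRealCLM.comp _) x :=
    Complex.ofRealCLM.hasFDerivAt.comp x h2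
  rw [wirt_of_hasFDerivAt h1, wirt_of_hasFDerivAt h3]
  simp
  ring

theorem wirt_XX (S : Finset ι) (i : ι) (x : ι → ℂ) :
    wirt (fun y => ((XX S y : ℝ) : ℂ)) i x = if i ∈ S then (starRingEnd ℂ) (x i) else 0 := by
  have h0 : ∀ l, HasFDerivAt (fun y : ι → ℂ => ‖y l‖ ^ 2)
      (2 • (innerSL ℝ (x l)).comp (ContinuousLinearMap.proj (R := ℝ) (φ := fun _ : ι => ℂ) l)) x := by
    intro l
    have := (ContinuousLinearMap.proj (R := ℝ) (φ := fun _ : ι => ℂ) l).hasFDerivAt (x := x)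
    exact this.norm_sq
  have h1 : HasFDerivAt (XX S) (∑ l ∈ S,
      (2 • (innerSL ℝ (x l)).comp (ContinuousLinearMap.proj (R := ℝ) (φ := fun _ : ι => ℂ) l))) x := by
    unfold XX
    exact HasFDerivAt.fun_sum fun l _ => h0 l
  have h2 : HasFDerivAt (fun y => ((XX S y : ℝ) : ℂ)) (Complex.ofRealCLM.comp _) x :=
    Complex.ofRealCLM.hasFDerivAt.comp x h1
  rw [wirt_of_hasFDerivAt h2]
  simp only [ContinuousLinearMap.comp_apply, ContinuousLinearMap.sum_apply, ContinuousLinearMap.smul_apply,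
    ContinuousLinearMap.proj_apply, innerSL_apply_apply, Pi.smul_apply, Pi.single_apply]
  by_cases hi : i ∈ S
  · rw [Finset.sum_eq_single_of_mem i hi (by intro b _ hb; simp [hb]),
      Finset.sum_eq_single_of_mem i hi (by intro b _ hb; simp [hb])]
    simp [hi, Complex.inner]
    apply Complex.ext <;> simp <;> ring
  · rw [Finset.sum_eq_zero (by intro b hb; simp [ne_of_mem_of_not_mem hb hi]),
      Finset.sum_eq_zero (by intro b hb; simp [ne_of_mem_of_not_mem hb hi])]
    simp [hi]

theorem wirt_sg (S : Finset ι) (μ : ℝ) (i : ι) (x : ι → ℂ) :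
    wirt (fun y => ((sg S μ y : ℝ) : ℂ)) i x =
      if i ∈ S then (μ * sg S μ x : ℂ) * (starRingEnd ℂ) (x i)
        else (Real.exp (μ * XX S x) : ℂ) * (starRingEnd ℂ) (x i) := by
  have hX : ∀ S : Finset ι, DifferentiableAt ℝ (XX S) x := fun S =>
    (XX_contDiff S).differentiable one_ne_zero x
  have hX' : DifferentiableAt ℝ (fun y => ((XX Sᶜ y : ℝ) : ℂ)) x :=
    Complex.ofRealCLM.differentiableAt.comp x (hX Sᶜ)
  have hX'' : DifferentiableAt ℝ (fun y => ((Real.exp (μ * XX S y) : ℝ) : ℂ)) x := by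
    have := hX S
    exact Complex.ofRealCLM.differentiableAt.comp x (by fun_prop)
  unfold sg
  simp only [Complex.ofReal_mul]
  rw [wirt_mul hX' hX'', wirt_real (a := fun t => Real.exp (μ * t)) (by fun_prop) (hX S), wirt_XX, wirt_XX]
  have : deriv (fun t => Real.exp (μ * t)) (XX S x) = Real.exp (μ * XX S x) * μ := by
    have := ((hasDerivAt_id (XX S x)).const_mul μ).exp
    simpa using this.deriv
  rw [this]
  by_cases hi : i ∈ S
  · simp [hi]; ring
  · simp [hi]; ring

/-- the test field -/
noncomputable def fld (S : Finset ι) (μ : ℝ) (j : ι) (k : ℕ) (a b : ℝ → ℝ) (i : ι) (ζ : ι → ℂ) : ℂ :=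
  ζ i * ζ j ^ k * ((a (XX S ζ) : ℝ) : ℂ) * ((b (sg S μ ζ) : ℝ) : ℂ)

theorem fld_contDiff (S : Finset ι) (μ : ℝ) (j : ι) (k : ℕ) {a b : ℝ → ℝ} (ha : ContDiff ℝ 1 a)
    (hb : ContDiff ℝ 1 b) (i : ι) : ContDiff ℝ 1 (fld S μ j k a b i) := by
  unfold fld
  have h1 : ContDiff ℝ 1 fun ζ : ι → ℂ => ((a (XX S ζ) : ℝ) : ℂ) :=
    Complex.ofRealCLM.contDiff.comp (ha.comp (XX_contDiff S))
  have h2 : ContDiff ℝ 1 fun ζ : ι → ℂ => ((b (sg S μ ζ) : ℝ) : ℂ) :=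
    Complex.ofRealCLM.contDiff.comp (hb.comp (sg_contDiff S μ))
  have h3 := contDiff_apply ℝ ℂ i (n := 1)
  have h4 := contDiff_apply ℝ ℂ j (n := 1)
  exact ((h3.mul (h4.pow k)).mul h1).mul h2

theorem fld_wirt (S : Finset ι) (μ : ℝ) (j : ι) (k : ℕ) {a b : ℝ → ℝ} (ha : ContDiff ℝ 1 a)
    (hb : ContDiff ℝ 1 b) (i : ι) (ζ : ι → ℂ) :
    wirt (fld S μ j k a b i) i ζ = (1 + if i = j then (k:ℂ) else 0) * (ζ j ^ k * a (XX S ζ) * b (sg S μ ζ))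
      + ζ j ^ k * (ζ i * (deriv a (XX S ζ) * wirt (fun y => ((XX S y : ℝ) : ℂ)) i ζ) * b (sg S μ ζ)
        + ζ i * a (XX S ζ) * (deriv b (sg S μ ζ) * wirt (fun y => ((sg S μ y : ℝ) : ℂ)) i ζ)) := by
  have h1 : DifferentiableAt ℝ (fun ζ : ι → ℂ => ((a (XX S ζ) : ℝ) : ℂ)) ζ :=
    (Complex.ofRealCLM.contDiff.comp (ha.comp (XX_contDiff S))).differentiable one_ne_zero ζ
  have h2 : DifferentiableAt ℝ (fun ζ : ι → ℂ => ((b (sg S μ ζ) : ℝ) : ℂ)) ζ :=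
    (Complex.ofRealCLM.contDiff.comp (hb.comp (sg_contDiff S μ))).differentiable one_ne_zero ζ
  have h3 : DifferentiableAt ℂ (fun ζ : ι → ℂ => ζ i * ζ j ^ k) ζ := by fun_prop
  have h4 : wirt (fun ζ : ι → ℂ => ζ i * ζ j ^ k) i ζ = (1 + if i = j then (k:ℂ) else 0) * ζ j ^ k := by
    rw [wirt_holo h3]
    have e1 : HasFDerivAt (fun ζ : ι → ℂ => ζ i) (ContinuousLinearMap.proj (R := ℂ) (φ := fun _ : ι => ℂ) i) ζ :=
      (ContinuousLinearMap.proj (R := ℂ) (φ := fun _ : ι => ℂ) i).hasFDerivAt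
    have e2 : HasFDerivAt (fun ζ : ι → ℂ => ζ j) (ContinuousLinearMap.proj (R := ℂ) (φ := fun _ : ι => ℂ) j) ζ :=
      (ContinuousLinearMap.proj (R := ℂ) (φ := fun _ : ι => ℂ) j).hasFDerivAt
    have e3 : HasFDerivAt (fun ζ : ι → ℂ => ζ i * ζ j ^ k) _ ζ := e1.mul (e2.pow k)
    rw [e3.fderiv]
    simp only [ContinuousLinearMap.add_apply, ContinuousLinearMap.smul_apply, ContinuousLinearMap.proj_apply,
      Pi.single_apply, smul_eq_mul]
    by_cases hij : i = j
    · subst hij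
      rcases k with _ | k
      · simp
      · simp; ring
    · simp [hij, Ne.symm hij]
  unfold fld
  rw [wirt_mul (g₁ := fun ζ : ι → ℂ => ζ i * ζ j ^ k * ((a (XX S ζ) : ℝ) : ℂ)) ((h3.restrictScalars ℝ).mul h1) h2,
    wirt_mul (h3.restrictScalars ℝ) h1, h4, wirt_real (ha.differentiable one_ne_zero _) ((XX_contDiff S).differentiable one_ne_zero _),
    wirt_real (hb.differentiable one_ne_zero _) ((sg_contDiff S μ).differentiable one_ne_zero _)]
  ring

theorem sum_mul_conj (S : Finset ι) (ζ : ι → ℂ) : ∑ i ∈ S, ζ i * (starRingEnd ℂ) (ζ i) = (XX S ζ : ℂ) := by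
  unfold XX
  push_cast
  exact Finset.sum_congr rfl fun i _ => Complex.mul_conj' _

theorem div1 (S : Finset ι) (μ : ℝ) (j : ι) (k : ℕ) {a b : ℝ → ℝ} (ha : ContDiff ℝ 1 a)
    (hb : ContDiff ℝ 1 b) (ζ : ι → ℂ) :
    ∑ i ∈ Sᶜ, wirt (fld S μ j k a b i) i ζ = ζ j ^ k * a (XX S ζ) *
      (((Sᶜ.card + if j ∈ Sᶜ then k else 0 : ℕ) : ℂ) * b (sg S μ ζ) + sg S μ ζ * deriv b (sg S μ ζ)) := by
  have e : ∀ i ∈ Sᶜ, wirt (fld S μ j k a b i) i ζ = (1 + if i = j then (k:ℂ) else 0) * (ζ j ^ k * a (XX S ζ) * b (sg S μ ζ))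
      + (ζ i * (starRingEnd ℂ) (ζ i)) * (ζ j ^ k * (a (XX S ζ) * deriv b (sg S μ ζ) * Real.exp (μ * XX S ζ))) := by
    intro i hi
    have hi' : i ∉ S := Finset.mem_compl.1 hi
    rw [fld_wirt S μ j k ha hb, wirt_XX, wirt_sg, if_neg hi', if_neg hi']
    ring
  rw [Finset.sum_congr rfl e, Finset.sum_add_distrib, ← Finset.sum_mul, ← Finset.sum_mul, sum_mul_conj,
    Finset.sum_add_distrib, Finset.sum_ite_eq']
  simp only [sg]
  push_cast
  simp only [Finset.sum_const, nsmul_eq_mul, mul_one]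
  ring

theorem div2 (S : Finset ι) (μ : ℝ) (j : ι) (k : ℕ) {a b : ℝ → ℝ} (ha : ContDiff ℝ 1 a)
    (hb : ContDiff ℝ 1 b) (ζ : ι → ℂ) :
    ∑ i ∈ S, wirt (fld S μ j k a b i) i ζ = ζ j ^ k * (((S.card + if j ∈ S then k else 0 : ℕ) : ℂ) *
      a (XX S ζ) * b (sg S μ ζ) + XX S ζ * deriv a (XX S ζ) * b (sg S μ ζ) +
       μ * XX S ζ * a (XX S ζ) * (sg S μ ζ * deriv b (sg S μ ζ))) := by
  have e : ∀ i ∈ S, wirt (fld S μ j k a b i) i ζ = (1 + if i = j then (k:ℂ) else 0) * (ζ j ^ k * a (XX S ζ) * b (sg S μ ζ))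
      + (ζ i * (starRingEnd ℂ) (ζ i)) * (ζ j ^ k * (deriv a (XX S ζ) * b (sg S μ ζ) + a (XX S ζ) * deriv b (sg S μ ζ) * (μ * sg S μ ζ))) := by
    intro i hi
    rw [fld_wirt S μ j k ha hb, wirt_XX, wirt_sg, if_pos hi, if_pos hi]
    ring
  rw [Finset.sum_congr rfl e, Finset.sum_add_distrib, ← Finset.sum_mul, ← Finset.sum_mul, sum_mul_conj,
    Finset.sum_add_distrib, Finset.sum_ite_eq']
  push_cast
  simp only [Finset.sum_const, nsmul_eq_mul, mul_one]
  ring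

end FBHProof
end

section
open MeasureTheory Metric Set Filter Topology

namespace FBHProof

variable {ι : Type*} [Fintype ι] [DecidableEq ι]

/-- the basic functional -/
noncomputable def Lam (D : Set (ι → ℂ)) (f : (ι → ℂ) → (ι → ℂ)) (h : (ι → ℂ) → ℂ)
    (S : Finset ι) (μ : ℝ) (j : ι) (k : ℕ) (A B : ℝ → ℝ) : ℂ :=
  ∫ x in D, jdet f x * (f x j ^ k * A (XX S (f x)) * B (sg S μ (f x))) * (starRingEnd ℂ) (h x)

/-- properness into the model domain -/
def Prp (D : Set (ι → ℂ)) (f : (ι → ℂ) → (ι → ℂ)) (D' : Set (ι → ℂ)) : Prop :=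
  ∀ K ⊆ D', IsCompact K → IsCompact (f ⁻¹' K ∩ D)

theorem sum_fld_zero {D : Set (ι → ℂ)} (hD : IsOpen D) {f : (ι → ℂ) → (ι → ℂ)}
    (hf : ∀ k, DifferentiableOn ℂ (fun y => f y k) D) {h : (ι → ℂ) → ℂ}
    (hh : DifferentiableOn ℂ h D) {S : Finset ι} {μ : ℝ} (hμ : 0 ≤ μ) (hP : Prp D f (Dm S μ))
    (j : ι) (k : ℕ) {a b : ℝ → ℝ} (ha : Tst (Ioi 0) a) (hb : Tst (Ioo 0 1) b) (T : Finset ι) :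
    IntegrableOn (fun x => jdet f x * (∑ i ∈ T, wirt (fld S μ j k a b i) i (f x)) * (starRingEnd ℂ) (h x)) D ∧
    ∫ x in D, jdet f x * (∑ i ∈ T, wirt (fld S μ j k a b i) i (f x)) * (starRingEnd ℂ) (h x) = 0 := by
  obtain ⟨hac, α, β, _, hU, h0⟩ := ha
  obtain ⟨hbc, γ, δ, _, hV, h1⟩ := hb
  have hcomp := isCompact_box S hμ α β γ δ
  have key : ∀ i, _ := fun i => div_zero_integral hD hf hh (fld_contDiff S μ j k hac hbc i)
    (K := {ζ : ι → ℂ | XX S ζ ∈ Icc α β ∧ sg S μ ζ ∈ Icc γ δ}) (by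
      intro ζ hζ
      rw [mem_setOf_eq, not_and_or] at hζ
      unfold fld
      rcases hζ with h | h
      · rw [h0 _ h]; simp
      · rw [h1 _ h]; simp) (hP _ (by
        intro ζ hζ
        exact (hV hζ.2).2) hcomp) i
  simp only [Finset.mul_sum, Finset.sum_mul]
  constructor
  · exact integrable_finsetSum _ fun i _ => (key i).1
  · rw [integral_finsetSum _ fun i _ => (key i).1]
    exact Finset.sum_eq_zero fun i _ => (key i).2

theorem Tst.id_mul {U : Set ℝ} {a : ℝ → ℝ} (ha : Tst U a) : Tst U (fun x => x * a x) := by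
  obtain ⟨h, α, β, hab, hU, h0⟩ := ha
  exact ⟨by fun_prop, α, β, hab, hU, fun x hx => by simp [h0 x hx]⟩

theorem Lam_zero2 {D : Set (ι → ℂ)} (hD : IsOpen D) {f : (ι → ℂ) → (ι → ℂ)}
    (hf : ∀ k, DifferentiableOn ℂ (fun y => f y k) D) {h : (ι → ℂ) → ℂ}
    (hh : DifferentiableOn ℂ h D) {S : Finset ι} {μ : ℝ} (hμ : 0 ≤ μ) (hP : Prp D f (Dm S μ))
    (j : ι) (k : ℕ) {A B : ℝ → ℝ} (ha : Tst (Ioi 0) A) (hb : Tst (Ioo 0 1) B) {q : ℕ}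
    (hq : q + 1 = Sᶜ.card + if j ∈ Sᶜ then k else 0)
    (hintg : ∫ x, B x * (x ^ q * Real.exp (- 0 * x)) = 0) :
    Lam D f h S μ j k A B = 0 := by
  obtain ⟨b, hbT, hbe⟩ := ode1 (fun x hx => hx.1) hb q 0 hintg
  have := (sum_fld_zero hD hf hh hμ hP j k ha hbT Sᶜ).2
  rw [← this, Lam]
  congr 1
  funext x
  rw [div1 S μ j k ha.1 hbT.1, ← hq, ← hbe]
  push_cast
  ring

theorem Lam_zero1 {D : Set (ι → ℂ)} (hD : IsOpen D) {f : (ι → ℂ) → (ι → ℂ)}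
    (hf : ∀ k, DifferentiableOn ℂ (fun y => f y k) D) {h : (ι → ℂ) → ℂ}
    (hh : DifferentiableOn ℂ h D) {S : Finset ι} {μ : ℝ} (hμ : 0 ≤ μ) (hP : Prp D f (Dm S μ))
    (j : ι) (k : ℕ) {A B : ℝ → ℝ} (ha : Tst (Ioi 0) A) (hb : Tst (Ioo 0 1) B) {p q : ℕ}
    (hp : p + 1 = S.card + if j ∈ S then k else 0)
    (hq : q + 1 = Sᶜ.card + if j ∈ Sᶜ then k else 0)
    (hintg : ∫ x, A x * (x ^ p * Real.exp (- ((q + 1) * μ) * x)) = 0) :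
    Lam D f h S μ j k A B = 0 := by
  obtain ⟨a, haT, hae⟩ := ode1 le_rfl ha p ((q + 1) * μ) hintg
  have h1 := (sum_fld_zero hD hf hh hμ hP j k haT hb S)
  have h2 := (sum_fld_zero hD hf hh hμ hP j k haT.id_mul hb Sᶜ)
  have h3 := integral_sub h1.1 (h2.1.const_mul (μ : ℂ))
  rw [h1.2, integral_const_mul, h2.2] at h3
  simp only [mul_zero, sub_zero] at h3
  rw [← h3, Lam]
  congr 1
  funext x
  rw [div1 S μ j k haT.id_mul.1 hb.1, div2 S μ j k haT.1 hb.1, ← hq, ← hp, ← hae]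
  push_cast
  ring

theorem Lam_integrable {D : Set (ι → ℂ)} (hD : IsOpen D) {f : (ι → ℂ) → (ι → ℂ)}
    (hf : ∀ k, DifferentiableOn ℂ (fun y => f y k) D) {h : (ι → ℂ) → ℂ}
    (hh : ContinuousOn h D) {S : Finset ι} {μ : ℝ} (hμ : 0 ≤ μ) (hP : Prp D f (Dm S μ))
    (j : ι) (k : ℕ) {A B : ℝ → ℝ} (ha : Tst (Ioi 0) A) (hb : Tst (Ioo 0 1) B) :
    IntegrableOn (fun x => jdet f x * (f x j ^ k * A (XX S (f x)) * B (sg S μ (f x))) *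
      (starRingEnd ℂ) (h x)) D := by
  obtain ⟨hac, α, β, _, hU, h0⟩ := ha
  obtain ⟨hbc, γ, δ, _, hV, h1⟩ := hb
  have hcomp := hP _ (fun ζ hζ => (hV hζ.2).2) (isCompact_box S hμ α β γ δ)
  refine int_of_compact hD hcomp inter_subset_right ?_ ?_
  · have hfc : ContinuousOn f D := continuousOn_pi.2 fun i => (hf i).continuousOn
    have e1 := (hac.continuous.comp (XX_contDiff S).continuous).comp_continuousOn hfc
    have e2 := (hbc.continuous.comp (sg_contDiff S μ).continuous).comp_continuousOn hfc
    have e3 := Complex.continuous_ofReal.comp_continuousOn e1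
    have e4 := Complex.continuous_ofReal.comp_continuousOn e2
    exact ((jdet_holo hD hf).continuousOn.mul ((((hf j).continuousOn.pow k).mul e3).mul e4)).mul
      (Complex.continuous_conj.comp_continuousOn hh)
  · intro x hx hn
    have : ¬ (XX S (f x) ∈ Icc α β ∧ sg S μ (f x) ∈ Icc γ δ) := fun h => hn ⟨h, hx⟩
    rw [not_and_or] at this
    rcases this with h | h
    · rw [h0 _ h]; simp
    · rw [h1 _ h]; simp

theorem Lam_rel {D : Set (ι → ℂ)} (hD : IsOpen D) {f : (ι → ℂ) → (ι → ℂ)}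
    (hf : ∀ k, DifferentiableOn ℂ (fun y => f y k) D) {h : (ι → ℂ) → ℂ}
    (hh : DifferentiableOn ℂ h D) {S : Finset ι} {μ : ℝ} (hμ : 0 ≤ μ) (hP : Prp D f (Dm S μ))
    (j : ι) (k : ℕ) {p q : ℕ}
    (hp : p + 1 = S.card + if j ∈ S then k else 0)
    (hq : q + 1 = Sᶜ.card + if j ∈ Sᶜ then k else 0)
    {A A0 B B0 : ℝ → ℝ} (hA : Tst (Ioi 0) A) (hA0 : Tst (Ioi 0) A0)
    (hB : Tst (Ioo 0 1) B) (hB0 : Tst (Ioo 0 1) B0) :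
    ((∫ x, A0 x * (x ^ p * Real.exp (- ((q + 1) * μ) * x)) : ℝ) : ℂ) *
    ((∫ x, B0 x * (x ^ q * Real.exp (- 0 * x)) : ℝ) : ℂ) * Lam D f h S μ j k A B =
    ((∫ x, A x * (x ^ p * Real.exp (- ((q + 1) * μ) * x)) : ℝ) : ℂ) *
    ((∫ x, B x * (x ^ q * Real.exp (- 0 * x)) : ℝ) : ℂ) * Lam D f h S μ j k A0 B0 := by
  set W₁ : ℝ → ℝ := fun x => x ^ p * Real.exp (- ((q + 1) * μ) * x) with hW₁
  set W₂ : ℝ → ℝ := fun x => x ^ q * Real.exp (- 0 * x) with hW₂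
  have hW₁c : Continuous W₁ := by fun_prop
  have hW₂c : Continuous W₂ := by fun_prop
  have hcomb : ∀ {U : Set ℝ} {A B W : ℝ → ℝ}, Tst U A → Tst U B → Continuous W →
      ∫ x, ((∫ t, B t * W t) * A x - (∫ t, A t * W t) * B x) * W x = 0 := by
    intro U A B W hA hB hW
    have e : ∀ x, ((∫ t, B t * W t) * A x - (∫ t, A t * W t) * B x) * W x =
       (∫ t, B t * W t) * (A x * W x) - (∫ t, A t * W t) * (B x * W x) := fun x => by ring
    simp only [e]
    rw [integral_sub ((hA.integrable hW).const_mul _) ((hB.integrable hW).const_mul _),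
      integral_const_mul, integral_const_mul]
    ring
  have r1 : ((∫ t, A0 t * W₁ t : ℝ) : ℂ) * Lam D f h S μ j k A B =
      ((∫ t, A t * W₁ t : ℝ) : ℂ) * Lam D f h S μ j k A0 B := by
    have := Lam_zero1 hD hf hh hμ hP j k (hA.comb hA0 (∫ t, A0 t * W₁ t) (∫ t, A t * W₁ t)) hB hp hq
      (hcomb hA hA0 hW₁c)
    have e := integral_sub ((Lam_integrable hD hf hh.continuousOn hμ hP j k hA hB).const_mul ((∫ t, A0 t * W₁ t : ℝ) : ℂ))
      ((Lam_integrable hD hf hh.continuousOn hμ hP j k hA0 hB).const_mul ((∫ t, A t * W₁ t : ℝ) : ℂ))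
    rw [integral_const_mul, integral_const_mul] at e
    rw [← sub_eq_zero, Lam, Lam, ← e, ← this, Lam]
    congr 1
    funext x
    push_cast
    ring
  have r2 : ((∫ t, B0 t * W₂ t : ℝ) : ℂ) * Lam D f h S μ j k A0 B =
      ((∫ t, B t * W₂ t : ℝ) : ℂ) * Lam D f h S μ j k A0 B0 := by
    have := Lam_zero2 hD hf hh hμ hP j k hA0 (hB.comb hB0 (∫ t, B0 t * W₂ t) (∫ t, B t * W₂ t)) hq
      (hcomb hB hB0 hW₂c)
    have e := integral_sub ((Lam_integrable hD hf hh.continuousOn hμ hP j k hA0 hB).const_mul ((∫ t, B0 t * W₂ t : ℝ) : ℂ))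
      ((Lam_integrable hD hf hh.continuousOn hμ hP j k hA0 hB0).const_mul ((∫ t, B t * W₂ t : ℝ) : ℂ))
    rw [integral_const_mul, integral_const_mul] at e
    rw [← sub_eq_zero, Lam, Lam, ← e, ← this, Lam]
    congr 1
    funext x
    push_cast
    ring
  linear_combination ((∫ t, B0 t * W₂ t : ℝ) : ℂ) * r1 + ((∫ t, A t * W₁ t : ℝ) : ℂ) * r2

end FBHProof
end

section
open MeasureTheory Metric Set Filter Topology

namespace FBHProof

variable {ι : Type*} [Fintype ι] [DecidableEq ι]

theorem det_fderiv {f : (ι → ℂ) → (ι → ℂ)} {x : ι → ℂ} :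
    (ContinuousLinearMap.pi fun k => fderiv ℂ (fun y => f y k) x : (ι → ℂ) →L[ℂ] (ι → ℂ)).det = jdet f x := by
  rw [ContinuousLinearMap.det, ← LinearMap.det_toMatrix', jdet]
  congr 1

theorem null_preimage {D : Set (ι → ℂ)} (hD : IsOpen D) {f : (ι → ℂ) → (ι → ℂ)}
    (hf : ∀ k, DifferentiableOn ℂ (fun y => f y k) D) {Z : Set (ι → ℂ)} (hZ : volume Z = 0) :
    volume {x | x ∈ D ∧ f x ∈ Z ∧ jdet f x ≠ 0} = 0 := by
  refine measure_null_of_locally_null _ fun x hx => ?_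
  obtain ⟨hxD, -, hxj⟩ := hx
  have hfd : DifferentiableOn ℂ f D := differentiableOn_pi.2 hf
  have hcd : ContDiffAt ℂ 1 f x := by
    refine contDiffAt_pi.2 fun k => ?_
    have : ContDiffOn ℂ (0 + 1) (fun y => f y k) D :=
      (contDiffOn_succ_iff_fderiv_of_isOpen hD).2 ⟨hf k, by simp,
        contDiffOn_zero.2 (fderiv_holo' hD (hf k)).continuousOn⟩
    rw [zero_add] at this
    exact this.contDiffAt (hD.mem_nhds hxD)
  have hder : HasFDerivAt f (ContinuousLinearMap.pi fun k => fderiv ℂ (fun y => f y k) x) x :=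
    hasFDerivAt_pi.2 fun k => ((hf k).differentiableAt (hD.mem_nhds hxD)).hasFDerivAt
  have hdet : (ContinuousLinearMap.pi fun k => fderiv ℂ (fun y => f y k) x : (ι → ℂ) →L[ℂ] (ι → ℂ)).det ≠ 0 := by
    rw [det_fderiv]; exact hxj
  set f' := ContinuousLinearMap.toContinuousLinearEquivOfDetNeZero _ hdet with hf'
  have hder' : HasFDerivAt f (f' : (ι → ℂ) →L[ℂ] (ι → ℂ)) x := by
    rw [hf', ContinuousLinearMap.coe_toContinuousLinearEquivOfDetNeZero]; exact hder
  set g := hcd.localInverse hder' one_ne_zero with hg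
  have hgd : ContDiffAt ℂ 1 g (f x) := hcd.to_localInverse hder' one_ne_zero
  have hgl : ∀ᶠ y in 𝓝 x, g (f y) = y :=
    (hcd.hasStrictFDerivAt' hder' one_ne_zero).eventually_left_inverse
  obtain ⟨u, hu, hgu⟩ := (hgd.eventually (by simp)).exists_mem
  have hN : {y | f y ∈ u ∧ g (f y) = y} ∈ 𝓝 x :=
    (hder.continuousAt.eventually_mem hu).and hgl
  refine ⟨_, mem_nhdsWithin_of_mem_nhds hN |> fun h => inter_mem h self_mem_nhdsWithin, ?_⟩
  have hnull : volume (g '' (u ∩ Z)) = 0 := by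
    refine addHaar_image_eq_zero_of_differentiableOn_of_addHaar_eq_zero volume ?_ (measure_mono_null inter_subset_right hZ)
    intro y hy
    exact ((hgu y hy.1).differentiableAt one_ne_zero).restrictScalars ℝ |>.differentiableWithinAt
  refine measure_mono_null ?_ hnull
  rintro y ⟨⟨h1, h2⟩, ⟨_, h3, _⟩⟩
  exact ⟨f y, ⟨h1, h3⟩, h2⟩

theorem null_coord (i : ι) : volume {ζ : ι → ℂ | ζ i = 0} = 0 := by
  have : {ζ : ι → ℂ | ζ i = 0} = ((LinearMap.ker (LinearMap.proj (R := ℝ) (φ := fun _ : ι => ℂ) i) : Submodule ℝ (ι → ℂ)) : Set (ι → ℂ)) := by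
    ext; simp
  rw [this]
  refine Measure.addHaar_submodule _ _ ?_
  intro h
  have : (Pi.single i 1 : ι → ℂ) ∈ LinearMap.ker (LinearMap.proj (R := ℝ) (φ := fun _ : ι => ℂ) i) := by
    rw [h]; trivial
  simp at this

/-- exhausting bumps on `(0, ∞)` -/
noncomputable def bA (k : ℕ) (x : ℝ) : ℝ :=
  Real.smoothTransition ((k + 1) * x - 1) * Real.smoothTransition (k + 1 - x)

/-- exhausting bumps on `(0, 1)` -/
noncomputable def bB (k : ℕ) (x : ℝ) : ℝ :=
  Real.smoothTransition ((k + 3) * x - 1) * Real.smoothTransition ((k + 3) * (1 - x) - 1)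

theorem bA_tst (k : ℕ) : Tst (Ioi 0) (bA k) := by
  refine ⟨?_, 1 / (k + 1), k + 1, ?_, ?_, ?_⟩
  · unfold bA
    exact (Real.smoothTransition.contDiff.comp (by fun_prop)).mul (Real.smoothTransition.contDiff.comp (by fun_prop))
  · rw [div_le_iff₀ (by positivity)]
    nlinarith [(Nat.cast_nonneg k : (0:ℝ) ≤ k)]
  · intro x hx
    exact lt_of_lt_of_le (by positivity) hx.1
  · intro x hx
    by_cases h : 1 / ((k:ℝ) + 1) ≤ x
    · have : (k:ℝ) + 1 < x := by by_contra h'; exact hx ⟨h, not_lt.1 h'⟩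
      rw [bA, Real.smoothTransition.zero_of_nonpos (x := k + 1 - x) (by linarith), mul_zero]
    · rw [not_le, lt_div_iff₀ (by positivity)] at h
      rw [bA, Real.smoothTransition.zero_of_nonpos (by linarith), zero_mul]

theorem bB_tst (k : ℕ) : Tst (Ioo 0 1) (bB k) := by
  have hk : (0:ℝ) < k + 3 := by positivity
  have h2 : 1 / ((k:ℝ) + 3) < 1 / 2 := by
    rw [div_lt_div_iff₀ hk (by norm_num)]; linarith [(Nat.cast_nonneg k : (0:ℝ) ≤ k)]
  have h3 : 0 < 1 / ((k:ℝ) + 3) := by positivity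
  refine ⟨?_, 1 / (k + 3), 1 - 1 / (k + 3), by linarith, ?_, ?_⟩
  · unfold bB
    exact (Real.smoothTransition.contDiff.comp (by fun_prop)).mul (Real.smoothTransition.contDiff.comp (by fun_prop))
  · intro x hx
    exact ⟨by linarith [hx.1], by linarith [hx.2]⟩
  · intro x hx
    by_cases h : 1 / ((k:ℝ) + 3) ≤ x
    · have : 1 - x < 1 / ((k:ℝ) + 3) := by by_contra h'; exact hx ⟨h, by linarith⟩
      rw [lt_div_iff₀ hk] at this
      rw [bB, Real.smoothTransition.zero_of_nonpos (x := (k + 3) * (1 - x) - 1) (by linarith), mul_zero]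
    · rw [not_le, lt_div_iff₀ hk] at h
      rw [bB, Real.smoothTransition.zero_of_nonpos (by linarith), zero_mul]

theorem bA_nonneg (k : ℕ) (x : ℝ) : 0 ≤ bA k x :=
  mul_nonneg (Real.smoothTransition.nonneg _) (Real.smoothTransition.nonneg _)
theorem bB_nonneg (k : ℕ) (x : ℝ) : 0 ≤ bB k x :=
  mul_nonneg (Real.smoothTransition.nonneg _) (Real.smoothTransition.nonneg _)
theorem bA_le (k : ℕ) (x : ℝ) : bA k x ≤ 1 :=
  mul_le_one₀ (Real.smoothTransition.le_one _) (Real.smoothTransition.nonneg _) (Real.smoothTransition.le_one _)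
theorem bB_le (k : ℕ) (x : ℝ) : bB k x ≤ 1 :=
  mul_le_one₀ (Real.smoothTransition.le_one _) (Real.smoothTransition.nonneg _) (Real.smoothTransition.le_one _)

theorem bA_tendsto {x : ℝ} (hx : 0 < x) : Tendsto (fun k => bA k x) atTop (𝓝 1) := by
  refine tendsto_const_nhds.congr' ?_
  filter_upwards [tendsto_natCast_atTop_atTop (R := ℝ) |>.eventually (eventually_ge_atTop (2 / x)),
    tendsto_natCast_atTop_atTop (R := ℝ) |>.eventually (eventually_ge_atTop x)] with k h1 h2
  rw [div_le_iff₀ hx] at h1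
  rw [bA, Real.smoothTransition.one_of_one_le (by linarith), Real.smoothTransition.one_of_one_le (by linarith), one_mul]

theorem bB_tendsto {x : ℝ} (hx : 0 < x) (hx1 : x < 1) : Tendsto (fun k => bB k x) atTop (𝓝 1) := by
  refine tendsto_const_nhds.congr' ?_
  filter_upwards [tendsto_natCast_atTop_atTop (R := ℝ) |>.eventually (eventually_ge_atTop (2 / x)),
    tendsto_natCast_atTop_atTop (R := ℝ) |>.eventually (eventually_ge_atTop (2 / (1 - x)))] with k h1 h2
  have h3 : 0 < 1 - x := by linarith
  rw [div_le_iff₀ hx] at h1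
  rw [div_le_iff₀ h3] at h2
  rw [bB, Real.smoothTransition.one_of_one_le (by linarith), Real.smoothTransition.one_of_one_le (by linarith), one_mul]

theorem Tst.zero {U : Set ℝ} {A : ℝ → ℝ} (h : Tst U A) {x : ℝ} (hx : x ∉ U) : A x = 0 := by
  obtain ⟨_, α, β, _, hU, h0⟩ := h
  exact h0 x fun h => hx (hU h)

theorem wt_tendsto {U : Set ℝ} (hU : MeasurableSet U) {W : ℝ → ℝ} (hW : IntegrableOn W U) (hWc : Continuous W)
    {A : ℕ → ℝ → ℝ} (hA : ∀ k, Tst U (A k)) (h0 : ∀ k x, 0 ≤ A k x) (h1 : ∀ k x, A k x ≤ 1)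
    (ht : ∀ x ∈ U, Tendsto (fun k => A k x) atTop (𝓝 1)) :
    Tendsto (fun k => ∫ x, A k x * W x) atTop (𝓝 (∫ x in U, W x)) := by
  rw [← integral_indicator hU]
  refine tendsto_integral_of_dominated_convergence (fun x => U.indicator (fun x => ‖W x‖) x) ?_ ?_ ?_ ?_
  · intro k
    exact ((hA k).1.continuous.mul hWc).aestronglyMeasurable
  · exact (integrable_indicator_iff hU).2 hW.norm
  · intro k
    refine ae_of_all _ fun x => ?_
    by_cases hx : x ∈ U
    · rw [indicator_of_mem hx, norm_mul, Real.norm_of_nonneg (h0 k x)]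
      exact mul_le_of_le_one_left (norm_nonneg _) (h1 k x)
    · simp [hx, (hA k).zero hx]
  · refine ae_of_all _ fun x => ?_
    by_cases hx : x ∈ U
    · simpa [hx] using (ht x hx).mul_const (W x)
    · simp [hx, (hA _).zero hx]

theorem wt_pos {U : Set ℝ} {A W : ℝ → ℝ} (hA : Tst U A) (hW : Continuous W) (h0 : ∀ x, 0 ≤ A x)
    (hW0 : ∀ x ∈ U, 0 ≤ W x) {x₀ : ℝ} (h1 : A x₀ ≠ 0) (h2 : W x₀ ≠ 0) : 0 < ∫ x, A x * W x := by
  refine Continuous.integral_pos_of_hasCompactSupport_nonneg_nonzero (x := x₀) (hA.1.continuous.mul hW)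
    (hA.hasCompactSupport.mul_right) ?_ (mul_ne_zero h1 h2)
  intro x
  by_cases hx : x ∈ U
  · exact mul_nonneg (h0 x) (hW0 x hx)
  · simp [hA.zero hx]

end FBHProof
end

section
open MeasureTheory Metric Set Filter Topology

namespace FBHProof

variable {ι : Type*} [Fintype ι] [DecidableEq ι]

theorem bergman_rep {D : Set (ι → ℂ)} (hD : IsOpen D) {f : (ι → ℂ) → (ι → ℂ)}
    (hf : ∀ k, DifferentiableOn ℂ (fun y => f y k) D) {S : Finset ι} {μ : ℝ} (hμ : 0 < μ)
    (hS : S.Nonempty) (hSc : Sᶜ.Nonempty)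
    (hP : Prp D f (Dm S μ)) (hmaps : ∀ x ∈ D, f x ∈ Dm S μ) :
    ∃ K ⊆ D, IsCompact K ∧ ∀ (j : ι) (k : ℕ),
      IntegrableOn (fun x => ‖jdet f x * f x j ^ k‖ ^ 2) D ∧
      ∃ M : ℝ, 0 ≤ M ∧ ∀ p : (ι → ℂ) → ℂ, DifferentiableOn ℂ p D → IntegrableOn (fun x => ‖p x‖ ^ 2) D →
        ∀ C : ℝ, (∀ x ∈ K, ‖p x‖ ≤ C) →
          ‖∫ x in D, jdet f x * f x j ^ k * (starRingEnd ℂ) (p x)‖ ≤ M * C := by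
  have hfc : ContinuousOn f D := continuousOn_pi.2 fun i => (hf i).continuousOn
  have hu := jdet_holo hD hf
  obtain ⟨α, β, -, hα, hA0⟩ := (bA_tst 2).2
  obtain ⟨γ, δ, -, hγ, hB0⟩ := (bB_tst 2).2
  set K : Set (ι → ℂ) := f ⁻¹' {ζ : ι → ℂ | XX S ζ ∈ Icc α β ∧ sg S μ ζ ∈ Icc γ δ} ∩ D with hKdef
  have hK : IsCompact K := hP _ (fun ζ hζ => (hγ hζ.2).2) (isCompact_box S hμ.le α β γ δ)
  refine ⟨K, inter_subset_right, hK, fun j k => ?_⟩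
  set g : (ι → ℂ) → ℂ := fun x => jdet f x * f x j ^ k with hg
  have hgd : DifferentiableOn ℂ g D := hu.mul ((hf j).pow k)
  obtain ⟨p, hp⟩ : ∃ p, p + 1 = S.card + if j ∈ S then k else 0 := by
    have := hS.card_pos; exact ⟨S.card + (if j ∈ S then k else 0) - 1, by omega⟩
  obtain ⟨q, hq⟩ : ∃ q, q + 1 = Sᶜ.card + if j ∈ Sᶜ then k else 0 := by
    have := hSc.card_pos; exact ⟨Sᶜ.card + (if j ∈ Sᶜ then k else 0) - 1, by omega⟩
  set W₁ : ℝ → ℝ := fun x => x ^ p * Real.exp (- ((q + 1) * μ) * x) with hW₁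
  set W₂ : ℝ → ℝ := fun x => x ^ q * Real.exp (- 0 * x) with hW₂
  have hW₁c : Continuous W₁ := by fun_prop
  have hW₂c : Continuous W₂ := by fun_prop
  have hW₁i : IntegrableOn W₁ (Ioi 0) := by
    have := integrableOn_rpow_mul_exp_neg_mul_rpow (p := 1) (s := p) (b := (q + 1) * μ)
      (by linarith [(Nat.cast_nonneg p : (0:ℝ) ≤ p)]) one_pos (by positivity)
    simpa [hW₁, Real.rpow_natCast] using this
  have hW₂i : IntegrableOn W₂ (Ioo 0 1) :=
    (hW₂c.continuousOn.integrableOn_compact isCompact_Icc).mono_set Ioo_subset_Icc_self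
  have t1 := wt_tendsto measurableSet_Ioi hW₁i hW₁c bA_tst bA_nonneg bA_le (fun x hx => bA_tendsto hx)
  have t2 := wt_tendsto measurableSet_Ioo hW₂i hW₂c bB_tst bB_nonneg bB_le (fun x hx => bB_tendsto hx.1 hx.2)
  have p1 : 0 < ∫ x, bA 2 x * W₁ x := by
    refine wt_pos (bA_tst 2) hW₁c (bA_nonneg 2) (fun x hx => ?_) (x₀ := 1) ?_ ?_
    · have : (0:ℝ) < x := hx
      positivity
    · rw [bA, Real.smoothTransition.one_of_one_le (by norm_num), Real.smoothTransition.one_of_one_le (by norm_num)]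
      norm_num
    · positivity
  have p2 : 0 < ∫ x, bB 2 x * W₂ x := by
    refine wt_pos (bB_tst 2) hW₂c (bB_nonneg 2) (fun x hx => ?_) (x₀ := 1/2) ?_ ?_
    · have : (0:ℝ) < x := hx.1
      positivity
    · rw [bB, Real.smoothTransition.one_of_one_le (by norm_num), Real.smoothTransition.one_of_one_le (by norm_num)]
      norm_num
    · positivity
  set c₁ := ∫ x, bA 2 x * W₁ x
  set c₂ := ∫ x, bB 2 x * W₂ x
  set w₁ := ∫ x in Ioi 0, W₁ x
  set w₂ := ∫ x in Ioo 0 1, W₂ x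
  have rel : ∀ h, DifferentiableOn ℂ h D → Tendsto (fun n => Lam D f h S μ j k (bA n) (bB n)) atTop
      (𝓝 ((w₁ : ℂ) * w₂ / (c₁ * c₂) * Lam D f h S μ j k (bA 2) (bB 2))) := by
    intro h hh
    have e : ∀ n, Lam D f h S μ j k (bA n) (bB n) = (((∫ x, bA n x * W₁ x : ℝ) : ℂ) * ((∫ x, bB n x * W₂ x : ℝ) : ℂ)) / (c₁ * c₂) *
        Lam D f h S μ j k (bA 2) (bB 2) := by
      intro n
      have := Lam_rel hD hf hh hμ.le hP j k hp hq (bA_tst n) (bA_tst 2) (bB_tst n) (bB_tst 2)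
      have n1 : (c₁ : ℂ) ≠ 0 := by exact_mod_cast p1.ne'
      have n2 : (c₂ : ℂ) ≠ 0 := by exact_mod_cast p2.ne'
      rw [div_mul_eq_mul_div, eq_div_iff (mul_ne_zero n1 n2)]
      linear_combination this
    refine Tendsto.congr (fun n => (e n).symm) ?_
    have t1' := (Complex.continuous_ofReal.tendsto _).comp t1
    have t2' := (Complex.continuous_ofReal.tendsto _).comp t2
    exact ((t1'.mul t2').div_const _).mul_const _
  -- almost everywhere convergence
  have hae : ∀ᵐ x ∂(volume.restrict D), Tendsto (fun n => bA n (XX S (f x)) * bB n (sg S μ (f x))) atTop (𝓝 1) ∨ g x = 0 := by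
    obtain ⟨i₁, hi₁⟩ := hS
    obtain ⟨i₂, hi₂⟩ := hSc
    rw [ae_restrict_iff' hD.measurableSet]
    have n1 := null_preimage hD hf (null_coord i₁)
    have n2 := null_preimage hD hf (null_coord i₂)
    filter_upwards [compl_mem_ae_iff.2 n1, compl_mem_ae_iff.2 n2] with x hx1 hx2 hxD
    by_cases hj : jdet f x = 0
    · right; simp [hg, hj]
    · left
      have a1 : f x i₁ ≠ 0 := fun h => hx1 ⟨hxD, h, hj⟩
      have a2 : f x i₂ ≠ 0 := fun h => hx2 ⟨hxD, h, hj⟩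
      have b1 : 0 < XX S (f x) := lt_of_lt_of_le (by positivity) (XX_le hi₁ (f x))
      have b2 : 0 < sg S μ (f x) := lt_of_lt_of_le (by positivity) ((XX_le hi₂ (f x)).trans (XXc_le_sg hμ.le _))
      simpa using (bA_tendsto b1).mul (bB_tendsto b2 (hmaps x hxD))
  have hcts : ∀ n, ContinuousOn (fun x => bA n (XX S (f x)) * bB n (sg S μ (f x))) D := by
    intro n
    have e1 := ((bA_tst n).1.continuous.comp (XX_contDiff S).continuous).comp_continuousOn hfc
    have e2 := ((bB_tst n).1.continuous.comp (sg_contDiff S μ).continuous).comp_continuousOn hfc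
    exact e1.mul e2
  have hL2 : IntegrableOn (fun x => ‖g x‖ ^ 2) D := by
    have hLg : ∀ n, Lam D f g S μ j k (bA n) (bB n) =
        ((∫ x in D, ‖g x‖ ^ 2 * (bA n (XX S (f x)) * bB n (sg S μ (f x))) : ℝ) : ℂ) := by
      intro n
      rw [Lam, ← integral_complex_ofReal]
      congr 1
      funext x
      push_cast
      rw [← Complex.mul_conj']
      simp only [hg]
      ring
    have hgi : ∀ n, IntegrableOn (fun x => ‖g x‖ ^ 2 * (bA n (XX S (f x)) * bB n (sg S μ (f x)))) D := by
      intro n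
      have := (Lam_integrable hD hf hgd.continuousOn hμ.le hP j k (bA_tst n) (bB_tst n)).re
      refine Integrable.congr this (ae_of_all _ fun x => ?_)
      dsimp only
      have : jdet f x * (f x j ^ k * (bA n (XX S (f x)) : ℂ) * (bB n (sg S μ (f x)) : ℂ)) * (starRingEnd ℂ) (g x)
        = ((‖g x‖ ^ 2 * (bA n (XX S (f x)) * bB n (sg S μ (f x))) : ℝ) : ℂ) := by
        push_cast
        rw [← Complex.mul_conj']
        simp only [hg]
        ring
      rw [this]
      exact Complex.ofReal_re _
    have hlim := (Complex.continuous_re.tendsto _).comp (rel g hgd)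
    simp only [Function.comp_def, hLg, Complex.ofReal_re] at hlim
    refine ⟨(hgd.continuousOn.norm.pow 2).aestronglyMeasurable hD.measurableSet, ?_⟩
    rw [hasFiniteIntegral_iff_ofReal (ae_of_all _ fun x => by positivity)]
    have hF := lintegral_liminf_le' (μ := volume.restrict D) (u := atTop)
      (f := fun (n : ℕ) x => ENNReal.ofReal (‖g x‖ ^ 2 * (bA n (XX S (f x)) * bB n (sg S μ (f x)))))
      (fun n => (hgi n).aestronglyMeasurable.aemeasurable.ennreal_ofReal)
    have e1 : ∀ n, ∫⁻ x in D, ENNReal.ofReal (‖g x‖ ^ 2 * (bA n (XX S (f x)) * bB n (sg S μ (f x)))) =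
        ENNReal.ofReal (∫ x in D, ‖g x‖ ^ 2 * (bA n (XX S (f x)) * bB n (sg S μ (f x)))) := by
      intro n
      rw [ofReal_integral_eq_lintegral_ofReal (hgi n)]
      exact ae_of_all _ fun x => mul_nonneg (by positivity) (mul_nonneg (bA_nonneg _ _) (bB_nonneg _ _))
    simp only [e1] at hF
    have hlim' : Tendsto (fun n => ENNReal.ofReal (∫ x in D, ‖g x‖ ^ 2 * (bA n (XX S (f x)) * bB n (sg S μ (f x))))) atTop _ := (ENNReal.continuous_ofReal.tendsto _).comp hlim
    rw [hlim'.liminf_eq] at hF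
    refine lt_of_le_of_lt ?_ (lt_of_le_of_lt hF ENNReal.ofReal_lt_top)
    refine lintegral_mono_ae ?_
    filter_upwards [hae] with x hx
    rcases hx with hx | hx
    · have h3 := (hx.const_mul (‖g x‖ ^ 2))
      rw [mul_one] at h3
      exact ((ENNReal.continuous_ofReal.tendsto _).comp h3).liminf_eq.ge
    · simp [hx]
  refine ⟨hL2, ?_⟩
  obtain ⟨M₀, hM₀⟩ := hK.exists_bound_of_continuousOn (hgd.continuousOn.mono (inter_subset_right : K ⊆ D))
  set M₁ := max M₀ 0
  refine ⟨‖(w₁ : ℂ) * w₂ / (c₁ * c₂)‖ * (M₁ * volume.real K), by positivity, fun p hpd hpi C hC => ?_⟩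
  have hgp : IntegrableOn (fun x => ‖g x‖ * ‖p x‖) D := by
    refine Integrable.mono' (hL2.add hpi) ((hgd.continuousOn.norm.mul hpd.continuousOn.norm).aestronglyMeasurable hD.measurableSet) (ae_of_all _ fun x => ?_)
    rw [Real.norm_of_nonneg (by positivity)]
    simp only [Pi.add_apply]
    nlinarith [sq_nonneg (‖g x‖ - ‖p x‖), sq_nonneg (‖g x‖), sq_nonneg (‖p x‖)]
  have hlim2 : Tendsto (fun n => Lam D f p S μ j k (bA n) (bB n)) atTop (𝓝 (∫ x in D, g x * (starRingEnd ℂ) (p x))) := by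
    refine tendsto_integral_of_dominated_convergence (fun x => ‖g x‖ * ‖p x‖) ?_ hgp ?_ ?_
    · intro n
      exact (Lam_integrable hD hf hpd.continuousOn hμ.le hP j k (bA_tst n) (bB_tst n)).aestronglyMeasurable
    · intro n
      refine ae_of_all _ fun x => ?_
      have : jdet f x * (f x j ^ k * (bA n (XX S (f x)) : ℂ) * (bB n (sg S μ (f x)) : ℂ)) * (starRingEnd ℂ) (p x)
        = g x * (starRingEnd ℂ) (p x) * ((bA n (XX S (f x)) * bB n (sg S μ (f x)) : ℝ) : ℂ) := by
        simp only [hg]; push_cast; ring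
      rw [this, norm_mul, norm_mul, RCLike.norm_conj, Complex.norm_real, Real.norm_of_nonneg (mul_nonneg (bA_nonneg _ _) (bB_nonneg _ _))]
      exact mul_le_of_le_one_right (by positivity) (mul_le_one₀ (bA_le _ _) (bB_nonneg _ _) (bB_le _ _))
    · filter_upwards [hae] with x hx
      have : ∀ n, jdet f x * (f x j ^ k * (bA n (XX S (f x)) : ℂ) * (bB n (sg S μ (f x)) : ℂ)) * (starRingEnd ℂ) (p x)
        = g x * (starRingEnd ℂ) (p x) * ((bA n (XX S (f x)) * bB n (sg S μ (f x)) : ℝ) : ℂ) := by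
        intro n
        simp only [hg]; push_cast; ring
      simp only [this]
      rcases hx with hx | hx
      · have := ((Complex.continuous_ofReal.tendsto _).comp hx).const_mul (g x * (starRingEnd ℂ) (p x))
        simpa [Function.comp_def] using this
      · simp [hx]
  have heq := tendsto_nhds_unique hlim2 (rel p hpd)
  change ‖∫ x in D, g x * (starRingEnd ℂ) (p x)‖ ≤ _
  rw [heq, norm_mul, mul_assoc]
  refine mul_le_mul_of_nonneg_left ?_ (norm_nonneg _)
  have hintg : Lam D f p S μ j k (bA 2) (bB 2) = ∫ x in K, jdet f x * (f x j ^ k * bA 2 (XX S (f x)) * bB 2 (sg S μ (f x))) * (starRingEnd ℂ) (p x) := by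
    rw [Lam]
    refine setIntegral_eq_of_subset_of_forall_sdiff_eq_zero hD.measurableSet inter_subset_right ?_
    rintro x ⟨hxD, hxK⟩
    have : ¬ (XX S (f x) ∈ Icc α β ∧ sg S μ (f x) ∈ Icc γ δ) := fun h => hxK ⟨h, hxD⟩
    rw [not_and_or] at this
    rcases this with h | h
    · rw [hA0 _ h]; simp
    · rw [hB0 _ h]; simp
  rw [hintg]
  refine (norm_setIntegral_le_of_norm_le_const (C := M₁ * C) hK.measure_lt_top ?_).trans (le_of_eq (by ring))
  intro x hx
  have : jdet f x * (f x j ^ k * (bA 2 (XX S (f x)) : ℂ) * (bB 2 (sg S μ (f x)) : ℂ)) * (starRingEnd ℂ) (p x)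
    = g x * (starRingEnd ℂ) (p x) * ((bA 2 (XX S (f x)) * bB 2 (sg S μ (f x)) : ℝ) : ℂ) := by
    simp only [hg]; push_cast; ring
  rw [this, norm_mul, norm_mul, RCLike.norm_conj, Complex.norm_real, Real.norm_of_nonneg (mul_nonneg (bA_nonneg _ _) (bB_nonneg _ _))]
  refine (mul_le_of_le_one_right (by positivity) (mul_le_one₀ (bA_le _ _) (bB_nonneg _ _) (bB_le _ _))).trans ?_
  exact mul_le_mul ((hM₀ x hx).trans (le_max_left _ _)) (hC x hx) (norm_nonneg _) (le_max_right _ _)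

end FBHProof
end

section
open MeasureTheory Metric Set Filter Topology

namespace FBHProof

variable {ι : Type*} [Fintype ι] [DecidableEq ι]

/-- partial dilation -/
def dl (S : Finset ι) (c : ℂ) (x : ι → ℂ) : ι → ℂ := fun i => if i ∈ S then x i else c * x i

/-- Fourier coefficients along the rotation action -/
noncomputable def hh (S : Finset ι) (g : (ι → ℂ) → ℂ) (j : ℕ) (x : ι → ℂ) : ℂ :=
  (2 * Real.pi : ℂ)⁻¹ * ∫ t in Ioc (0:ℝ) (2 * Real.pi),
    Complex.exp (-(j * (t * Complex.I))) * g (dl S (Complex.exp (t * Complex.I)) x)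

theorem dl_mul (S : Finset ι) (a b : ℂ) (x : ι → ℂ) : dl S a (dl S b x) = dl S (a * b) x := by
  funext i; by_cases hi : i ∈ S <;> simp [dl, hi, mul_assoc]

theorem dl_one (S : Finset ι) (x : ι → ℂ) : dl S 1 x = x := by
  funext i; simp [dl]

theorem dl_cont (S : Finset ι) : Continuous (fun p : (ι → ℂ) × ℂ => dl S p.2 p.1) := by
  refine continuous_pi fun i => ?_
  by_cases hi : i ∈ S <;> simp only [dl, hi, if_true, if_false] <;> fun_prop

theorem dl_diff_x (S : Finset ι) (c : ℂ) : Differentiable ℂ (fun x : ι → ℂ => dl S c x) := by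
  refine differentiable_pi.2 fun i => ?_
  by_cases hi : i ∈ S <;> simp only [dl, hi, if_true, if_false] <;> fun_prop

theorem dl_diff_c (S : Finset ι) (x : ι → ℂ) : Differentiable ℂ (fun c : ℂ => dl S c x) := by
  refine differentiable_pi.2 fun i => ?_
  by_cases hi : i ∈ S <;> simp only [dl, hi, if_true, if_false] <;> fun_prop

theorem sg_dl (S : Finset ι) (μ : ℝ) (c : ℂ) (x : ι → ℂ) : sg S μ (dl S c x) = ‖c‖ ^ 2 * sg S μ x := by
  have h1 : XX S (dl S c x) = XX S x := Finset.sum_congr rfl fun i hi => by simp [dl, hi]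
  have h2 : XX Sᶜ (dl S c x) = ‖c‖ ^ 2 * XX Sᶜ x := by
    unfold XX
    rw [Finset.mul_sum]
    exact Finset.sum_congr rfl fun i hi => by simp [dl, Finset.mem_compl.1 hi, mul_pow]
  rw [sg, sg, h1, h2, mul_assoc]

theorem nexp (t : ℝ) : ‖Complex.exp (t * Complex.I)‖ = 1 := Complex.norm_exp_ofReal_mul_I t

theorem hh_cauchy (S : Finset ι) (g : (ι → ℂ) → ℂ) (j : ℕ) (x : ι → ℂ) :
    hh S g j x = (cauchyPowerSeries (fun z => g (dl S z x)) 0 1).coeff j := by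
  rw [FormalMultilinearSeries.coeff]
  have := cauchyPowerSeries_apply (fun z => g (dl S z x)) 0 1 j 1
  rw [show (1 : Fin j → ℂ) = fun _ => 1 from rfl, this, circleIntegral,
    intervalIntegral.integral_of_le (by positivity), hh]
  simp only [smul_eq_mul, deriv_circleMap, sub_zero, circleMap, zero_add, Complex.ofReal_one, one_mul]
  rw [mul_inv _ Complex.I, mul_assoc]
  congr 1
  rw [← integral_const_mul]
  congr 1
  funext t
  have h0 := Complex.exp_ne_zero (t * Complex.I)
  have : Complex.exp (-(j * (t * Complex.I))) = (1 / Complex.exp (t * Complex.I)) ^ j := by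
    rw [Complex.exp_neg, Complex.exp_nat_mul, one_div, inv_pow]
  rw [this]
  field_simp

theorem hh_eq {S : Finset ι} {g : (ι → ℂ) → ℂ} {x : ι → ℂ} {p : FormalMultilinearSeries ℂ ℂ ℂ}
    (hd : DifferentiableOn ℂ (fun z => g (dl S z x)) (closedBall 0 1))
    (hp : HasFPowerSeriesAt (fun z => g (dl S z x)) p 0) (j : ℕ) :
    hh S g j x = p.coeff j := by
  rw [hh_cauchy]
  have := DifferentiableOn.hasFPowerSeriesOnBall (R := 1) (by simpa using hd) one_pos
  rw [NNReal.coe_one] at this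
  rw [this.hasFPowerSeriesAt.eq_formalMultilinearSeries hp]

/-- homogeneity -/
theorem hh_homog {S : Finset ι} {g : (ι → ℂ) → ℂ} {x : ι → ℂ} (c : ℂ)
    (hd : DifferentiableOn ℂ (fun z => g (dl S z x)) (closedBall 0 1))
    (hd' : DifferentiableOn ℂ (fun z => g (dl S z x)) (closedBall 0 ‖c‖)) (j : ℕ) :
    hh S g j (dl S c x) = c ^ j * hh S g j x := by
  have h1 := (DifferentiableOn.hasFPowerSeriesOnBall (R := 1) (by simpa using hd) one_pos).hasFPowerSeriesAt
  set p := cauchyPowerSeries (fun z => g (dl S z x)) 0 ((1 : NNReal) : ℝ) with hp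
  have h2 : HasFPowerSeriesAt (fun z => g (dl S z (dl S c x)))
      (FormalMultilinearSeries.ofScalars ℂ fun n => c ^ n * p.coeff n) 0 := by
    rw [hasFPowerSeriesAt_iff] at h1 ⊢
    have ht : Tendsto (fun z : ℂ => z * c) (𝓝 0) (𝓝 0) := by
      have : Continuous (fun z : ℂ => z * c) := by fun_prop
      simpa using this.tendsto 0
    filter_upwards [ht.eventually h1] with z hz
    simp only [FormalMultilinearSeries.coeff_ofScalars, dl_mul, smul_eq_mul, zero_add] at hz ⊢
    convert hz using 2
    ring
  rw [hh_eq hd h1, hh_eq ?_ h2, FormalMultilinearSeries.coeff_ofScalars]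
  simp only [dl_mul]
  refine hd'.comp (by fun_prop) ?_
  intro z hz
  simp only [mem_closedBall, dist_zero_right] at hz ⊢
  rw [norm_mul]
  exact mul_le_of_le_one_left (norm_nonneg _) hz

/-- summation -/
theorem hh_sum {S : Finset ι} {g : (ι → ℂ) → ℂ} {x : ι → ℂ} {r : ℝ} (hr : 1 < r)
    (hd : DifferentiableOn ℂ (fun z => g (dl S z x)) (closedBall 0 r)) :
    HasSum (fun j => hh S g j x) (g x) := by
  lift r to NNReal using by linarith
  have h1 := DifferentiableOn.hasFPowerSeriesOnBall hd (zero_lt_one.trans (by exact_mod_cast hr))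
  have h2 := h1.hasSum (y := 1) (by simpa using by exact_mod_cast hr)
  simp only [zero_add, dl_one] at h2
  have he : (fun j => hh S g j x) = fun n => (cauchyPowerSeries (fun z => g (dl S z x)) 0 (r:ℝ) n) fun _ => 1 := by
    funext j
    rw [hh_eq (hd.mono (closedBall_subset_closedBall hr.le)) h1.hasFPowerSeriesAt]
    rfl
  rw [he]
  exact h2

theorem hh_rot {S : Finset ι} {g : (ι → ℂ) → ℂ} {Ω : Set (ι → ℂ)} (hΩ : IsOpen Ω)
    (hg : DifferentiableOn ℂ g Ω) (hrot : ∀ x ∈ Ω, ∀ c : ℂ, ‖c‖ = 1 → dl S c x ∈ Ω) (j : ℕ) :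
    DifferentiableOn ℂ (hh S g j) Ω := by
  unfold hh
  refine DifferentiableOn.const_mul (holo_circle (g := fun x t =>
    Complex.exp (-(j * (t * Complex.I))) * g (dl S (Complex.exp (t * Complex.I)) x)) hΩ ?_ ?_) _
  · intro t
    refine DifferentiableOn.const_mul ?_ _
    exact hg.comp (dl_diff_x S _).differentiableOn fun x hx => hrot x hx _ (nexp t)
  · refine ContinuousOn.mul (by fun_prop) ?_
    refine hg.continuousOn.comp ?_ (fun p hp => hrot p.1 hp.1 _ (nexp p.2))
    exact ((dl_cont S).comp (f := fun p : (ι → ℂ) × ℝ => (p.1, Complex.exp (p.2 * Complex.I)))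
      (by fun_prop)).continuousOn

end FBHProof
end

section
open MeasureTheory Metric Set Filter Topology

namespace FBHProof

variable {ι : Type*} [Fintype ι] [DecidableEq ι]

theorem dl_mp (S : Finset ι) {c : ℂ} (hc : ‖c‖ = 1) :
    MeasurePreserving (fun x : ι → ℂ => dl S c x) volume volume := by
  have h1 : MeasurePreserving (fun z : ℂ => c * z) volume volume :=
    (rotation ⟨c, by simp [Submonoid.unitSphere, hc]⟩).measurePreserving
  exact volume_preserving_pi (f := fun i (z : ℂ) => if i ∈ S then z else c * z) (fun i => by
    by_cases hi : i ∈ S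
    · simp only [hi, if_true]; exact MeasurePreserving.id _
    · simp only [hi, if_false]; exact h1)

theorem dl_emb (S : Finset ι) {c : ℂ} (hc : ‖c‖ = 1) :
    MeasurableEmbedding (fun x : ι → ℂ => dl S c x) := by
  have h0 : c ≠ 0 := by rintro rfl; simp at hc
  refine (dl_diff_x S c).continuous.measurableEmbedding ?_
  intro x y h
  have : dl S c⁻¹ (dl S c x) = dl S c⁻¹ (dl S c y) := by simp only at h; rw [h]
  simpa [dl_mul, h0, dl_one] using this

theorem dl_pre {S : Finset ι} {Ω : Set (ι → ℂ)}
    (hrot : ∀ x ∈ Ω, ∀ c : ℂ, ‖c‖ = 1 → dl S c x ∈ Ω) {c : ℂ} (hc : ‖c‖ = 1) :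
    (fun x : ι → ℂ => dl S c x) ⁻¹' Ω = Ω := by
  have h0 : c ≠ 0 := by rintro rfl; simp at hc
  ext x
  refine ⟨fun h => ?_, fun h => hrot x h c hc⟩
  have := hrot _ h c⁻¹ (by simp [hc])
  simpa [dl_mul, h0, dl_one] using this

theorem rot_integral {S : Finset ι} {Ω : Set (ι → ℂ)}
    (hrot : ∀ x ∈ Ω, ∀ c : ℂ, ‖c‖ = 1 → dl S c x ∈ Ω) {c : ℂ} (hc : ‖c‖ = 1) (F : (ι → ℂ) → ℂ) :
    ∫ x in Ω, F (dl S c x) = ∫ x in Ω, F x := by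
  have := (dl_mp S hc).setIntegral_preimage_emb (dl_emb S hc) F Ω
  rwa [dl_pre hrot hc] at this

theorem rot_lintegral {S : Finset ι} {Ω : Set (ι → ℂ)}
    (hrot : ∀ x ∈ Ω, ∀ c : ℂ, ‖c‖ = 1 → dl S c x ∈ Ω) {c : ℂ} (hc : ‖c‖ = 1) (F : (ι → ℂ) → ENNReal) :
    ∫⁻ x in Ω, F (dl S c x) = ∫⁻ x in Ω, F x := by
  have := (dl_mp S hc).setLIntegral_comp_preimage_emb (dl_emb S hc) F Ω
  rwa [dl_pre hrot hc] at this

theorem enn_cs {α : Type*} [MeasurableSpace α] {μ : Measure α} {F : α → ENNReal} (hF : AEMeasurable F μ) :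
    (∫⁻ a, F a ∂μ) ^ 2 ≤ μ univ * ∫⁻ a, F a ^ 2 ∂μ := by
  have h := ENNReal.lintegral_mul_le_Lp_mul_Lq μ Real.HolderConjugate.two_two hF
    (aemeasurable_const (b := (1 : ENNReal)))
  simp only [Pi.mul_apply, mul_one, ENNReal.rpow_two, one_pow, lintegral_const, one_mul] at h
  calc (∫⁻ a, F a ∂μ) ^ 2 ≤ ((∫⁻ a, F a ^ 2 ∂μ) ^ (1 / 2 : ℝ) * (μ univ) ^ (1 / 2 : ℝ)) ^ 2 := by gcongr
    _ = μ univ * ∫⁻ a, F a ^ 2 ∂μ := by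
      rw [mul_pow, ← ENNReal.rpow_mul_natCast, ← ENNReal.rpow_mul_natCast, mul_comm]
      norm_num

theorem rot_cont {S : Finset ι} {g : (ι → ℂ) → ℂ} {Ω : Set (ι → ℂ)}
    (hg : ContinuousOn g Ω) (hrot : ∀ x ∈ Ω, ∀ c : ℂ, ‖c‖ = 1 → dl S c x ∈ Ω) :
    ContinuousOn (fun p : (ι → ℂ) × ℝ => g (dl S (Complex.exp (p.2 * Complex.I)) p.1)) (Ω ×ˢ univ) := by
  refine hg.comp ?_ (fun p hp => hrot p.1 hp.1 _ (nexp p.2))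
  exact ((dl_cont S).comp (f := fun p : (ι → ℂ) × ℝ => (p.1, Complex.exp (p.2 * Complex.I)))
      (by fun_prop)).continuousOn

theorem hh_le {S : Finset ι} {g : (ι → ℂ) → ℂ} {x : ι → ℂ}
    (hc : Continuous fun t : ℝ => g (dl S (Complex.exp (t * Complex.I)) x)) (j : ℕ) :
    ‖hh S g j x‖ₑ ^ 2 ≤ (ENNReal.ofReal (2 * Real.pi))⁻¹ *
      ∫⁻ t in Ioc (0:ℝ) (2 * Real.pi), ‖g (dl S (Complex.exp (t * Complex.I)) x)‖ₑ ^ 2 := by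
  have hpi : (0:ℝ) < 2 * Real.pi := by positivity
  have h1 : ‖(2 * Real.pi : ℂ)⁻¹‖ₑ = (ENNReal.ofReal (2 * Real.pi))⁻¹ := by
    rw [← ofReal_norm, norm_inv, ENNReal.ofReal_inv_of_pos (by simpa using hpi)]
    congr 2
    simp [abs_of_pos Real.pi_pos]
  have hne : ENNReal.ofReal (2 * Real.pi) ≠ 0 := by simpa using Real.pi_pos
  have h2 : ‖∫ t in Ioc (0:ℝ) (2 * Real.pi),
    Complex.exp (-(j * (t * Complex.I))) * g (dl S (Complex.exp (t * Complex.I)) x)‖ₑ ≤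
      ∫⁻ t in Ioc (0:ℝ) (2 * Real.pi), ‖g (dl S (Complex.exp (t * Complex.I)) x)‖ₑ := by
    refine (enorm_integral_le_lintegral_enorm _).trans (le_of_eq ?_)
    congr 1
    funext t
    rw [enorm_mul, ← ofReal_norm, Complex.norm_exp]
    simp
  rw [hh, enorm_mul, mul_pow, h1]
  calc _ ≤ (ENNReal.ofReal (2 * Real.pi))⁻¹ ^ 2 * (∫⁻ t in Ioc (0:ℝ) (2 * Real.pi), ‖g (dl S (Complex.exp (t * Complex.I)) x)‖ₑ) ^ 2 := by
        gcongr
    _ ≤ (ENNReal.ofReal (2 * Real.pi))⁻¹ ^ 2 * (ENNReal.ofReal (2 * Real.pi) * ∫⁻ t in Ioc (0:ℝ) (2 * Real.pi), ‖g (dl S (Complex.exp (t * Complex.I)) x)‖ₑ ^ 2) := by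
        gcongr
        refine (enn_cs hc.measurable.enorm.aemeasurable).trans (le_of_eq ?_)
        simp
    _ = _ := by
      rw [pow_two, mul_assoc, ← mul_assoc _ (ENNReal.ofReal (2 * Real.pi)), ENNReal.inv_mul_cancel hne ENNReal.ofReal_ne_top, one_mul]

theorem avg {S : Finset ι} {g : (ι → ℂ) → ℂ} {Ω : Set (ι → ℂ)} (hΩ : IsOpen Ω)
    (hg : ContinuousOn g Ω) (hrot : ∀ x ∈ Ω, ∀ c : ℂ, ‖c‖ = 1 → dl S c x ∈ Ω) (j : ℕ) :
    ∫⁻ x in Ω, ‖hh S g j x‖ₑ ^ 2 ≤ ∫⁻ x in Ω, ‖g x‖ₑ ^ 2 := by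
  have hne : ENNReal.ofReal (2 * Real.pi) ≠ 0 := by simpa using Real.pi_pos
  have hcc := rot_cont hg hrot
  have hm : AEMeasurable (Function.uncurry fun (x : ι → ℂ) (t : ℝ) => ‖g (dl S (Complex.exp (t * Complex.I)) x)‖ₑ ^ 2)
      ((volume.restrict Ω).prod (volume.restrict (Ioc (0:ℝ) (2 * Real.pi)))) := by
    rw [Measure.prod_restrict]
    have := (hcc.mono (prod_mono le_rfl (subset_univ (Ioc (0:ℝ) (2 * Real.pi))))).aemeasurable
      (μ := (volume : Measure (ι → ℂ)).prod (volume : Measure ℝ)) (hΩ.measurableSet.prod measurableSet_Ioc)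
    exact this.enorm.pow_const 2
  calc _ ≤ ∫⁻ x in Ω, (ENNReal.ofReal (2 * Real.pi))⁻¹ *
      ∫⁻ t in Ioc (0:ℝ) (2 * Real.pi), ‖g (dl S (Complex.exp (t * Complex.I)) x)‖ₑ ^ 2 := by
        refine setLIntegral_mono' hΩ.measurableSet fun x hx => hh_le ?_ j
        exact continuousOn_univ.1 (hcc.comp (f := fun t : ℝ => (x, t)) (by fun_prop) fun t _ => ⟨hx, mem_univ _⟩)
    _ = (ENNReal.ofReal (2 * Real.pi))⁻¹ * ∫⁻ x in Ω,
      ∫⁻ t in Ioc (0:ℝ) (2 * Real.pi), ‖g (dl S (Complex.exp (t * Complex.I)) x)‖ₑ ^ 2 := by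
        rw [lintegral_const_mul' _ _ (by simpa using hne)]
    _ = (ENNReal.ofReal (2 * Real.pi))⁻¹ * ∫⁻ t in Ioc (0:ℝ) (2 * Real.pi), ∫⁻ x in Ω, ‖g x‖ₑ ^ 2 := by
        rw [lintegral_lintegral_swap hm]
        congr 2
        funext t
        exact rot_lintegral hrot (nexp t) fun x => ‖g x‖ₑ ^ 2
    _ = _ := by
        rw [lintegral_const, mul_comm (∫⁻ x in Ω, ‖g x‖ₑ ^ 2), ← mul_assoc]
        simp only [MeasurableSet.univ, Measure.restrict_apply, univ_inter, Real.volume_Ioc, sub_zero]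
        rw [ENNReal.inv_mul_cancel hne ENNReal.ofReal_ne_top, one_mul]

end FBHProof
end

section
open MeasureTheory Metric Set Filter Topology

namespace FBHProof

variable {ι : Type*} [Fintype ι] [DecidableEq ι]

theorem lint_sq {D : Set (ι → ℂ)} {p : (ι → ℂ) → ℂ} (hi : IntegrableOn (fun x => ‖p x‖ ^ 2) D) :
    ∫⁻ x in D, ‖p x‖ₑ ^ 2 = ENNReal.ofReal (∫ x in D, ‖p x‖ ^ 2) := by
  rw [ofReal_integral_eq_lintegral_ofReal hi (ae_of_all _ fun x => by positivity)]
  congr 1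
  funext x
  rw [ENNReal.ofReal_pow (norm_nonneg _), ofReal_norm]

theorem sq_int {D : Set (ι → ℂ)} (hD : IsOpen D) {p : (ι → ℂ) → ℂ} (hp : ContinuousOn p D)
    (hi : ∫⁻ x in D, ‖p x‖ₑ ^ 2 ≠ ⊤) : IntegrableOn (fun x => ‖p x‖ ^ 2) D := by
  refine ⟨((hp.norm.pow 2).aestronglyMeasurable hD.measurableSet), ?_⟩
  rw [HasFiniteIntegral]
  refine lt_of_le_of_lt (le_of_eq ?_) hi.lt_top
  congr 1
  funext x
  rw [← ofReal_norm, norm_pow, norm_norm, ENNReal.ofReal_pow (norm_nonneg _), ofReal_norm]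

theorem sup_bound {D K : Set (ι → ℂ)} (hD : IsOpen D) (hK : IsCompact K) (hKD : K ⊆ D) :
    ∃ C : ℝ, 0 ≤ C ∧ ∀ p : (ι → ℂ) → ℂ, DifferentiableOn ℂ p D → IntegrableOn (fun x => ‖p x‖ ^ 2) D →
      ∀ x ∈ K, ‖p x‖ ^ 2 ≤ C * ∫ x in D, ‖p x‖ ^ 2 := by
  obtain ⟨ρ, hρ, hρK⟩ := hK.exists_thickening_subset_open hD hKD
  set V : ℝ := (volume (ball (0 : ι → ℂ) ρ)).toReal with hV
  have hVt : volume (ball (0 : ι → ℂ) ρ) ≠ ⊤ := measure_ball_lt_top.ne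
  have hV0 : 0 < V := ENNReal.toReal_pos (measure_ball_pos _ _ hρ).ne' hVt
  refine ⟨V⁻¹, by positivity, fun p hp hi x hx => ?_⟩
  have hsub : ∀ v ∈ ball (0 : ι → ℂ) ρ, x + v ∈ D := by
    intro v hv
    apply hρK
    rw [mem_thickening_iff]
    exact ⟨x, hx, by simpa [dist_eq_norm] using hv⟩
  have hball : ∀ v ∈ ball (0 : ι → ℂ) ρ, ∀ c : ℂ, ‖c‖ ≤ 1 → dl ∅ c v ∈ ball (0 : ι → ℂ) ρ := by
    intro v hv c hc
    have : dl ∅ c v = c • v := by funext i; simp [dl]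
    rw [this, mem_ball_zero_iff, norm_smul]
    exact lt_of_le_of_lt (mul_le_of_le_one_left (norm_nonneg _) hc) (mem_ball_zero_iff.1 hv)
  have hq : DifferentiableOn ℂ (fun v => p (x + v)) (ball 0 ρ) :=
    hp.comp (by fun_prop) hsub
  have h1 := avg (S := ∅) isOpen_ball hq.continuousOn (fun v hv c hc => hball v hv c hc.le) 0
  have h2 : ∀ v ∈ ball (0 : ι → ℂ) ρ, hh ∅ (fun v => p (x + v)) 0 v = p x := by
    intro v hv
    have hd : DifferentiableOn ℂ (fun z => p (x + dl ∅ z v)) (closedBall 0 1) :=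
      hq.comp (dl_diff_c ∅ v).differentiableOn fun z hz => hball v hv z (by simpa using hz)
    have hps := (DifferentiableOn.hasFPowerSeriesOnBall (R := 1) (by simpa using hd) one_pos).hasFPowerSeriesAt
    rw [hh_eq hd hps, FormalMultilinearSeries.coeff, hps.coeff_zero]
    congr 1
    funext i
    simp [dl]
  rw [setLIntegral_congr_fun measurableSet_ball (g := fun _ => ‖p x‖ₑ ^ 2) (fun v hv => by simp only [h2 v hv])] at h1
  have h3 : ∫⁻ v in ball (0 : ι → ℂ) ρ, ‖p (x + v)‖ₑ ^ 2 ≤ ∫⁻ y in D, ‖p y‖ₑ ^ 2 := by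
    have hmp := measurePreserving_add_left (volume : Measure (ι → ℂ)) x
    have := hmp.setLIntegral_comp_preimage_emb (measurableEmbedding_addLeft x) (fun y => ‖p y‖ₑ ^ 2) D
    rw [← this]
    exact lintegral_mono_set fun v hv => hsub v hv
  have h4 := h1.trans h3
  rw [setLIntegral_const, lint_sq hi, ← ofReal_norm, ← ENNReal.ofReal_pow (norm_nonneg _),
    ← ENNReal.ofReal_toReal hVt, ← hV, ← ENNReal.ofReal_mul (by positivity),
    ENNReal.ofReal_le_ofReal_iff (integral_nonneg fun x => by positivity)] at h4
  rw [inv_mul_eq_div, le_div_iff₀ hV0]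
  exact h4

theorem Dm_dl {S : Finset ι} {μ : ℝ} {x : ι → ℂ} (hx : x ∈ Dm S μ) {c : ℂ} (hc : ‖c‖ ≤ 1) : dl S c x ∈ Dm S μ := by
  rw [Dm, mem_setOf_eq, sg_dl]
  exact lt_of_le_of_lt (mul_le_of_le_one_left (sg_nonneg _ _ _) (pow_le_one₀ (norm_nonneg _) hc)) hx

theorem Dm_phi {S : Finset ι} {μ : ℝ} {g : (ι → ℂ) → ℂ} (hg : DifferentiableOn ℂ g (Dm S μ))
    {x : ι → ℂ} {r : ℝ} (hx : r ^ 2 * sg S μ x < 1) :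
    DifferentiableOn ℂ (fun z => g (dl S z x)) (closedBall 0 r) := by
  refine hg.comp (dl_diff_c S x).differentiableOn fun z hz => ?_
  rw [mem_closedBall, dist_zero_right] at hz
  rw [Dm, mem_setOf_eq, sg_dl]
  refine lt_of_le_of_lt ?_ hx
  have := sg_nonneg S μ x
  gcongr

theorem Dm_hh {S : Finset ι} {μ : ℝ} {g : (ι → ℂ) → ℂ} (hg : DifferentiableOn ℂ g (Dm S μ))
    (hi : IntegrableOn (fun x => ‖g x‖ ^ 2) (Dm S μ)) (j : ℕ) :
    DifferentiableOn ℂ (hh S g j) (Dm S μ) ∧ IntegrableOn (fun x => ‖hh S g j x‖ ^ 2) (Dm S μ) := by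
  have hrot : ∀ x ∈ Dm S μ, ∀ c : ℂ, ‖c‖ = 1 → dl S c x ∈ Dm S μ := fun x hx c hc => Dm_dl hx hc.le
  have h1 := hh_rot (isOpen_Dm S μ) hg hrot j
  refine ⟨h1, sq_int (isOpen_Dm S μ) h1.continuousOn ?_⟩
  refine ((avg (isOpen_Dm S μ) hg.continuousOn hrot j).trans_lt ?_).ne
  rw [lint_sq hi]
  exact ENNReal.ofReal_lt_top

theorem Dm_inner {S : Finset ι} {μ : ℝ} {g : (ι → ℂ) → ℂ} (hg : DifferentiableOn ℂ g (Dm S μ))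
    (hi : IntegrableOn (fun x => ‖g x‖ ^ 2) (Dm S μ)) (j : ℕ) :
    ∫ x in Dm S μ, g x * (starRingEnd ℂ) (hh S g j x) = ((∫ x in Dm S μ, ‖hh S g j x‖ ^ 2 : ℝ) : ℂ) := by
  obtain ⟨hh1, hh2⟩ := Dm_hh hg hi j
  have hrot : ∀ x ∈ Dm S μ, ∀ c : ℂ, ‖c‖ = 1 → dl S c x ∈ Dm S μ := fun x hx c hc => Dm_dl hx hc.le
  have hDm := (isOpen_Dm S μ).measurableSet
  set I := ∫ x in Dm S μ, g x * (starRingEnd ℂ) (hh S g j x) with hI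
  have hcc := rot_cont hg.continuousOn hrot
  have h2pi : (2 * Real.pi : ℂ) ≠ 0 := by simp [Real.pi_ne_zero]
  have e1 : ∀ t : ℝ, (starRingEnd ℂ) (Complex.exp (t * Complex.I) ^ j) = Complex.exp (-(j * (t * Complex.I))) := by
    intro t
    rw [← Complex.exp_nat_mul, ← Complex.exp_conj]
    congr 1
    simp
  have key : ∀ t : ℝ, ∫ x in Dm S μ, Complex.exp (-(j * (t * Complex.I))) * g (dl S (Complex.exp (t * Complex.I)) x)
      * (starRingEnd ℂ) (hh S g j x) = I := by
    intro t
    rw [hI, ← rot_integral hrot (nexp t) fun x => g x * (starRingEnd ℂ) (hh S g j x)]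
    refine setIntegral_congr_fun hDm fun x hx => ?_
    have hd := Dm_phi (r := 1) hg (x := x) (by simpa [Dm] using hx)
    show _ = g _ * (starRingEnd ℂ) (hh S g j _)
    rw [hh_homog _ hd (by rw [nexp]; exact hd), map_mul, e1]
    ring
  have hcont : ContinuousOn (Function.uncurry fun (x : ι → ℂ) (t : ℝ) =>
      Complex.exp (-(j * (t * Complex.I))) * g (dl S (Complex.exp (t * Complex.I)) x)
      * (starRingEnd ℂ) (hh S g j x)) (Dm S μ ×ˢ univ) := by
    refine ContinuousOn.mul (ContinuousOn.mul (by fun_prop) hcc) ?_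
    refine Complex.continuous_conj.comp_continuousOn ?_
    exact hh1.continuousOn.comp continuous_fst.continuousOn fun p hp => hp.1
  have hintg : Integrable (Function.uncurry fun (x : ι → ℂ) (t : ℝ) =>
      Complex.exp (-(j * (t * Complex.I))) * g (dl S (Complex.exp (t * Complex.I)) x)
      * (starRingEnd ℂ) (hh S g j x)) ((volume.restrict (Dm S μ)).prod (volume.restrict (Ioc (0:ℝ) (2 * Real.pi)))) := by
    have hres : ((volume : Measure (ι → ℂ)).restrict (Dm S μ)).prod ((volume : Measure ℝ).restrict (Ioc (0:ℝ) (2 * Real.pi)))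
      = ((volume : Measure (ι → ℂ)).prod (volume : Measure ℝ)).restrict (Dm S μ ×ˢ Ioc (0:ℝ) (2 * Real.pi)) := Measure.prod_restrict _ _
    have hms := (isOpen_Dm S μ).measurableSet.prod (measurableSet_Ioc (a := (0:ℝ)) (b := 2 * Real.pi))
    have hm1 : AEStronglyMeasurable (fun p : (ι → ℂ) × ℝ => g (dl S (Complex.exp (p.2 * Complex.I)) p.1))
        ((volume.restrict (Dm S μ)).prod (volume.restrict (Ioc (0:ℝ) (2 * Real.pi)))) := by
      rw [hres]
      exact (hcc.mono (prod_mono le_rfl (subset_univ (Ioc (0:ℝ) (2 * Real.pi))))).aestronglyMeasurable hms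
    have hA : Integrable (fun p : (ι → ℂ) × ℝ => ‖g (dl S (Complex.exp (p.2 * Complex.I)) p.1)‖ ^ 2)
        ((volume.restrict (Dm S μ)).prod (volume.restrict (Ioc (0:ℝ) (2 * Real.pi)))) := by
      refine (integrable_prod_iff' (hm1.norm.pow 2)).2 ?_
      have hnn : ∀ t : ℝ, IntegrableOn (fun x => ‖g (dl S (Complex.exp (t * Complex.I)) x)‖ ^ 2) (Dm S μ) ∧
          ∫ x in Dm S μ, ‖g (dl S (Complex.exp (t * Complex.I)) x)‖ ^ 2 = ∫ x in Dm S μ, ‖g x‖ ^ 2 := by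
        intro t
        have a := (dl_mp S (nexp t)).integrableOn_comp_preimage (dl_emb S (nexp t)) (f := fun x => ‖g x‖ ^ 2) (s := Dm S μ)
        have b := (dl_mp S (nexp t)).setIntegral_preimage_emb (dl_emb S (nexp t)) (fun x => ‖g x‖ ^ 2) (Dm S μ)
        rw [dl_pre hrot (nexp t)] at a b
        exact ⟨a.2 hi, b⟩
      refine ⟨ae_of_all _ fun t => (hnn t).1, ?_⟩
      have : (fun t : ℝ => ∫ x in Dm S μ, ‖‖g (dl S (Complex.exp (t * Complex.I)) x)‖ ^ 2‖) =
          fun _ => ∫ x in Dm S μ, ‖g x‖ ^ 2 := by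
        funext t
        simp only [norm_pow, norm_norm]
        exact (hnn t).2
      change Integrable (fun t : ℝ => ∫ x in Dm S μ, ‖‖g (dl S (Complex.exp (t * Complex.I)) x)‖ ^ 2‖) _
      rw [this]
      exact integrable_const _
    have hB : Integrable (fun p : (ι → ℂ) × ℝ => ‖hh S g j p.1‖ ^ 2)
        ((volume.restrict (Dm S μ)).prod (volume.restrict (Ioc (0:ℝ) (2 * Real.pi)))) :=
      Integrable.comp_fst hh2 _
    refine (hA.add hB).mono' ?_ (ae_of_all _ fun p => ?_)
    · rw [hres]
      exact (hcont.mono (prod_mono le_rfl (subset_univ _))).aestronglyMeasurable hms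
    · have h1 : ‖Complex.exp (-(j * (p.2 * Complex.I)))‖ = 1 := by
        rw [Complex.norm_exp]; simp
      simp only [Function.uncurry, norm_mul, h1, one_mul, RCLike.norm_conj, Pi.add_apply]
      nlinarith [sq_nonneg (‖g (dl S (Complex.exp (p.2 * Complex.I)) p.1)‖ - ‖hh S g j p.1‖),
        sq_nonneg (‖g (dl S (Complex.exp (p.2 * Complex.I)) p.1)‖), sq_nonneg ‖hh S g j p.1‖]
  have hsw := integral_integral_swap hintg
  simp only [key] at hsw
  rw [setIntegral_const] at hsw
  have e2 : ∫ x in Dm S μ, ∫ t in Ioc (0:ℝ) (2 * Real.pi), Complex.exp (-(j * (t * Complex.I))) *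
      g (dl S (Complex.exp (t * Complex.I)) x) * (starRingEnd ℂ) (hh S g j x) =
      (2 * Real.pi : ℂ) * ((∫ x in Dm S μ, ‖hh S g j x‖ ^ 2 : ℝ) : ℂ) := by
    rw [← integral_complex_ofReal, ← integral_const_mul]
    refine setIntegral_congr_fun hDm fun x hx => ?_
    rw [integral_mul_const]
    have : ∫ t in Ioc (0:ℝ) (2 * Real.pi), Complex.exp (-(j * (t * Complex.I))) *
      g (dl S (Complex.exp (t * Complex.I)) x) = (2 * Real.pi : ℂ) * hh S g j x := by
      rw [hh, mul_inv_cancel_left₀ h2pi]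
    rw [this, mul_assoc, Complex.mul_conj, Complex.normSq_eq_norm_sq]
  rw [e2] at hsw
  have : (volume.real (Ioc (0:ℝ) (2 * Real.pi))) • I = (2 * Real.pi : ℂ) * I := by
    rw [Real.volume_real_Ioc_of_le (by positivity)]
    simp
  rw [this] at hsw
  exact (mul_left_cancel₀ h2pi hsw).symm

end FBHProof
end

section
open MeasureTheory Metric Set Filter Topology

namespace FBHProof

variable {ι : Type*} [Fintype ι] [DecidableEq ι]

theorem exists_s {S : Finset ι} {μ : ℝ} {K : Set (ι → ℂ)} (hK : IsCompact K) (hKD : K ⊆ Dm S μ) :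
    ∃ s : ℝ, 1 < s ∧ ∀ x ∈ K, s ^ 2 * sg S μ x < 1 := by
  rcases K.eq_empty_or_nonempty with rfl | hne
  · exact ⟨2, by norm_num, by simp⟩
  · obtain ⟨y, hy, hmax⟩ := hK.exists_isMaxOn hne (sg_contDiff S μ).continuous.continuousOn
    have hm : sg S μ y < 1 := hKD hy
    have hm0 := sg_nonneg S μ y
    have hs : √(2 / (1 + sg S μ y)) ^ 2 = 2 / (1 + sg S μ y) := Real.sq_sqrt (by positivity)
    refine ⟨√(2 / (1 + sg S μ y)), ?_, fun x hx => ?_⟩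
    · rw [Real.lt_sqrt (by norm_num), lt_div_iff₀ (by positivity)]
      linarith
    · have : sg S μ x ≤ sg S μ y := hmax hx
      rw [hs, div_mul_eq_mul_div, div_lt_one (by positivity)]
      linarith

theorem ext_lemma {S : Finset ι} {μ : ℝ} {K : Set (ι → ℂ)} (hK : IsCompact K) (hKD : K ⊆ Dm S μ) :
    ∃ s : ℝ, 1 < s ∧ ∀ g : (ι → ℂ) → ℂ, DifferentiableOn ℂ g (Dm S μ) →
      IntegrableOn (fun x => ‖g x‖ ^ 2) (Dm S μ) →
      (∃ M : ℝ, 0 ≤ M ∧ ∀ p : (ι → ℂ) → ℂ, DifferentiableOn ℂ p (Dm S μ) →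
        IntegrableOn (fun x => ‖p x‖ ^ 2) (Dm S μ) → ∀ C : ℝ, (∀ x ∈ K, ‖p x‖ ≤ C) →
        ‖∫ x in Dm S μ, g x * (starRingEnd ℂ) (p x)‖ ≤ M * C) →
      ∃ G : (ι → ℂ) → ℂ, DifferentiableOn ℂ G {x | sg S μ x < s ^ 2} ∧ ∀ x ∈ Dm S μ, G x = g x := by
  obtain ⟨s, hs1, hsK⟩ := exists_s hK hKD
  have hs0 : 0 < s := by linarith
  have hsn : ‖(s : ℂ)‖ = s := by simp [abs_of_pos hs0]
  set s' := (1 + s) / 2 with hs'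
  have hs'1 : 1 < s' := by rw [hs']; linarith
  have hs'0 : 0 < s' := by linarith
  have hs's : s' < s := by rw [hs']; linarith
  have hs'n : ‖(s' : ℂ)‖ = s' := by rw [Complex.norm_real, Real.norm_of_nonneg hs'0.le]
  refine ⟨s', hs'1, fun g hg hi ⟨M, hM, hMb⟩ => ?_⟩
  have hsKc : IsCompact ((fun x => dl S (s : ℂ) x) '' K) := hK.image (dl_diff_x S _).continuous
  have hsKD : (fun x => dl S (s : ℂ) x) '' K ⊆ Dm S μ := by
    rintro _ ⟨x, hx, rfl⟩
    rw [Dm, mem_setOf_eq, sg_dl, hsn]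
    exact hsK x hx
  obtain ⟨C, hC, hCb⟩ := sup_bound (isOpen_Dm S μ) hsKc hsKD
  have hN : ∀ j, ∫ x in Dm S μ, ‖hh S g j x‖ ^ 2 ≤ (M * √C * (s⁻¹) ^ j) ^ 2 := by
    intro j
    obtain ⟨h1, h2⟩ := Dm_hh hg hi j
    set N := ∫ x in Dm S μ, ‖hh S g j x‖ ^ 2 with hN
    have hN0 : 0 ≤ N := integral_nonneg fun x => by positivity
    have hb : ∀ x ∈ K, ‖hh S g j x‖ ≤ (s⁻¹) ^ j * (√C * √N) := by
      intro x hx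
      have h3 := hCb _ h1 h2 _ (mem_image_of_mem _ hx)
      have hxD : sg S μ x < 1 := hKD hx
      have h4 := hh_homog (S := S) (g := g) (x := x) (s : ℂ) (Dm_phi hg (by simpa using hxD))
        (by rw [hsn]; exact Dm_phi hg (hsK x hx)) j
      rw [h4, norm_mul, norm_pow, hsn] at h3
      have h5 : s ^ j * ‖hh S g j x‖ ≤ √C * √N := by
        rw [← Real.sqrt_mul hC]
        exact Real.le_sqrt_of_sq_le h3
      rw [inv_pow, inv_mul_eq_div, le_div_iff₀ (by positivity), mul_comm]
      exact h5
    have h6 := hMb _ h1 h2 _ hb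
    rw [Dm_inner hg hi j, ← hN, Complex.norm_real, Real.norm_of_nonneg hN0] at h6
    have h7 : √N ≤ M * √C * (s⁻¹) ^ j := by
      rcases hN0.eq_or_lt with h0 | h0
      · rw [← h0, Real.sqrt_zero]; positivity
      · have h8 : √N * √N = N := Real.mul_self_sqrt hN0
        have h9 : 0 < √N := Real.sqrt_pos.2 h0
        refine le_of_mul_le_mul_right ?_ h9
        rw [h8]
        refine h6.trans (le_of_eq (by ring))
    calc N = √N ^ 2 := (Real.sq_sqrt hN0).symm
      _ ≤ _ := by gcongr
  have hbd : ∀ K1 : Set (ι → ℂ), IsCompact K1 → K1 ⊆ Dm S μ → ∃ B : ℝ, ∀ j, ∀ x ∈ K1,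
      ‖hh S g j x‖ ≤ B * (s⁻¹) ^ j := by
    intro K1 hK1 hK1D
    obtain ⟨C1, hC1, hC1b⟩ := sup_bound (isOpen_Dm S μ) hK1 hK1D
    refine ⟨√C1 * (M * √C), fun j x hx => ?_⟩
    obtain ⟨h1, h2⟩ := Dm_hh hg hi j
    have h3 := hC1b _ h1 h2 x hx
    refine abs_le_of_sq_le_sq' ?_ (by positivity) |>.2
    refine h3.trans ((mul_le_mul_of_nonneg_left (hN j) hC1).trans (le_of_eq ?_))
    calc C1 * (M * √C * s⁻¹ ^ j) ^ 2 = √C1 ^ 2 * (M * √C * s⁻¹ ^ j) ^ 2 := by rw [Real.sq_sqrt hC1]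
      _ = _ := by ring
  have hdE : ∀ x, sg S μ x < s' ^ 2 → dl S ((s' : ℂ)⁻¹) x ∈ Dm S μ := by
    intro x hx
    rw [Dm, mem_setOf_eq, sg_dl, norm_inv, hs'n, inv_pow, inv_mul_eq_div, div_lt_one (by positivity)]
    exact hx
  have hEo : IsOpen {x | sg S μ x < s' ^ 2} := isOpen_lt (sg_contDiff S μ).continuous continuous_const
  have hsum : ∀ B : ℝ, Summable fun j : ℕ => s' ^ j * (B * (s⁻¹) ^ j) := by
    intro B
    have : Summable fun j : ℕ => B * (s' * s⁻¹) ^ j :=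
      (summable_geometric_of_lt_one (by positivity) (by rw [← div_eq_mul_inv, div_lt_one hs0]; exact hs's)).mul_left B
    refine this.congr fun j => ?_
    rw [mul_pow]; ring
  have hloc : ∀ x ∈ {x | sg S μ x < s' ^ 2}, ∃ r > 0, ∃ b : ℕ → ℝ, Integrable b Measure.count ∧
      ∀ᵐ j ∂Measure.count, ∀ y ∈ ball x r, ‖(s' : ℂ) ^ j * hh S g j (dl S ((s' : ℂ)⁻¹) y)‖ ≤ b j := by
    intro x hx
    obtain ⟨r, hr, hrE⟩ := Metric.isOpen_iff.1 hEo x hx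
    obtain ⟨B, hB⟩ := hbd ((fun x => dl S ((s' : ℂ)⁻¹) x) '' closedBall x (r/2))
      ((isCompact_closedBall _ _).image (dl_diff_x S _).continuous) (by
        rintro _ ⟨y, hy, rfl⟩
        exact hdE y (hrE (closedBall_subset_ball (by linarith) hy)))
    refine ⟨r/2, by positivity, fun j => s' ^ j * (B * (s⁻¹) ^ j), ?_, ae_of_all _ fun j y hy => ?_⟩
    · rw [integrable_count_iff]; exact (hsum B).norm
    · rw [norm_mul, norm_pow, hs'n]
      refine mul_le_mul_of_nonneg_left ?_ (by positivity)
      exact hB j _ (mem_image_of_mem _ (ball_subset_closedBall hy))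
  refine ⟨fun x => ∫ j, (s' : ℂ) ^ j * hh S g j (dl S ((s' : ℂ)⁻¹) x) ∂(Measure.count : Measure ℕ), ?_, ?_⟩
  · refine holo_integral (g := fun x j => (s' : ℂ) ^ j * hh S g j (dl S ((s' : ℂ)⁻¹) x)) hEo ?_ ?_ hloc
    · refine ae_of_all _ fun j => DifferentiableOn.const_mul ?_ _
      exact (Dm_hh hg hi j).1.comp (dl_diff_x S _).differentiableOn fun x hx => hdE x hx
    · intro x _
      exact (measurable_of_countable _).aestronglyMeasurable
  · intro x hx
    have hx1 : sg S μ x < 1 := hx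
    have hsx : sg S μ x < s' ^ 2 := by nlinarith
    obtain ⟨r, hr, b, hbi, hbb⟩ := hloc x hsx
    have hintg : Integrable (fun j => (s' : ℂ) ^ j * hh S g j (dl S ((s' : ℂ)⁻¹) x)) (Measure.count : Measure ℕ) :=
      hbi.mono' (measurable_of_countable _).aestronglyMeasurable (hbb.mono fun j hj => hj x (mem_ball_self hr))
    simp only
    rw [integral_countable hintg]
    simp only [measureReal_def, Measure.count_singleton, ENNReal.toReal_one, one_smul]
    obtain ⟨r, hr1, hr2⟩ := exists_s (isCompact_singleton (x := x)) (by simpa using hx)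
    rw [← (hh_sum hr1 (Dm_phi hg (hr2 x rfl))).tsum_eq]
    congr 1
    funext j
    have hs'c : (s' : ℂ) ≠ 0 := by exact_mod_cast hs'0.ne'
    have hy : sg S μ (dl S ((s' : ℂ)⁻¹) x) = (s' ^ 2)⁻¹ * sg S μ x := by
      rw [sg_dl, norm_inv, hs'n, inv_pow]
    rw [← hh_homog (S := S) (g := g) (s' : ℂ) (Dm_phi hg (by
      rw [one_pow, one_mul]; exact hdE x hsx)) (by
      rw [hs'n]; refine Dm_phi hg ?_
      rw [hy, mul_inv_cancel_left₀ (by positivity)]; exact hx1), dl_mul, mul_inv_cancel₀ hs'c, dl_one]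

end FBHProof
end

section
open MeasureTheory Metric Set Filter Topology

namespace FBHProof

variable {ι : Type*} [Fintype ι] [DecidableEq ι]

theorem sg_empty (ζ : ι → ℂ) : sg ∅ 0 ζ = XX Finset.univ ζ := by
  simp [sg]

theorem radial_zero {D : Set (ι → ℂ)} (hD : IsOpen D) {f : (ι → ℂ) → (ι → ℂ)}
    (hf : ∀ k, DifferentiableOn ℂ (fun y => f y k) D) {h : (ι → ℂ) → ℂ}
    (hh : DifferentiableOn ℂ h D) {δ : ℝ} (hP : ∀ α β, 0 < α → β < δ →
      IsCompact (f ⁻¹' {ζ | XX Finset.univ ζ ∈ Icc α β} ∩ D)) (j : ι)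
    {B : ℝ → ℝ} (hB : Tst (Ioo 0 δ) B) {q : ℕ} (hq : q + 1 = Fintype.card ι)
    (hintg : ∫ x, B x * (x ^ q * Real.exp (- 0 * x)) = 0) :
    ∫ x in D, jdet f x * B (XX Finset.univ (f x)) * (starRingEnd ℂ) (h x) = 0 := by
  obtain ⟨b, hbT, hbe⟩ := ode1 (fun x hx => hx.1) hB q 0 hintg
  obtain ⟨hbc, α, β, hab, hU, h0⟩ := hbT
  have h1c : ContDiff ℝ 1 (fun _ : ℝ => (1:ℝ)) := contDiff_const
  have key : ∀ i, _ := fun i => div_zero_integral hD hf hh (fld_contDiff ∅ 0 j 0 h1c hbc i)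
    (K := {ζ : ι → ℂ | XX Finset.univ ζ ∈ Icc α β}) (by
      intro ζ hζ
      unfold fld
      rw [sg_empty, h0 _ hζ]; simp) (hP α β (hU ⟨le_rfl, hab⟩).1 (hU ⟨hab, le_rfl⟩).2) i
  have e := integral_finsetSum (Finset.univ : Finset ι) (fun i _ => (key i).1)
  rw [Finset.sum_eq_zero fun i _ => (key i).2] at e
  rw [← e]
  congr 1
  funext x
  rw [← Finset.sum_mul, ← Finset.mul_sum]
  have := div1 ∅ 0 j 0 h1c hbc (f x)
  rw [Finset.compl_empty] at this
  rw [this, sg_empty, ← hbe]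
  have hc : ((Fintype.card ι : ℕ) : ℂ) = q + 1 := by rw [← hq]; push_cast; ring
  simp only [Finset.card_univ, Finset.mem_univ, if_true, add_zero, pow_zero, Complex.ofReal_one, hc]
  push_cast
  ring

theorem radial_int {D : Set (ι → ℂ)} (hD : IsOpen D) {f : (ι → ℂ) → (ι → ℂ)}
    (hf : ∀ k, DifferentiableOn ℂ (fun y => f y k) D) {δ : ℝ} (hP : ∀ α β, 0 < α → β < δ →
      IsCompact (f ⁻¹' {ζ | XX Finset.univ ζ ∈ Icc α β} ∩ D))
    {B : ℝ → ℝ} (hB : Tst (Ioo 0 δ) B) :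
    IntegrableOn (fun x => ‖jdet f x‖ ^ 2 * B (XX Finset.univ (f x))) D := by
  obtain ⟨hbc, α, β, hab, hU, h0⟩ := hB
  have hfc : ContinuousOn f D := continuousOn_pi.2 fun i => (hf i).continuousOn
  have e1 := (hbc.continuous.comp (XX_contDiff (Finset.univ : Finset ι)).continuous).comp_continuousOn hfc
  have e2 : ContinuousOn (fun x => ((‖jdet f x‖ ^ 2 * B (XX Finset.univ (f x)) : ℝ) : ℂ)) D :=
    Complex.continuous_ofReal.comp_continuousOn (((jdet_holo hD hf).continuousOn.norm.pow 2).mul e1)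
  have := int_of_compact hD (hP α β (hU ⟨le_rfl, hab⟩).1 (hU ⟨hab, le_rfl⟩).2) inter_subset_right e2 (by
    intro x hx hn
    have : ¬ (XX Finset.univ (f x) ∈ Icc α β) := fun h => hn ⟨h, hx⟩
    rw [h0 _ this]; simp)
  exact this.re

theorem radial_rel {D : Set (ι → ℂ)} (hD : IsOpen D) {f : (ι → ℂ) → (ι → ℂ)}
    (hf : ∀ k, DifferentiableOn ℂ (fun y => f y k) D) {δ : ℝ} (hP : ∀ α β, 0 < α → β < δ →
      IsCompact (f ⁻¹' {ζ | XX Finset.univ ζ ∈ Icc α β} ∩ D)) (j : ι)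
    {B B0 : ℝ → ℝ} (hB : Tst (Ioo 0 δ) B) (hB0 : Tst (Ioo 0 δ) B0) {q : ℕ} (hq : q + 1 = Fintype.card ι) :
    (∫ x, B0 x * (x ^ q * Real.exp (- 0 * x))) * ∫ x in D, ‖jdet f x‖ ^ 2 * B (XX Finset.univ (f x)) =
    (∫ x, B x * (x ^ q * Real.exp (- 0 * x))) * ∫ x in D, ‖jdet f x‖ ^ 2 * B0 (XX Finset.univ (f x)) := by
  set W : ℝ → ℝ := fun x => x ^ q * Real.exp (- 0 * x) with hW
  have hWc : Continuous W := by fun_prop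
  have hcomb : ∫ x, ((∫ t, B0 t * W t) * B x - (∫ t, B t * W t) * B0 x) * W x = 0 := by
    have e : ∀ x, ((∫ t, B0 t * W t) * B x - (∫ t, B t * W t) * B0 x) * W x =
       (∫ t, B0 t * W t) * (B x * W x) - (∫ t, B t * W t) * (B0 x * W x) := fun x => by ring
    simp only [e]
    rw [integral_sub ((hB.integrable hWc).const_mul _) ((hB0.integrable hWc).const_mul _),
      integral_const_mul, integral_const_mul]
    ring
  have h1 := radial_zero hD hf (jdet_holo hD hf) hP j (hB.comb hB0 (∫ t, B0 t * W t) (∫ t, B t * W t)) hq hcomb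
  have h2 : ∫ x in D, (‖jdet f x‖ ^ 2 * ((∫ t, B0 t * W t) * B (XX Finset.univ (f x)) -
      (∫ t, B t * W t) * B0 (XX Finset.univ (f x)))) = 0 := by
    rw [← Complex.ofReal_eq_zero, ← integral_complex_ofReal, ← h1]
    congr 1
    funext x
    have : ((‖jdet f x‖ : ℝ) : ℂ) ^ 2 = jdet f x * (starRingEnd ℂ) (jdet f x) := (Complex.mul_conj' _).symm
    push_cast
    rw [this]
    ring
  have e := integral_sub ((radial_int hD hf hP hB).const_mul (∫ t, B0 t * W t))
      ((radial_int hD hf hP hB0).const_mul (∫ t, B t * W t))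
  rw [integral_const_mul, integral_const_mul] at e
  rw [← sub_eq_zero, ← e, ← h2]
  congr 1
  funext x
  ring

theorem Tst.scale {B : ℝ → ℝ} (hB : Tst (Ioo 0 1) B) {η δ : ℝ} (hη : 0 < η) (hηδ : η ≤ δ) :
    Tst (Ioo 0 δ) (fun x => B (x / η)) := by
  obtain ⟨hbc, α, β, hab, hU, h0⟩ := hB
  refine ⟨hbc.comp (by fun_prop), α * η, β * η, by gcongr, ?_, ?_⟩
  · have h1 := (hU ⟨le_rfl, hab⟩).1
    have h2 := (hU ⟨hab, le_rfl⟩).2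
    intro x hx
    exact ⟨lt_of_lt_of_le (by positivity) hx.1, lt_of_le_of_lt hx.2 (by nlinarith)⟩
  · intro x hx
    apply h0
    intro h
    apply hx
    rw [mem_Icc, le_div_iff₀ hη, div_le_iff₀ hη] at h
    exact h

theorem jdet_id (x : ι → ℂ) : jdet (fun y : ι → ℂ => y) x = 1 := by
  have : jac (fun y : ι → ℂ => y) x = 1 := by
    ext k i
    have h : HasFDerivAt (fun y : ι → ℂ => y k) (ContinuousLinearMap.proj (R := ℂ) (φ := fun _ : ι => ℂ) k) x :=
      (ContinuousLinearMap.proj (R := ℂ) (φ := fun _ : ι => ℂ) k).hasFDerivAt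
    simp only [jac, Matrix.of_apply, h.fderiv, ContinuousLinearMap.proj_apply, Pi.single_apply, Matrix.one_apply]
  rw [jdet, this, Matrix.det_one]

theorem XX_box (α β : ℝ) : IsCompact {ζ : ι → ℂ | XX Finset.univ ζ ∈ Icc α β} := by
  have := isCompact_box (ι := ι) ∅ le_rfl 0 0 α β
  convert this using 1
  ext ζ
  have h0 : XX (∅ : Finset ι) ζ = 0 := by simp [XX]
  simp [sg_empty, h0]

/-- change of variables with complex determinant -/
theorem chg {s : Set (ι → ℂ)} (hs : IsOpen s) {f : (ι → ℂ) → (ι → ℂ)}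
    (hf : ∀ k, DifferentiableOn ℂ (fun y => f y k) s) (hinj : InjOn f s) (g : (ι → ℂ) → ℝ) :
    ∫ y in f '' s, g y = ∫ x in s, ‖jdet f x‖ ^ 2 * g (f x) := by
  have hder : ∀ x ∈ s, HasFDerivWithinAt f ((ContinuousLinearMap.pi fun k => fderiv ℂ (fun y => f y k) x :
      (ι → ℂ) →L[ℂ] (ι → ℂ)).restrictScalars ℝ) s x := fun x hx =>
    ((hasFDerivAt_pi.2 fun k => ((hf k).differentiableAt (hs.mem_nhds hx)).hasFDerivAt).restrictScalars ℝ).hasFDerivWithinAt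
  rw [integral_image_eq_integral_abs_det_fderiv_smul volume hs.measurableSet hder hinj]
  congr 1
  funext x
  have : ((ContinuousLinearMap.pi fun k => fderiv ℂ (fun y => f y k) x :
      (ι → ℂ) →L[ℂ] (ι → ℂ)).restrictScalars ℝ).det = ‖jdet f x‖ ^ 2 := by
    rw [← Complex.normSq_eq_norm_sq, ← Algebra.norm_complex_apply, ← det_fderiv, ContinuousLinearMap.det,
      ContinuousLinearMap.det, ← LinearMap.det_restrictScalars]
    rfl
  rw [this, abs_of_nonneg (by positivity), smul_eq_mul]

end FBHProof
end

section
open MeasureTheory Metric Set Filter Topology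

namespace FBHProof

variable {ι : Type*} [Fintype ι] [DecidableEq ι]

theorem contDiffAt_holo {D : Set (ι → ℂ)} (hD : IsOpen D) {f : (ι → ℂ) → (ι → ℂ)}
    (hf : ∀ k, DifferentiableOn ℂ (fun y => f y k) D) {x : ι → ℂ} (hx : x ∈ D) : ContDiffAt ℂ 1 f x := by
  refine contDiffAt_pi.2 fun k => ?_
  have : ContDiffOn ℂ (0 + 1) (fun y => f y k) D :=
    (contDiffOn_succ_iff_fderiv_of_isOpen hD).2 ⟨hf k, by simp,
      contDiffOn_zero.2 (fderiv_holo' hD (hf k)).continuousOn⟩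
  rw [zero_add] at this
  exact this.contDiffAt (hD.mem_nhds hx)

theorem local_inj {D : Set (ι → ℂ)} (hD : IsOpen D) {f : (ι → ℂ) → (ι → ℂ)}
    (hf : ∀ k, DifferentiableOn ℂ (fun y => f y k) D) {x : ι → ℂ} (hx : x ∈ D) (hxj : jdet f x ≠ 0) :
    ∃ s ⊆ D, IsOpen s ∧ InjOn f s ∧ f '' s ∈ 𝓝 (f x) := by
  have hcd := contDiffAt_holo hD hf hx
  have hder : HasFDerivAt f (ContinuousLinearMap.pi fun k => fderiv ℂ (fun y => f y k) x) x :=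
    hasFDerivAt_pi.2 fun k => ((hf k).differentiableAt (hD.mem_nhds hx)).hasFDerivAt
  have hdet : (ContinuousLinearMap.pi fun k => fderiv ℂ (fun y => f y k) x : (ι → ℂ) →L[ℂ] (ι → ℂ)).det ≠ 0 := by
    rw [det_fderiv]; exact hxj
  set f' := ContinuousLinearMap.toContinuousLinearEquivOfDetNeZero _ hdet with hf'
  have hder' : HasFDerivAt f (f' : (ι → ℂ) →L[ℂ] (ι → ℂ)) x := by
    rw [hf', ContinuousLinearMap.coe_toContinuousLinearEquivOfDetNeZero]; exact hder
  have hs := hcd.hasStrictFDerivAt' hder' one_ne_zero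
  have hc := hs.toOpenPartialHomeomorph_coe
  set e := hs.toOpenPartialHomeomorph f with he
  have hxe : x ∈ e.source := hs.mem_toOpenPartialHomeomorph_source
  refine ⟨e.source ∩ D, inter_subset_right, e.open_source.inter hD, ?_, ?_⟩
  · rw [← hc]; exact e.injOn.mono inter_subset_left
  · rw [← hc]
    exact e.image_mem_nhds hxe (inter_mem (e.open_source.mem_nhds hxe) (hD.mem_nhds hx))

theorem XX_zero (S : Finset ι) : XX S (0 : ι → ℂ) = 0 := by simp [XX]

theorem XX_small {t : Set (ι → ℂ)} (ht : t ∈ 𝓝 (0 : ι → ℂ)) :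
    ∃ η > 0, ∀ ζ, XX Finset.univ ζ < η → ζ ∈ t := by
  obtain ⟨r, hr, h⟩ := Metric.mem_nhds_iff.1 ht
  refine ⟨r ^ 2, by positivity, fun ζ hζ => h ?_⟩
  rw [mem_ball_zero_iff, pi_norm_lt_iff hr]
  intro i
  exact lt_of_pow_lt_pow_left₀ 2 hr.le ((XX_le (Finset.mem_univ i) ζ).trans_lt hζ)

theorem id_hP {δ : ℝ} (α β : ℝ) (_ : 0 < α) (_ : β < δ) :
    IsCompact ((fun y : ι → ℂ => y) ⁻¹' {ζ | XX Finset.univ ζ ∈ Icc α β} ∩ univ) := by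
  rw [inter_univ]; exact XX_box α β

theorem bB_ne {x : ℝ} (hx : x = 1/2) : bB 0 x ≠ 0 := by
  subst hx
  have h1 : 0 < Real.smoothTransition (((0:ℕ) + 3 : ℝ) * (1/2) - 1) := Real.smoothTransition.pos_of_pos (by norm_num)
  have h2 : 0 < Real.smoothTransition (((0:ℕ) + 3 : ℝ) * (1 - 1/2) - 1) := Real.smoothTransition.pos_of_pos (by norm_num)
  exact (mul_pos h1 h2).ne'

theorem core_lower [Nonempty ι] {U : Set (ι → ℂ)} (hU : IsOpen U) {f : (ι → ℂ) → (ι → ℂ)}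
    (hf : ∀ k, DifferentiableOn ℂ (fun y => f y k) U) {x₀ : ι → ℂ} (hx : x₀ ∈ U) (h0 : f x₀ = 0)
    (hj : jdet f x₀ ≠ 0) {δ : ℝ} (hδ : 0 < δ) (hP : ∀ α β, 0 < α → β < δ →
      IsCompact (f ⁻¹' {ζ | XX Finset.univ ζ ∈ Icc α β} ∩ U)) :
    ∫ ζ : ι → ℂ, bB 0 (XX Finset.univ ζ / δ) ≤ ∫ x in U, ‖jdet f x‖ ^ 2 * bB 0 (XX Finset.univ (f x) / δ) := by
  obtain ⟨s, hsU, hs, hinj, him⟩ := local_inj hU hf hx hj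
  rw [h0] at him
  obtain ⟨η', hη', hsm⟩ := XX_small him
  set η := min η' δ
  have hη : 0 < η := lt_min hη' hδ
  have hηδ : η ≤ δ := min_le_right _ _
  have hT := (bB_tst 0).scale hη hηδ
  have hT0 := (bB_tst 0).scale hδ le_rfl
  obtain ⟨j⟩ := ‹Nonempty ι›
  obtain ⟨q, hq⟩ : ∃ q, q + 1 = Fintype.card ι := ⟨Fintype.card ι - 1, Nat.sub_add_cancel (Fintype.card_pos_iff.2 ⟨j⟩)⟩
  have r1 := radial_rel hU hf hP j hT hT0 hq
  have r2 := radial_rel (f := fun y : ι → ℂ => y) isOpen_univ (fun k => (differentiable_apply k).differentiableOn)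
    (id_hP (δ := δ)) j hT hT0 hq
  simp only [jdet_id, norm_one, one_pow, one_mul, setIntegral_univ] at r2
  have hlow : ∫ ζ : ι → ℂ, bB 0 (XX Finset.univ ζ / η) ≤ ∫ x in U, ‖jdet f x‖ ^ 2 * bB 0 (XX Finset.univ (f x) / η) := by
    calc _ = ∫ ζ in f '' s, bB 0 (XX Finset.univ ζ / η) := by
          refine (setIntegral_eq_integral_of_forall_compl_eq_zero fun ζ hζ => ?_).symm
          obtain ⟨_, a, b, hab, hU', h0'⟩ := bB_tst 0
          apply h0'
          intro h
          apply hζ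
          apply hsm
          have := (hU' h).2
          rw [div_lt_one hη] at this
          exact this.trans_le (min_le_left _ _)
      _ = ∫ x in s, ‖jdet f x‖ ^ 2 * bB 0 (XX Finset.univ (f x) / η) :=
          chg hs (fun k => (hf k).mono hsU) hinj (fun ζ => bB 0 (XX Finset.univ ζ / η))
      _ ≤ _ := by
          refine setIntegral_mono_set (radial_int hU hf hP hT) ?_ (Eventually.of_forall hsU)
          exact Eventually.of_forall fun x => mul_nonneg (by positivity) (bB_nonneg _ _)
  have hWp : ∀ {θ : ℝ}, 0 < θ → 0 < ∫ x, bB 0 (x / θ) * (x ^ q * Real.exp (- 0 * x)) := by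
    intro θ hθ
    refine wt_pos (U := Ioo 0 θ) (W := fun x => x ^ q * Real.exp (- 0 * x)) ((bB_tst 0).scale hθ le_rfl) (by fun_prop) (fun x => bB_nonneg _ _) (fun x hx => ?_)
      (x₀ := θ / 2) (bB_ne (by field_simp)) (by positivity)
    have := hx.1
    positivity
  have hp1 := hWp hη
  have hp2 := hWp hδ
  refine le_of_mul_le_mul_left ?_ hp1
  rw [← r1, ← r2]
  exact mul_le_mul_of_nonneg_left hlow hp2.le

theorem core_pos [Nonempty ι] {δ : ℝ} (hδ : 0 < δ) : 0 < ∫ ζ : ι → ℂ, bB 0 (XX Finset.univ ζ / δ) := by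
  obtain ⟨i⟩ := ‹Nonempty ι›
  obtain ⟨hc, a, b, hab, hU', h0'⟩ := (bB_tst 0).scale hδ le_rfl
  refine Continuous.integral_pos_of_hasCompactSupport_nonneg_nonzero
    (hc.continuous.comp (XX_contDiff (Finset.univ : Finset ι)).continuous) ?_ (fun _ => bB_nonneg _ _)
    (x := Pi.single i ((Real.sqrt (δ / 2) : ℝ) : ℂ)) ?_
  · exact HasCompactSupport.intro (XX_box a b) fun ζ hζ => h0' _ hζ
  · apply bB_ne
    have : XX Finset.univ (Pi.single i ((Real.sqrt (δ / 2) : ℝ) : ℂ) : ι → ℂ) = δ / 2 := by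
      rw [XX, Finset.sum_eq_single i]
      · rw [Pi.single_eq_same, Complex.norm_real, Real.norm_eq_abs, sq_abs, Real.sq_sqrt (by positivity)]
      · intro k _ hk; simp [Pi.single_eq_of_ne hk]
      · simp
    rw [this]
    field_simp

theorem jac_pert {D : Set (ι → ℂ)} (hD : IsOpen D) {f : (ι → ℂ) → (ι → ℂ)}
    (hf : ∀ k, DifferentiableOn ℂ (fun y => f y k) D) {x x₀ c : ι → ℂ} (hx : x ∈ D) (ε : ℂ) :
    jac (fun y => f y - c + ε • (y - x₀)) x = jac f x + ε • (1 : Matrix ι ι ℂ) := by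
  ext k i
  have h1 := ((hf k).differentiableAt (hD.mem_nhds hx)).hasFDerivAt
  have h2 : HasFDerivAt (fun y : ι → ℂ => y k) (ContinuousLinearMap.proj (R := ℂ) (φ := fun _ : ι => ℂ) k) x :=
      (ContinuousLinearMap.proj (R := ℂ) (φ := fun _ : ι => ℂ) k).hasFDerivAt
  have h3 : HasFDerivAt (fun y => (f y - c + ε • (y - x₀)) k) _ x :=
    (h1.sub_const (c k)).add ((h2.sub_const (x₀ k)).const_smul ε)
  simp only [jac, Matrix.of_apply, h3.fderiv]
  simp [Pi.single_apply, Matrix.one_apply]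

theorem det_pert (A : Matrix ι ι ℂ) : ∀ᶠ ε in 𝓝[≠] (0:ℂ), (A + ε • (1 : Matrix ι ι ℂ)).det ≠ 0 := by
  have h : {ε : ℂ | (A + ε • (1 : Matrix ι ι ℂ)).det = 0} ⊆ ((-A).charpoly.roots.toFinset : Set ℂ) := by
    intro ε hε
    have hne := (Matrix.charpoly_monic (-A)).ne_zero
    simp only [Finset.mem_coe, Multiset.mem_toFinset, Polynomial.mem_roots hne, Polynomial.IsRoot]
    rw [Matrix.eval_charpoly]
    convert hε.out using 2
    rw [sub_neg_eq_add, add_comm, Matrix.scalar_apply, Matrix.smul_one_eq_diagonal]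
  have hfin := (Finset.finite_toSet _).subset h
  have := hfin.subset (sdiff_subset (t := {0})) |>.isClosed.compl_mem_nhds (x := (0:ℂ)) (by simp)
  filter_upwards [mem_nhdsWithin_of_mem_nhds this, self_mem_nhdsWithin] with ε h1 h2 h3
  exact h1 ⟨h3, h2⟩

end FBHProof
end

section
open MeasureTheory Metric Set Filter Topology

namespace FBHProof

variable {ι : Type*} [Fintype ι] [DecidableEq ι]

theorem jdet_ne [Nonempty ι] {D : Set (ι → ℂ)} (hD : IsOpen D) {f : (ι → ℂ) → (ι → ℂ)}
    (hf : ∀ k, DifferentiableOn ℂ (fun y => f y k) D) {x₀ : ι → ℂ} (hx : x₀ ∈ D)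
    (hcomp : IsCompact (f ⁻¹' {f x₀} ∩ D)) : ∃ x ∈ D, jdet f x ≠ 0 := by
  by_contra! hz
  obtain ⟨U, hU, hKU, hUD, hUc⟩ := exists_open_between_and_isCompact_closure hcomp hD inter_subset_right
  have hxU : x₀ ∈ U := hKU ⟨rfl, hx⟩
  have hUD' : U ⊆ D := subset_closure.trans hUD
  set F : ℂ → (ι → ℂ) → (ι → ℂ) := fun ε y => f y - f x₀ + ε • (y - x₀) with hF
  have hfc : ContinuousOn f D := continuousOn_pi.2 fun k => (hf k).continuousOn
  have hFc : ∀ y ∈ D, ContinuousAt (fun z : ℂ × (ι → ℂ) => XX Finset.univ (F z.1 z.2)) (0, y) := by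
    intro y hy
    refine (XX_contDiff (Finset.univ : Finset ι)).continuous.continuousAt.comp ?_
    have : ContinuousAt (fun z : ℂ × (ι → ℂ) => f z.2) (0, y) :=
      ContinuousAt.comp (f := Prod.snd) (hfc.continuousAt (hD.mem_nhds hy)) continuousAt_snd
    exact (this.sub continuousAt_const).add (continuousAt_fst.smul (continuousAt_snd.sub continuousAt_const))
  have hfrD : frontier U ⊆ D := frontier_subset_closure.trans hUD
  have hpos : ∀ y ∈ frontier U, 0 < XX Finset.univ (F 0 y) := by
    intro y hy
    refine lt_of_le_of_ne (XX_nonneg _ _) fun h => ?_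
    have h2 : f y = f x₀ := by
      funext k
      have := XX_le (Finset.mem_univ k) (F 0 y)
      rw [← h] at this
      have h3 : ‖F 0 y k‖ = 0 := by
        have := norm_nonneg (F 0 y k); nlinarith
      simp [hF] at h3
      exact sub_eq_zero.1 h3
    have : y ∈ U := hKU ⟨h2, hfrD hy⟩
    rw [hU.frontier_eq] at hy
    exact hy.2 this
  have hfrc : IsCompact (frontier U) := hUc.of_isClosed_subset isClosed_frontier frontier_subset_closure
  obtain ⟨m, hm, hmle⟩ : ∃ m, 0 < m ∧ ∀ y ∈ frontier U, m ≤ XX Finset.univ (F 0 y) := by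
    have hcc : ContinuousOn (fun y => XX Finset.univ (F 0 y)) (frontier U) := by
      intro y hy
      have := (hFc y (hfrD hy)).comp (f := fun y => ((0:ℂ), y)) (x := y) (by fun_prop)
      exact this.continuousWithinAt
    exact hfrc.exists_forall_le' hcc hpos
  set δ := m / 2 with hδd
  have hδ : 0 < δ := by positivity
  have ev1 : ∀ᶠ ε in 𝓝 (0:ℂ), ∀ y ∈ frontier U, δ < XX Finset.univ (F ε y) := by
    refine hfrc.eventually_forall_of_forall_eventually fun y hy => ?_
    exact (hFc y (hfrD hy)).eventually (lt_mem_nhds (lt_of_lt_of_le (by simp [hδd]; linarith) (hmle y hy)))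
  set κ₀ := ∫ ζ : ι → ℂ, bB 0 (XX Finset.univ ζ / δ) with hκ
  have hκ0 : 0 < κ₀ := core_pos hδ
  set κ := κ₀ / (volume.real U + 1) with hκd
  have hκp : 0 < κ := by positivity
  have ev2 : ∀ᶠ ε in 𝓝 (0:ℂ), ∀ y ∈ closure U, ‖(jac f y + ε • (1 : Matrix ι ι ℂ)).det‖ ^ 2 < κ := by
    refine hUc.eventually_forall_of_forall_eventually fun y hy => ?_
    have hy := hUD hy
    have hc : ContinuousAt (fun z : ℂ × (ι → ℂ) => ‖(jac f z.2 + z.1 • (1 : Matrix ι ι ℂ)).det‖ ^ 2) (0, y) := by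
      have h1 : ContinuousAt (fun z : ℂ × (ι → ℂ) => jac f z.2) (0, y) := by
        have hJ : ContinuousAt (jac f) y := continuousAt_pi.2 fun k => continuousAt_pi.2 fun i =>
          ((jac_holo hD hf k i).differentiableAt (hD.mem_nhds hy)).continuousAt
        exact ContinuousAt.comp (g := jac f) (f := Prod.snd) hJ continuousAt_snd
      have h2 : ContinuousAt (fun z : ℂ × (ι → ℂ) => jac f z.2 + z.1 • (1 : Matrix ι ι ℂ)) (0, y) :=
        h1.add (continuousAt_fst.smul continuousAt_const)
      have h3 : ContinuousAt (fun z : ℂ × (ι → ℂ) => (jac f z.2 + z.1 • (1 : Matrix ι ι ℂ)).det) (0, y) :=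
        ContinuousAt.comp (g := fun M : Matrix ι ι ℂ => M.det) (continuous_id.matrix_det.continuousAt) h2
      exact h3.norm.pow 2
    refine hc.eventually (gt_mem_nhds ?_)
    have := hz y hy
    rw [jdet] at this
    simp [this, hκp]
  obtain ⟨ε, hε1, hε2, hε3⟩ := ((det_pert (jac f x₀)).and ((mem_nhdsWithin_of_mem_nhds (ev1.and ev2)))).exists
  have hFd : ∀ k, DifferentiableOn ℂ (fun y => F ε y k) U := by
    intro k
    have h2 : DifferentiableOn ℂ (fun y : ι → ℂ => y k) U := (differentiable_apply k).differentiableOn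
    exact (((hf k).mono hUD').sub_const (f x₀ k)).add ((h2.sub_const (x₀ k)).const_smul ε)
  have hjF : ∀ y ∈ U, jdet (F ε) y = (jac f y + ε • (1 : Matrix ι ι ℂ)).det := by
    intro y hy
    rw [jdet, jac_pert hD hf (hUD' hy)]
  have hFcont : ContinuousOn (F ε) (closure U) :=
    ((hfc.mono hUD).sub continuousOn_const).add (by fun_prop)
  have hP : ∀ α β, 0 < α → β < δ → IsCompact (F ε ⁻¹' {ζ | XX Finset.univ ζ ∈ Icc α β} ∩ U) := by
    intro α β _ hβ
    have : F ε ⁻¹' {ζ | XX Finset.univ ζ ∈ Icc α β} ∩ U = closure U ∩ F ε ⁻¹' {ζ | XX Finset.univ ζ ∈ Icc α β} := by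
      rw [inter_comm]
      apply Subset.antisymm
      · exact inter_subset_inter_left _ subset_closure
      · rintro y ⟨h1, h2⟩
        refine ⟨?_, h2⟩
        by_contra h3
        have := hε2 y (by rw [hU.frontier_eq]; exact ⟨h1, h3⟩)
        have h4 : XX Finset.univ (F ε y) ≤ β := h2.2
        linarith
    rw [this]
    have hcl : IsClosed {ζ : ι → ℂ | XX Finset.univ ζ ∈ Icc α β} := (XX_box α β).isClosed
    exact hUc.of_isClosed_subset (hFcont.preimage_isClosed_of_isClosed isClosed_closure hcl) inter_subset_left
  have hlow := core_lower hU hFd hxU (by simp [hF]) (by rw [hjF _ hxU]; exact hε1) hδ hP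
  have hvol : volume U < ⊤ := (measure_mono subset_closure).trans_lt hUc.measure_lt_top
  have hup : ∫ x in U, ‖jdet (F ε) x‖ ^ 2 * bB 0 (XX Finset.univ (F ε x) / δ) ≤ κ * volume.real U := by
    have := norm_setIntegral_le_of_norm_le_const (μ := volume) (s := U) (C := κ)
      (f := fun x => ‖jdet (F ε) x‖ ^ 2 * bB 0 (XX Finset.univ (F ε x) / δ)) hvol (by
        intro x hx
        rw [Real.norm_of_nonneg (mul_nonneg (by positivity) (bB_nonneg _ _)), hjF x hx]
        have := hε3 x (subset_closure hx)
        have h2 := bB_le 0 (XX Finset.univ (F ε x) / δ)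
        have h3 := bB_nonneg 0 (XX Finset.univ (F ε x) / δ)
        nlinarith [sq_nonneg ‖(jac f x + ε • (1 : Matrix ι ι ℂ)).det‖])
    exact (le_abs_self _).trans this
  have hv : 0 ≤ volume.real U := measureReal_nonneg
  have : κ * volume.real U < κ₀ := by
    rw [hκd, div_mul_eq_mul_div, div_lt_iff₀ (by positivity)]
    nlinarith
  linarith

end FBHProof
end

section
open MeasureTheory Metric Set Filter Topology

namespace FBHProof

variable {ι : Type*} [Fintype ι] [DecidableEq ι]

theorem ident {U : Set (ι → ℂ)} (hU : IsOpen U) (hc : IsPreconnected U) {g : (ι → ℂ) → ℂ}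
    (hg : DifferentiableOn ℂ g U) {a : ι → ℂ} (ha : a ∈ U) (h0 : ∀ᶠ x in 𝓝 a, g x = 0) :
    ∀ x ∈ U, g x = 0 := by
  have hsub : U ⊆ {x | ∀ᶠ y in 𝓝 x, g y = 0} := by
    refine hc.subset_of_closure_inter_subset isOpen_setOf_eventually_nhds ⟨a, ha, h0⟩ ?_
    rintro x ⟨hx, hxU⟩
    obtain ⟨r, hr, hrU⟩ := Metric.isOpen_iff.1 hU x hxU
    obtain ⟨b, hb, hbx⟩ := Metric.mem_closure_iff.1 hx r hr
    have hb2 : b ∈ ball x r := by rw [mem_ball, dist_comm]; exact hbx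
    filter_upwards [ball_mem_nhds x hr] with y hy
    set Ω : Set ℂ := {t | b + t • (y - b) ∈ ball x r} with hΩ
    have hΩo : IsOpen Ω := isOpen_ball.preimage (by fun_prop : Continuous fun t : ℂ => b + t • (y - b))
    have hΩc : Convex ℝ Ω := by
      have e : Ω = (fun t : ℂ => t • (y - b)) ⁻¹' ((fun z => b + z) ⁻¹' ball x r) := rfl
      rw [e]
      exact ((convex_ball x r).translate_preimage_right b).is_linear_preimage
        (f := fun t : ℂ => t • (y - b)) ⟨fun s t => add_smul _ _ _, fun c t => by simp [mul_smul]⟩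
    have hd : DifferentiableOn ℂ (fun t : ℂ => g (b + t • (y - b))) Ω := fun t ht =>
      (line_diffAt (hg.differentiableAt (hU.mem_nhds (hrU ht)))).differentiableWithinAt
    have h0' : ∀ᶠ t in 𝓝 (0:ℂ), g (b + t • (y - b)) = 0 := by
      have ht : Tendsto (fun t : ℂ => b + t • (y - b)) (𝓝 0) (𝓝 b) := by
        have : Continuous (fun t : ℂ => b + t • (y - b)) := by fun_prop
        simpa using this.tendsto 0
      exact ht.eventually hb
    have := (hd.analyticOnNhd hΩo).eqOn_zero_of_preconnected_of_eventuallyEq_zero hΩc.isPreconnected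
      (z₀ := 0) (by simp [hΩ]; simpa using hb2) h0'
    have h1 := this (x := 1) (by simp only [hΩ, mem_setOf_eq, one_smul]; convert hy using 1; abel)
    simpa using h1
  intro x hx
  exact (hsub hx).self_of_nhds

theorem ident_freq {U : Set (ι → ℂ)} (hU : IsOpen U) (hc : IsPreconnected U) {g : (ι → ℂ) → ℂ}
    (hg : DifferentiableOn ℂ g U) {b : ι → ℂ} (hb : b ∈ U) (hgb : g b ≠ 0) {a : ι → ℂ} (ha : a ∈ U) :
    ∃ᶠ x in 𝓝 a, g x ≠ 0 := by
  intro h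
  simp only [not_not] at h
  exact hgb (ident hU hc hg ha h b hb)

theorem div1v {Ω : Set ℂ} (hΩ : IsOpen Ω) (hc : IsPreconnected Ω) {φ ψ : ℂ → ℂ} {χ : ℕ → ℂ → ℂ}
    (hφ : DifferentiableOn ℂ φ Ω) (hψ : DifferentiableOn ℂ ψ Ω) (hχ : ∀ k, DifferentiableOn ℂ (χ k) Ω)
    (hrel : ∀ k, ∀ t ∈ Ω, ψ t ^ (k + 1) = φ t ^ k * χ k t) {t₀ : ℂ} (ht₀ : t₀ ∈ Ω) (hne : φ t₀ ≠ 0) :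
    ∃ h : ℂ → ℂ, DifferentiableOn ℂ h Ω ∧ ∀ t ∈ Ω, φ t * h t = ψ t := by
  have aφ := hφ.analyticOnNhd hΩ
  have aψ := hψ.analyticOnNhd hΩ
  have hM : MeromorphicOn (ψ / φ) Ω := fun t ht => (aψ t ht).meromorphicAt.div (aφ t ht).meromorphicAt
  have hne' : ∀ t ∈ Ω, ∀ᶠ s in 𝓝[≠] t, φ s ≠ 0 := by
    intro t ht
    rcases (aφ t ht).eventually_eq_zero_or_eventually_ne_zero with h | h
    · exact absurd (aφ.eqOn_zero_of_preconnected_of_eventuallyEq_zero hc ht h ht₀) hne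
    · exact h
  have hord : ∀ t ∈ Ω, 0 ≤ meromorphicOrderAt (ψ / φ) t := by
    intro t ht
    have hq := hM t ht
    have hfin : meromorphicOrderAt φ t ≠ ⊤ := by
      intro h
      rw [meromorphicOrderAt_eq_top_iff] at h
      obtain ⟨s, h1, h2⟩ := (h.and (hne' t ht)).exists
      exact h2 h1
    obtain ⟨a, hae⟩ := WithTop.ne_top_iff_exists.1 hfin
    by_cases htop : meromorphicOrderAt (ψ / φ) t = ⊤
    · rw [htop]; exact le_top
    obtain ⟨c, hce⟩ := WithTop.ne_top_iff_exists.1 htop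
    rw [← hce]
    have key : ∀ k : ℕ, 0 ≤ ((k:ℤ) + 1) * c + a := by
      intro k
      have e : (ψ / φ) ^ (k + 1) * φ =ᶠ[𝓝[≠] t] χ k := by
        filter_upwards [hne' t ht, mem_nhdsWithin_of_mem_nhds (hΩ.mem_nhds ht)] with s h1 h2
        have := hrel k s h2
        simp only [Pi.mul_apply, Pi.pow_apply, Pi.div_apply, div_pow, this, pow_succ (φ s) k]
        field_simp
      have h1 := meromorphicOrderAt_congr e
      rw [meromorphicOrderAt_mul (hq.pow _) (aφ t ht).meromorphicAt, meromorphicOrderAt_pow hq, ← hce, ← hae] at h1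
      have h2 := ((hχ k).analyticOnNhd hΩ t ht).meromorphicOrderAt_nonneg
      rw [← h1] at h2
      exact_mod_cast h2
    have : 0 ≤ c := by
      by_contra hcn
      have := key a.natAbs
      have h3 : a ≤ (a.natAbs : ℤ) := Int.le_natAbs
      have h4 : (0:ℤ) ≤ a.natAbs := by positivity
      nlinarith
    exact_mod_cast this
  set h := toMeromorphicNFOn (ψ / φ) Ω with hh
  have ha : ∀ t ∈ Ω, AnalyticAt ℂ h t := by
    intro t ht
    rw [← (meromorphicNFOn_toMeromorphicNFOn (ψ / φ) Ω ht).meromorphicOrderAt_nonneg_iff_analyticAt,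
      meromorphicOrderAt_toMeromorphicNFOn hM ht]
    exact hord t ht
  refine ⟨h, fun t ht => (ha t ht).differentiableAt.differentiableWithinAt, fun t ht => ?_⟩
  have e := hM.toMeromorphicNFOn_eq_self_on_nhdsNE ht
  have e2 : (fun s => φ s * h s) =ᶠ[𝓝[≠] t] ψ := by
    filter_upwards [e, hne' t ht] with s h1 h2
    simp only [hh, h1, Pi.div_apply]
    field_simp
  exact tendsto_nhds_unique_of_eventuallyEq
    (((aφ t ht).continuousAt.mul (ha t ht).continuousAt).tendsto.mono_left nhdsWithin_le_nhds)
    ((aψ t ht).continuousAt.tendsto.mono_left nhdsWithin_le_nhds) e2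

end FBHProof
end

section
open MeasureTheory Metric Set Filter Topology

namespace FBHProof

variable {ι : Type*} [Fintype ι] [DecidableEq ι]

theorem line_convex (x v p : ι → ℂ) (r : ℝ) : Convex ℝ {t : ℂ | x + t • v ∈ ball p r} := by
  have e : {t : ℂ | x + t • v ∈ ball p r} = (fun t : ℂ => t • v) ⁻¹' ((fun z => x + z) ⁻¹' ball p r) := rfl
  rw [e]
  exact ((convex_ball p r).translate_preimage_right x).is_linear_preimage
    (f := fun t : ℂ => t • v) ⟨fun s t => add_smul _ _ _, fun c t => by simp [mul_smul]⟩

theorem local_div {G : Set (ι → ℂ)} (hG : IsOpen G) (hc : IsPreconnected G) {U V : (ι → ℂ) → ℂ}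
    {χ : ℕ → (ι → ℂ) → ℂ} (hU : DifferentiableOn ℂ U G) (hV : DifferentiableOn ℂ V G)
    (hχ : ∀ k, DifferentiableOn ℂ (χ k) G) (hrel : ∀ k, ∀ x ∈ G, V x ^ (k + 1) = U x ^ k * χ k x)
    {b : ι → ℂ} (hb : b ∈ G) (hUb : U b ≠ 0) {p : ι → ℂ} (hp : p ∈ G) :
    ∃ N, IsOpen N ∧ p ∈ N ∧ N ⊆ G ∧ ∃ F : (ι → ℂ) → ℂ, DifferentiableOn ℂ F N ∧ ∀ x ∈ N, U x * F x = V x := by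
  obtain ⟨r, hr, hrG⟩ := Metric.isOpen_iff.1 hG p hp
  obtain ⟨y, hUy, hy⟩ := ((ident_freq hG hc hU hb hUb hp).and_eventually (ball_mem_nhds p (half_pos hr))).exists
  set v := y - p with hv
  have hvn : ‖v‖ < r / 2 := by rwa [dist_eq_norm] at hy
  have hin : ∀ x ∈ ball p (r/2), ∀ t : ℂ, ‖t‖ ≤ 1 → x + t • v ∈ ball p r := by
    intro x hx t ht
    rw [mem_ball, dist_eq_norm] at hx ⊢
    calc ‖x + t • v - p‖ = ‖(x - p) + t • v‖ := by congr 1; abel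
      _ ≤ ‖x - p‖ + ‖t‖ * ‖v‖ := (norm_add_le _ _).trans (by rw [norm_smul])
      _ < r := by nlinarith [norm_nonneg v, norm_nonneg t]
  have hΩo : ∀ x : ι → ℂ, IsOpen {t : ℂ | x + t • v ∈ ball p r} := fun x =>
    isOpen_ball.preimage (by fun_prop : Continuous fun t : ℂ => x + t • v)
  have hΩc : ∀ x : ι → ℂ, IsPreconnected {t : ℂ | x + t • v ∈ ball p r} := fun x =>
    (line_convex x v p r).isPreconnected
  have hld : ∀ {g : (ι → ℂ) → ℂ}, DifferentiableOn ℂ g G → ∀ x, DifferentiableOn ℂ (fun t : ℂ => g (x + t • v))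
      {t : ℂ | x + t • v ∈ ball p r} := fun hg x t ht =>
    (line_diffAt (hg.differentiableAt (hG.mem_nhds (hrG ht)))).differentiableWithinAt
  have hpb : p ∈ ball p (r/2) := mem_ball_self (half_pos hr)
  have hev : ∀ᶠ t in 𝓝[≠] (0:ℂ), U (p + t • v) ≠ 0 := by
    have ha := (hld hU p).analyticOnNhd (hΩo p)
    have h0 : (0:ℂ) ∈ {t : ℂ | p + t • v ∈ ball p r} := hin p hpb 0 (by simp)
    rcases (ha 0 h0).eventually_eq_zero_or_eventually_ne_zero with h | h
    · have := ha.eqOn_zero_of_preconnected_of_eventuallyEq_zero (hΩc p) h0 h (x := 1) (hin p hpb 1 (by simp))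
      exfalso; apply hUy; simpa [hv] using this
    · exact h
  obtain ⟨ε, hε, hεU⟩ := Metric.eventually_nhds_iff.1 (eventually_nhdsWithin_iff.1 hev)
  set ρ := min ε 1 / 2 with hρd
  have hm : 0 < min ε 1 := lt_min hε one_pos
  have hρ : 0 < ρ := by positivity
  have hρ1 : ρ < 1 := by have := min_le_right ε 1; linarith
  have hρε : ρ < ε := by have := min_le_left ε 1; linarith
  have hUρ : ∀ t ∈ sphere (0:ℂ) ρ, U (p + t • v) ≠ 0 := by
    intro t ht
    have ht' : ‖t‖ = ρ := by simpa using ht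
    refine hεU (by rw [dist_zero_right, ht']; exact hρε) ?_
    rintro rfl
    simp at ht'; linarith
  have ev : ∀ᶠ x in 𝓝 p, ∀ t ∈ sphere (0:ℂ) ρ, U (x + t • v) ≠ 0 := by
    refine (isCompact_sphere _ _).eventually_forall_of_forall_eventually fun t ht => ?_
    have hmem : p + t • v ∈ G := hrG (hin p hpb t (by have : ‖t‖ = ρ := by simpa using ht
                                                      linarith))
    have : ContinuousAt (fun z : (ι → ℂ) × ℂ => U (z.1 + z.2 • v)) (p, t) :=
      ContinuousAt.comp (f := fun z : (ι → ℂ) × ℂ => z.1 + z.2 • v) (g := U)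
        ((hU.continuousOn).continuousAt (hG.mem_nhds hmem)) (by fun_prop)
    exact this.eventually_ne (hUρ t ht)
  obtain ⟨N, hNsub, hNo, hpN⟩ := _root_.mem_nhds_iff.1 (ev.and (ball_mem_nhds p (half_pos hr)))
  have hcm : ∀ a, circleMap 0 ρ a ∈ sphere (0:ℂ) ρ := fun a => circleMap_mem_sphere 0 hρ.le a
  have hcn : ∀ a, ‖circleMap 0 ρ a‖ ≤ 1 := fun a => by
    have : ‖circleMap 0 ρ a‖ = ρ := by simpa using hcm a
    linarith
  have hNG : ∀ x ∈ N, ∀ t : ℂ, ‖t‖ ≤ 1 → x + t • v ∈ G := fun x hx t ht => hrG (hin x (hNsub hx).2 t ht)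
  refine ⟨N, hNo, hpN, fun x hx => by simpa using hNG x hx 0 (by simp),
    fun x => (2 * (Real.pi:ℂ))⁻¹ * ∫ a in Ioc (0:ℝ) (2 * Real.pi), V (x + circleMap 0 ρ a • v) / U (x + circleMap 0 ρ a • v), ?_, ?_⟩
  · refine DifferentiableOn.const_mul (holo_circle hNo ?_ ?_) _
    · intro a x hx
      have hm' := hG.mem_nhds (hNG x hx _ (hcn a))
      have hd : DifferentiableAt ℂ (fun x : ι → ℂ => x + circleMap 0 ρ a • v) x := by fun_prop
      have d1 : DifferentiableAt ℂ (fun x => V (x + circleMap 0 ρ a • v)) x :=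
        DifferentiableAt.comp x (hV.differentiableAt hm') hd
      have d2 : DifferentiableAt ℂ (fun x => U (x + circleMap 0 ρ a • v)) x :=
        DifferentiableAt.comp x (hU.differentiableAt hm') hd
      simp only [div_eq_mul_inv]
      exact (d1.mul (d2.inv ((hNsub hx).1 _ (hcm a)))).differentiableWithinAt
    · have hcc : Continuous (fun z : (ι → ℂ) × ℝ => z.1 + circleMap 0 ρ z.2 • v) := by
        have := continuous_circleMap 0 ρ
        fun_prop
      have hmt : MapsTo (fun z : (ι → ℂ) × ℝ => z.1 + circleMap 0 ρ z.2 • v) (N ×ˢ univ) G :=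
        fun z hz => hNG z.1 hz.1 _ (hcn z.2)
      exact (hV.continuousOn.comp hcc.continuousOn hmt).div (hU.continuousOn.comp hcc.continuousOn hmt)
        fun z hz => (hNsub hz.1).1 _ (hcm z.2)
  · intro x hx
    have hxb := (hNsub hx).2
    obtain ⟨h, hhd, hhe⟩ := div1v (hΩo x) (hΩc x) (hld hU x) (hld hV x) (χ := fun k t => χ k (x + t • v))
      (fun k => hld (hχ k) x) (fun k t ht => hrel k _ (hrG ht)) (t₀ := circleMap 0 ρ 0) (hin x hxb _ (hcn 0))
      ((hNsub hx).1 _ (hcm 0))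
    have hsub : closedBall (0:ℂ) ρ ⊆ {t : ℂ | x + t • v ∈ ball p r} := fun t ht => hin x hxb t (by
      have : ‖t‖ ≤ ρ := by simpa using ht
      linarith)
    have hav := DiffContOnCl.circleAverage (f := h) (c := 0) (R := ρ) (by
      rw [abs_of_pos hρ]
      apply DifferentiableOn.diffContOnCl
      rw [closure_ball _ hρ.ne']
      exact hhd.mono hsub)
    rw [Real.circleAverage_def, intervalIntegral.integral_of_le (by positivity)] at hav
    have e : ∀ a, V (x + circleMap 0 ρ a • v) / U (x + circleMap 0 ρ a • v) = h (circleMap 0 ρ a) := by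
      intro a
      rw [div_eq_iff ((hNsub hx).1 _ (hcm a)), mul_comm]
      exact (hhe _ (hin x hxb _ (hcn a))).symm
    simp only [e]
    have h0 := hhe 0 (hin x hxb 0 (by simp))
    simp only [zero_smul, add_zero] at h0
    rw [← h0, ← hav, Complex.real_smul]
    push_cast
    ring

theorem glob_div {G : Set (ι → ℂ)} (hG : IsOpen G) (hc : IsPreconnected G) {U V : (ι → ℂ) → ℂ}
    {χ : ℕ → (ι → ℂ) → ℂ} (hU : DifferentiableOn ℂ U G) (hV : DifferentiableOn ℂ V G)
    (hχ : ∀ k, DifferentiableOn ℂ (χ k) G) (hrel : ∀ k, ∀ x ∈ G, V x ^ (k + 1) = U x ^ k * χ k x)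
    {b : ι → ℂ} (hb : b ∈ G) (hUb : U b ≠ 0) :
    ∃ F : (ι → ℂ) → ℂ, DifferentiableOn ℂ F G ∧ ∀ x ∈ G, U x * F x = V x := by
  have key := fun p (hp : p ∈ G) => local_div hG hc hU hV hχ hrel hb hUb hp
  choose! N hNo hpN hNG F hFd hFe using key
  have heq : ∀ p ∈ G, ∀ x ∈ N p, F x x = F p x := by
    intro p hp x hx
    have hxG := hNG p hp hx
    have n1 := (hNo p hp).mem_nhds hx
    have n2 := (hNo x hxG).mem_nhds (hpN x hxG)
    have hfr : ∃ᶠ y in 𝓝 x, F x y = F p y := by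
      refine ((ident_freq hG hc hU hb hUb hxG).and_eventually (Filter.inter_mem n1 n2)).mono ?_
      rintro y ⟨h1, h2, h3⟩
      exact mul_left_cancel₀ h1 ((hFe x hxG y h3).trans (hFe p hp y h2).symm)
    exact tendsto_nhds_unique_of_frequently_eq
      ((hFd x hxG).differentiableAt n2).continuousAt.tendsto
      ((hFd p hp).differentiableAt n1).continuousAt.tendsto hfr
  refine ⟨fun x => F x x, fun p hp => ?_, fun x hx => hFe x hx x (hpN x hx)⟩
  have n1 := (hNo p hp).mem_nhds (hpN p hp)
  refine (((hFd p hp).differentiableAt n1).congr_of_eventuallyEq ?_).differentiableWithinAt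
  filter_upwards [n1] with x hx
  exact heq p hp x hx

/-- division with the relations given only on an open subset -/
theorem div_ext {G D : Set (ι → ℂ)} (hG : IsOpen G) (hc : IsPreconnected G) (hD : IsOpen D) (hDG : D ⊆ G)
    {u f : (ι → ℂ) → ℂ} (hf : DifferentiableOn ℂ f D) {W : ℕ → (ι → ℂ) → ℂ}
    (hW : ∀ k, DifferentiableOn ℂ (W k) G) (hWu : ∀ k, ∀ x ∈ D, W k x = u x * f x ^ k)
    (hDc : IsPreconnected D) {b : ι → ℂ} (hb : b ∈ D) (hub : u b ≠ 0) :
    ∃ F : (ι → ℂ) → ℂ, DifferentiableOn ℂ F G ∧ ∀ x ∈ D, F x = f x := by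
  have hWb : W 0 b ≠ 0 := by rw [hWu 0 b hb]; simpa using hub
  have hrel : ∀ k, ∀ x ∈ G, W 1 x ^ (k + 1) = W 0 x ^ k * W (k + 1) x := by
    intro k x hx
    rw [← sub_eq_zero]
    refine ident hG hc (g := fun x => W 1 x ^ (k + 1) - W 0 x ^ k * W (k + 1) x)
      (((hW 1).pow _).sub (((hW 0).pow _).mul (hW _))) (hDG hb) ?_ x hx
    filter_upwards [hD.mem_nhds hb] with y hy
    rw [hWu _ y hy, hWu _ y hy, hWu _ y hy]
    ring
  obtain ⟨F, hFd, hFe⟩ := glob_div hG hc (hW 0) (hW 1) (fun k => hW (k + 1)) hrel (hDG hb) hWb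
  refine ⟨F, hFd, fun x hx => ?_⟩
  have hfr : ∃ᶠ y in 𝓝 x, F y = f y := by
    refine ((ident_freq hD hDc ((hW 0).mono hDG) hb hWb hx).and_eventually (hD.mem_nhds hx)).mono ?_
    rintro y ⟨h1, h2⟩
    refine mul_left_cancel₀ h1 ?_
    rw [hFe y (hDG h2), hWu _ y h2, hWu _ y h2]
    ring
  exact tendsto_nhds_unique_of_frequently_eq
    (hFd.differentiableAt (hG.mem_nhds (hDG hx))).continuousAt.tendsto
    (hf.differentiableAt (hD.mem_nhds hx)).continuousAt.tendsto hfr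

theorem sg_preconn (S : Finset ι) {μ : ℝ} (hμ : 0 ≤ μ) {c : ℝ} (hc : 0 < c) : IsPreconnected {x : ι → ℂ | sg S μ x < c} := by
  refine isPreconnected_of_forall 0 fun x hx => ?_
  refine ⟨segment ℝ 0 x, ?_, left_mem_segment _ _ _, right_mem_segment _ _ _, (convex_segment 0 x).isPreconnected⟩
  rw [segment_eq_image']
  rintro _ ⟨t, ht, rfl⟩
  have hXX : ∀ T : Finset ι, XX T (0 + t • (x - 0)) ≤ XX T x := by
    intro T
    refine Finset.sum_le_sum fun i _ => ?_
    simp only [zero_add, sub_zero, Pi.smul_apply, norm_smul, Real.norm_eq_abs, abs_of_nonneg ht.1]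
    have := norm_nonneg (x i)
    have h2 : t * ‖x i‖ ≤ ‖x i‖ := mul_le_of_le_one_left this ht.2
    have h3 : 0 ≤ t * ‖x i‖ := mul_nonneg ht.1 this
    gcongr
  refine lt_of_le_of_lt (b := sg S μ x) ?_ hx
  unfold sg
  have := XX_nonneg Sᶜ (0 + t • (x - 0))
  gcongr
  · exact XX_nonneg _ _
  · exact hXX _
  · exact hXX _

/-- main theorem in coordinates -/
theorem main_coord {S S' : Finset ι} {μ μ' : ℝ} (hμ : 0 < μ) (hμ' : 0 < μ') (hS : S'.Nonempty) (hSc : S'ᶜ.Nonempty)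
    {f : (ι → ℂ) → (ι → ℂ)} (hf : ∀ k, DifferentiableOn ℂ (fun y => f y k) (Dm S μ))
    (hmaps : ∀ x ∈ Dm S μ, f x ∈ Dm S' μ') (hP : Prp (Dm S μ) f (Dm S' μ')) :
    ∃ G, IsOpen G ∧ closure (Dm S μ) ⊆ G ∧ ∃ F : (ι → ℂ) → (ι → ℂ), DifferentiableOn ℂ F G ∧ ∀ x ∈ Dm S μ, F x = f x := by
  have hD := isOpen_Dm S μ
  obtain ⟨K, hKD, hK, hrep⟩ := bergman_rep hD hf hμ' hS hSc hP hmaps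
  obtain ⟨s, hs, hext⟩ := ext_lemma hK hKD
  have hs2 : 1 < s ^ 2 := by nlinarith
  have h0 : (0 : ι → ℂ) ∈ Dm S μ := by
    simp [Dm, sg, XX_zero]
  haveI : Nonempty ι := ⟨hS.choose⟩
  obtain ⟨b, hb, hub⟩ := jdet_ne hD hf h0 (hP _ (by simpa using hmaps 0 h0) isCompact_singleton)
  have hu := jdet_holo hD hf
  have hGo : IsOpen {x : ι → ℂ | sg S μ x < s ^ 2} := isOpen_lt (sg_contDiff S μ).continuous continuous_const
  have hex : ∀ j, ∃ F : (ι → ℂ) → ℂ, DifferentiableOn ℂ F {x : ι → ℂ | sg S μ x < s ^ 2} ∧ ∀ x ∈ Dm S μ, F x = f x j := by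
    intro j
    have := fun k => hext (fun x => jdet f x * f x j ^ k) (hu.mul ((hf j).pow k)) (hrep j k).1 (hrep j k).2
    choose W hW hWe using this
    exact div_ext hGo (sg_preconn S hμ.le (by positivity)) hD (fun x hx => lt_trans hx hs2) (hf j) hW hWe
      (sg_preconn S hμ.le one_pos) hb hub
  choose F hF hFe using hex
  refine ⟨_, hGo, ?_, fun x j => F j x, differentiableOn_pi.2 hF, fun x hx => funext fun j => hFe j x hx⟩
  intro x hx
  have : closure (Dm S μ) ⊆ {x | sg S μ x ≤ 1} :=
    closure_minimal (fun x hx => le_of_lt (show sg S μ x < 1 from hx)) (isClosed_le (sg_contDiff S μ).continuous continuous_const)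
  exact lt_of_le_of_lt (show sg S μ x ≤ 1 from this hx) hs2

end FBHProof
end

section
open MeasureTheory Metric Set Filter Topology

namespace FBHProof

variable {ι : Type*} [Fintype ι] [DecidableEq ι]

/-- coordinates -/
def coordL {n m : ℕ} (e : Fin n ⊕ Fin m ≃ ι) :
    (EuclideanSpace ℂ (Fin n) × EuclideanSpace ℂ (Fin m)) ≃ₗ[ℂ] (ι → ℂ) where
  toFun p i := Sum.elim (fun a => p.1 a) (fun a => p.2 a) (e.symm i)
  invFun x := (WithLp.toLp 2 fun a => x (e (Sum.inl a)), WithLp.toLp 2 fun a => x (e (Sum.inr a)))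
  map_add' p q := by
    funext i
    simp only [Pi.add_apply]
    cases e.symm i <;> simp
  map_smul' c p := by
    funext i
    simp only [Pi.smul_apply]
    cases e.symm i <;> simp
  left_inv p := by
    ext i <;> simp
  right_inv x := by
    funext i
    obtain ⟨j, rfl⟩ := e.surjective i
    rcases j with j | j <;> simp

/-- coordinates, continuous version -/
noncomputable def coord {n m : ℕ} (e : Fin n ⊕ Fin m ≃ ι) :
    (EuclideanSpace ℂ (Fin n) × EuclideanSpace ℂ (Fin m)) ≃L[ℂ] (ι → ℂ) :=
  (coordL e).toContinuousLinearEquiv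

theorem coord_inl {n m : ℕ} (e : Fin n ⊕ Fin m ≃ ι) (p) (a : Fin n) : coord e p (e (Sum.inl a)) = p.1 a := by
  change Sum.elim (fun a => p.1 a) (fun a => p.2 a) (e.symm _) = _
  simp

theorem coord_inr {n m : ℕ} (e : Fin n ⊕ Fin m ≃ ι) (p) (a : Fin m) : coord e p (e (Sum.inr a)) = p.2 a := by
  change Sum.elim (fun a => p.1 a) (fun a => p.2 a) (e.symm _) = _
  simp

/-- first block of coordinates -/
def cS {n m : ℕ} (e : Fin n ⊕ Fin m ≃ ι) : Finset ι :=
  Finset.univ.image fun a : Fin n => e (Sum.inl a)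

theorem cS_compl {n m : ℕ} (e : Fin n ⊕ Fin m ≃ ι) : (cS e)ᶜ = Finset.univ.image fun a : Fin m => e (Sum.inr a) := by
  ext i
  obtain ⟨j, rfl⟩ := e.surjective i
  rcases j with j | j <;> simp [cS]

theorem mem_coord {n m : ℕ} (e : Fin n ⊕ Fin m ≃ ι) (μ : ℝ) (p) : coord e p ∈ Dm (cS e) μ ↔ p ∈ FBH n m μ := by
  have h1 : XX (cS e) (coord e p) = ‖p.1‖ ^ 2 := by
    rw [XX, cS, Finset.sum_image (fun a _ b _ h => Sum.inl_injective (e.injective h)), EuclideanSpace.norm_sq_eq]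
    simp only [coord_inl]
  have h2 : XX (cS e)ᶜ (coord e p) = ‖p.2‖ ^ 2 := by
    rw [XX, cS_compl, Finset.sum_image (fun a _ b _ h => Sum.inr_injective (e.injective h)), EuclideanSpace.norm_sq_eq]
    simp only [coord_inr]
  change sg _ _ _ < 1 ↔ ‖p.2‖ ^ 2 < Real.exp (-μ * ‖p.1‖ ^ 2)
  rw [sg, h1, h2, neg_mul, Real.exp_neg, ← one_div, lt_div_iff₀ (Real.exp_pos _)]

end FBHProof
end

/-- A proper holomorphic mapping between equidimensional Fock–Bargmann–Hartogs
domains extends holomorphically to an open neighborhood of the closure of the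
source domain. -/
theorem proper_holomorphic_extends_past_boundary
    (n m n' m' : ℕ) (hn : 0 < n) (hm : 0 < m) (hn' : 0 < n') (hm' : 0 < m')
    (hdim : n + m = n' + m') (μ μ' : ℝ) (hμ : 0 < μ) (hμ' : 0 < μ')
    (f : EuclideanSpace ℂ (Fin n) × EuclideanSpace ℂ (Fin m) →
      EuclideanSpace ℂ (Fin n') × EuclideanSpace ℂ (Fin m'))
    (hol : DifferentiableOn ℂ f (FBH n m μ))
    (hmaps : Set.MapsTo f (FBH n m μ) (FBH n' m' μ'))
    (hproper : ∀ K : Set (EuclideanSpace ℂ (Fin n') × EuclideanSpace ℂ (Fin m')),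
      K ⊆ FBH n' m' μ' → IsCompact K → IsCompact (f ⁻¹' K ∩ FBH n m μ)) :
    ∃ G : Set (EuclideanSpace ℂ (Fin n) × EuclideanSpace ℂ (Fin m)),
      IsOpen G ∧ closure (FBH n m μ) ⊆ G ∧
      ∃ F : EuclideanSpace ℂ (Fin n) × EuclideanSpace ℂ (Fin m) →
          EuclideanSpace ℂ (Fin n') × EuclideanSpace ℂ (Fin m'),
        DifferentiableOn ℂ F G ∧ ∀ x ∈ FBH n m μ, F x = f x := by
  classical
  obtain ⟨e'⟩ : Nonempty (Fin n' ⊕ Fin m' ≃ Fin n ⊕ Fin m) :=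
    ⟨Fintype.equivOfCardEq (by simp [hdim])⟩
  set Φ := FBHProof.coord (Equiv.refl (Fin n ⊕ Fin m)) with hΦ
  set Ψ := FBHProof.coord e' with hΨ
  have mΦ : ∀ p, Φ p ∈ FBHProof.Dm _ μ ↔ p ∈ FBH n m μ := FBHProof.mem_coord _ μ
  have mΨ : ∀ p, Ψ p ∈ FBHProof.Dm _ μ' ↔ p ∈ FBH n' m' μ' := FBHProof.mem_coord _ μ'
  set S := FBHProof.cS (Equiv.refl (Fin n ⊕ Fin m))
  set S' := FBHProof.cS e' with hS'
  have mΦ' : ∀ x, Φ.symm x ∈ FBH n m μ ↔ x ∈ FBHProof.Dm S μ := fun x => by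
    rw [← mΦ, Φ.apply_symm_apply]
  have hg : DifferentiableOn ℂ (fun x => Ψ (f (Φ.symm x))) (FBHProof.Dm S μ) :=
    Ψ.differentiable.comp_differentiableOn
      (hol.comp Φ.symm.differentiable.differentiableOn fun x hx => (mΦ' x).2 hx)
  obtain ⟨G, hG, hcl, F, hF, hFe⟩ := FBHProof.main_coord (S := S) (S' := S') (f := fun x => Ψ (f (Φ.symm x))) hμ hμ'
    ⟨e' (Sum.inl ⟨0, hn'⟩), by simp [hS', FBHProof.cS]⟩
    ⟨e' (Sum.inr ⟨0, hm'⟩), by rw [hS', FBHProof.cS_compl]; simp⟩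
    (fun k => differentiableOn_pi.1 hg k)
    (fun x hx => (mΨ _).2 (hmaps ((mΦ' x).2 hx)))
    (by
      intro K hK hKc
      have h1 := hproper (Ψ.symm '' K) (by
        rintro _ ⟨y, hy, rfl⟩
        rw [← mΨ, Ψ.apply_symm_apply]
        exact hK hy) (hKc.image Ψ.symm.continuous)
      convert h1.image Φ.continuous using 1
      ext x
      constructor
      · rintro ⟨h2, h3⟩
        exact ⟨Φ.symm x, ⟨⟨_, h2, by simp⟩, (mΦ' x).2 h3⟩, by simp⟩
      · rintro ⟨p, ⟨⟨y, hy, hyp⟩, h3⟩, rfl⟩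
        refine ⟨?_, (mΦ p).2 h3⟩
        change Ψ (f (Φ.symm (Φ p))) ∈ K
        rw [Φ.symm_apply_apply, ← hyp, Ψ.apply_symm_apply]
        exact hy)
  refine ⟨Φ ⁻¹' G, hG.preimage Φ.continuous, ?_, fun p => Ψ.symm (F (Φ p)), ?_, ?_⟩
  · intro p hp
    apply hcl
    have hsub : Φ '' closure (FBH n m μ) ⊆ closure (Φ '' FBH n m μ) := image_closure_subset_closure_image Φ.continuous
    refine closure_mono ?_ (hsub ⟨p, hp, rfl⟩)
    rintro _ ⟨q, hq, rfl⟩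
    exact (mΦ q).2 hq
  · exact Ψ.symm.differentiable.comp_differentiableOn
      (hF.comp Φ.differentiable.differentiableOn fun x hx => hx)
  · intro x hx
    simp only [hFe (Φ x) ((mΦ x).2 hx), ContinuousLinearEquiv.symm_apply_apply]
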